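/- Let K be an algebraically closed field of arbitrary characteristic and n, m positive integers. The ring of matrix invariants S(n,m) = K[Mat_{n,n}^m]^{GL_n} is a Cohen-Macaulay ring. -/

import Mathlib

open MvPolynomial Matrix

/-- The depth of a local ring: the supremum of lengths of regular sequences contained
in the maximal ideal. -/
noncomputable def localRingDepth (R : Type) [CommRing R] [IsLocalRing R] :
    WithBot (WithTop ℕ) :=
  sSup { n : WithBot (WithTop ℕ) | ∃ rs : List R, (rs.length : WithBot (WithTop ℕ)) = n ∧
    RingTheory.Sequence.IsRegular R rs ∧ ∀ r ∈ rs, r ∈ IsLocalRing.maximalIdeal R }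

/-- A commutative ring is Cohen-Macaulay if the localization at every maximal ideal
has depth equal to its Krull dimension. -/
def IsCohenMacaulayRing (R : Type) [CommRing R] : Prop :=
  ∀ (p : Ideal R) (hp : p.IsMaximal),
    haveI := hp.isPrime
    localRingDepth (Localization.AtPrime p) = ringKrullDim (Localization.AtPrime p)

open MvPolynomial Matrix

/-- Coordinate functions of an `m`-tuple of `n × n` matrices. -/
def matCoords {K : Type} [Field K] {n m : ℕ} (X : Fin m → Matrix (Fin n) (Fin n) K) :
    Fin m × Fin n × Fin n → K :=
  fun p => X p.1 p.2.1 p.2.2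

/-- The ring of matrix semi-invariants `R(n,m) = K[Mat_{n,n}^m]^{SL_n × SL_n}`, where
`(A,B)` acts by `(X_1, …, X_m) ↦ (A X_1 B⁻¹, …, A X_m B⁻¹)`. -/
noncomputable def matrixSemiInvariants (K : Type) [Field K] (n m : ℕ) :
    Subalgebra K (MvPolynomial (Fin m × Fin n × Fin n) K) :=
  ⨅ (A : SpecialLinearGroup (Fin n) K) (B : SpecialLinearGroup (Fin n) K)
    (X : Fin m → Matrix (Fin n) (Fin n) K),
      AlgHom.equalizer
        (aeval (matCoords fun i => A.val * X i * (B⁻¹).val))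
        (aeval (matCoords X))

/-- The ring of matrix invariants `S(n,m) = K[Mat_{n,n}^m]^{GL_n}`, where `A` acts by
simultaneous conjugation. -/
noncomputable def matrixInvariants (K : Type) [Field K] (n m : ℕ) :
    Subalgebra K (MvPolynomial (Fin m × Fin n × Fin n) K) :=
  ⨅ (A : GeneralLinearGroup (Fin n) K) (X : Fin m → Matrix (Fin n) (Fin n) K),
      AlgHom.equalizer
        (aeval (matCoords fun i => A.val * X i * (A⁻¹).val))
        (aeval (matCoords X))


namespace CMProof

abbrev MV (n m : ℕ) := Fin m × Fin n × Fin n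

/-- coordinates of a tuple of matrices over any type -/
def ev {n m : ℕ} {E : Type*} (Y : Fin m → Matrix (Fin n) (Fin n) E) : MV n m → E :=
  fun v => Y v.1 v.2.1 v.2.2

/-- generic matrices -/
noncomputable def Xg (n m : ℕ) (R : Type*) [CommSemiring R] (l : Fin m) :
    Matrix (Fin n) (Fin n) (MvPolynomial (MV n m) R) :=
  Matrix.of fun a b => X (l, a, b)

lemma mem_S_iff {K : Type} [Field K] {n m : ℕ} {f : MvPolynomial (MV n m) K} :
    f ∈ matrixInvariants K n m ↔ ∀ (A : GeneralLinearGroup (Fin n) K)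
      (Y : Fin m → Matrix (Fin n) (Fin n) K),
      aeval (ev fun l => A.val * Y l * (A⁻¹).val) f = aeval (ev Y) f := by
  simp only [matrixInvariants, Algebra.mem_iInf, AlgHom.mem_equalizer]
  rfl

/-- ring for the universal identity: variables of a matrix `G`, and of the tuple `Y` -/
abbrev GY (n m : ℕ) (R : Type*) [CommRing R] := MvPolynomial ((Fin n × Fin n) ⊕ MV n m) R

noncomputable def Gg (n m : ℕ) (R : Type*) [CommRing R] : Matrix (Fin n) (Fin n) (GY n m R) :=
  Matrix.of fun a b => X (Sum.inl (a, b))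

noncomputable def Yg (n m : ℕ) (R : Type*) [CommRing R] (l : Fin m) :
    Matrix (Fin n) (Fin n) (GY n m R) :=
  Matrix.of fun a b => X (Sum.inr (l, a, b))

/-- invariance defect -/
noncomputable def Lam (n m : ℕ) (R : Type*) [CommRing R] :
    MvPolynomial (MV n m) R →ₗ[R] GY n m R :=
  (aeval (ev fun l => Gg n m R * Yg n m R l * (Gg n m R).adjugate)).toLinearMap -
  (aeval (ev fun l => (Gg n m R).det • Yg n m R l)).toLinearMap

lemma Lam_map {n m : ℕ} {R R' : Type*} [CommRing R] [CommRing R'] (θ : R →+* R')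
    (f : MvPolynomial (MV n m) R) : Lam n m R' (map θ f) = map θ (Lam n m R f) := by
  have hG : (Gg n m R).map (map θ) = Gg n m R' := by ext a b; simp [Gg]
  have hY : ∀ l, (Yg n m R l).map (map θ) = Yg n m R' l := by intro l; ext a b; simp [Yg]
  simp only [Lam, LinearMap.sub_apply, AlgHom.toLinearMap_apply, map_sub, aeval_def, eval₂_map]
  congr 1
  · rw [← MvPolynomial.coe_eval₂Hom, ← MvPolynomial.coe_eval₂Hom, ← RingHom.comp_apply]
    congr 1
    apply MvPolynomial.ringHom_ext
    · intro r; simp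
    · intro v
      simp only [ev, coe_eval₂Hom, eval₂_X, RingHom.comp_apply]
      rw [← Matrix.map_apply (f := map θ), Matrix.map_mul, Matrix.map_mul, hY, hG,
        ← RingHom.mapMatrix_apply, RingHom.map_adjugate, RingHom.mapMatrix_apply, hG]
  · rw [← MvPolynomial.coe_eval₂Hom, ← MvPolynomial.coe_eval₂Hom, ← RingHom.comp_apply]
    congr 1
    apply MvPolynomial.ringHom_ext
    · intro r; simp
    · intro v
      simp only [ev, coe_eval₂Hom, eval₂_X, RingHom.comp_apply, Matrix.smul_apply, smul_eq_mul,
        map_mul, RingHom.map_det, RingHom.mapMatrix_apply, hG]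
      rw [← hY, Matrix.map_apply]

lemma Lam_eval {n m : ℕ} {R E : Type*} [CommRing R] [CommRing E] [Algebra R E]
    (g : Matrix (Fin n) (Fin n) E) (Y : Fin m → Matrix (Fin n) (Fin n) E)
    (f : MvPolynomial (MV n m) R) :
    aeval (Sum.elim (fun p : Fin n × Fin n => g p.1 p.2) (ev Y)) (Lam n m R f) =
      aeval (ev fun l => g * Y l * g.adjugate) f - aeval (ev fun l => g.det • Y l) f := by
  set φ : GY n m R →ₐ[R] E := aeval (Sum.elim (fun p : Fin n × Fin n => g p.1 p.2) (ev Y))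
  have hG : (Gg n m R).map φ = g := by ext a b; simp [Gg, φ]
  have hY : ∀ l, (Yg n m R l).map φ = Y l := by intro l; ext a b; simp [Yg, φ, ev]
  simp only [Lam, LinearMap.sub_apply, AlgHom.toLinearMap_apply, map_sub]
  rw [← AlgHom.comp_apply, ← AlgHom.comp_apply, comp_aeval, comp_aeval]
  congr 3
  · funext v
    simp only [ev]
    rw [← Matrix.map_apply (f := φ), Matrix.map_mul, Matrix.map_mul, hY, hG,
      ← AlgHom.mapMatrix_apply, AlgHom.map_adjugate, AlgHom.mapMatrix_apply, hG]
  · funext v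
    simp only [ev, Matrix.smul_apply, smul_eq_mul, map_mul, AlgHom.map_det,
      AlgHom.mapMatrix_apply, hG]
    rw [← hY, Matrix.map_apply]

lemma inv_of_Lam {n m : ℕ} {R E : Type*} [CommRing R] [CommRing E] [Algebra R E]
    {f : MvPolynomial (MV n m) R} (hf : Lam n m R f = 0)
    {g g' : Matrix (Fin n) (Fin n) E} (hg : g * g' = 1) (Y : Fin m → Matrix (Fin n) (Fin n) E) :
    aeval (ev fun l => g * Y l * g') f = aeval (ev Y) f := by
  have hd : g.det * g'.det = 1 := by rw [← det_mul, hg, det_one]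
  have hg' : g' = g'.det • g.adjugate := by
    calc g' = (g'.det * g.det) • g' := by rw [mul_comm, hd, one_smul]
      _ = g'.det • (g.adjugate * g * g') := by rw [adjugate_mul]; simp [mul_smul]
      _ = _ := by rw [Matrix.mul_assoc, hg, Matrix.mul_one]
  have h := Lam_eval g (fun l => g'.det • Y l) f
  rw [hf, map_zero, eq_comm, sub_eq_zero] at h
  have e1 : (fun l => g * (g'.det • Y l) * g.adjugate) = fun l => g * Y l * g' := by
    funext l
    conv_rhs => rw [hg']
    simp
  have e2 : (fun l => g.det • g'.det • Y l) = Y := by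
    funext l; rw [smul_smul, hd, one_smul]
  rwa [e1, e2] at h

lemma mem_S_iff_Lam {K : Type} [Field K] [Infinite K] {n m : ℕ}
    {f : MvPolynomial (MV n m) K} : f ∈ matrixInvariants K n m ↔ Lam n m K f = 0 := by
  constructor
  · intro h
    rw [mem_S_iff] at h
    have hdet : (Gg n m K).det ≠ 0 := by
      intro h0
      have := congrArg (aeval (Sum.elim (fun p : Fin n × Fin n => (1 : Matrix (Fin n) (Fin n) K) p.1 p.2)
        (fun _ : MV n m => (0 : K)))) h0
      rw [AlgHom.map_det, map_zero] at this
      have e : (aeval (Sum.elim (fun p : Fin n × Fin n => (1 : Matrix (Fin n) (Fin n) K) p.1 p.2)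
        (fun _ : MV n m => (0 : K)))).mapMatrix (Gg n m K) = 1 := by
        ext a b; simp [Gg]
      rw [e, det_one] at this
      exact one_ne_zero this
    refine (mul_eq_zero.1 ?_ : (Gg n m K).det = 0 ∨ _).resolve_left hdet
    apply MvPolynomial.funext
    intro x
    rw [map_zero, map_mul]
    let g : Matrix (Fin n) (Fin n) K := Matrix.of fun a b => x (Sum.inl (a, b))
    let Y : Fin m → Matrix (Fin n) (Fin n) K := fun l => Matrix.of fun a b => x (Sum.inr (l, a, b))
    have hx : x = Sum.elim (fun p : Fin n × Fin n => g p.1 p.2) (ev Y) := by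
      funext v; rcases v with v | v <;> rfl
    have e1 : eval x (Gg n m K).det = g.det := by
      rw [RingHom.map_det]; congr 1; ext a b; simp [Gg, g]
    have e2 := Lam_eval g Y f
    have e0 : aeval x (Lam n m K f) = eval x (Lam n m K f) := by
      rw [← coe_aeval_eq_eval]; rfl
    rw [← hx, e0] at e2
    rw [e1, e2]
    by_cases hg : g.det = 0
    · rw [hg, zero_mul]
    · have := h (GeneralLinearGroup.mkOfDetNeZero g hg) (fun l => g.det • Y l)
      have e3 : (fun l => (GeneralLinearGroup.mkOfDetNeZero g hg).val * (g.det • Y l) *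
         ((GeneralLinearGroup.mkOfDetNeZero g hg)⁻¹).val) = fun l => g * Y l * g.adjugate := by
        funext l
        have : ((GeneralLinearGroup.mkOfDetNeZero g hg)⁻¹).val = g⁻¹ := by
          rw [Matrix.coe_units_inv]; rfl
        rw [this, Matrix.inv_def, Ring.inverse_eq_inv']
        change g * (g.det • Y l) * _ = _
        simp [smul_smul, hg]
      rw [e3] at this
      rw [this, sub_self, mul_zero]
  · intro h
    rw [mem_S_iff]
    intro A Y
    exact inv_of_Lam h (by rw [← Units.val_mul, mul_inv_cancel, Units.val_one]) Y

end CMProof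


namespace CMProof

/-! ### torus weights -/
def rowc {n m : ℕ} (α : MV n m →₀ ℕ) (i : Fin n) : ℕ := ∑ v, if v.2.1 = i then α v else 0
def colc {n m : ℕ} (α : MV n m →₀ ℕ) (i : Fin n) : ℕ := ∑ v, if v.2.2 = i then α v else 0
def wt0 {n m : ℕ} (α : MV n m →₀ ℕ) : Prop := ∀ i, rowc α i = colc α i

/-- torus-invariance -/
def TW {n m : ℕ} {R : Type*} [CommSemiring R] (f : MvPolynomial (MV n m) R) : Prop :=
  ∀ α ∈ f.support, wt0 α

lemma prod_pow_rowc {n m : ℕ} {E : Type*} [CommMonoid E] (D : Fin n → E) (α : MV n m →₀ ℕ) :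
    ∏ v : MV n m, D v.2.1 ^ α v = ∏ i, D i ^ rowc α i := by
  simp only [rowc, ← Finset.prod_pow_eq_pow_sum]
  rw [Finset.prod_comm]
  refine Finset.prod_congr rfl fun v _ => ?_
  rw [Finset.prod_eq_single v.2.1]
  · simp
  · intro b _ hb; simp [hb.symm]
  · simp

lemma prod_pow_colc {n m : ℕ} {E : Type*} [CommMonoid E] (D : Fin n → E) (α : MV n m →₀ ℕ) :
    ∏ v : MV n m, D v.2.2 ^ α v = ∏ i, D i ^ colc α i := by
  simp only [colc, ← Finset.prod_pow_eq_pow_sum]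
  rw [Finset.prod_comm]
  refine Finset.prod_congr rfl fun v _ => ?_
  rw [Finset.prod_eq_single v.2.2]
  · simp
  · intro b _ hb; simp [hb.symm]
  · simp

lemma aeval_diag {n m : ℕ} {R E : Type*} [CommRing R] [CommRing E] [Algebra R E]
    (D D' : Fin n → E) (Y : Fin m → Matrix (Fin n) (Fin n) E) (f : MvPolynomial (MV n m) R) :
    aeval (ev fun l => diagonal D * Y l * diagonal D') f =
      ∑ α ∈ f.support, algebraMap R E (coeff α f) *
        ((∏ i, D i ^ rowc α i * D' i ^ colc α i) * ∏ v, ev Y v ^ α v) := by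
  rw [aeval_def, eval₂_eq']
  refine Finset.sum_congr rfl fun α _ => ?_
  congr 1
  rw [Finset.prod_mul_distrib, ← prod_pow_rowc, ← prod_pow_colc, ← Finset.prod_mul_distrib,
    ← Finset.prod_mul_distrib]
  refine Finset.prod_congr rfl fun v _ => ?_
  simp only [ev, Matrix.diagonal_mul, Matrix.mul_diagonal, mul_pow]
  ring

lemma TW.diag {n m : ℕ} {R E : Type*} [CommRing R] [CommRing E] [Algebra R E]
    {f : MvPolynomial (MV n m) R} (hf : TW f)
    {D D' : Fin n → E} (hD : ∀ i, D i * D' i = 1) (Y : Fin m → Matrix (Fin n) (Fin n) E) :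
    aeval (ev fun l => diagonal D * Y l * diagonal D') f = aeval (ev Y) f := by
  rw [aeval_diag, aeval_def, eval₂_eq']
  refine Finset.sum_congr rfl fun α hα => ?_
  congr 1
  rw [Finset.prod_eq_one, one_mul]
  intro i _
  rw [hf α hα i, ← mul_pow, hD, one_pow]

lemma TW_of_diag {K : Type} [Field K] [Infinite K] {n m : ℕ} {f : MvPolynomial (MV n m) K}
    (hf : ∀ u u' : Fin n → K, (∀ i, u i * u' i = 1) → aeval (ev fun l =>
      diagonal (fun j => C (u j)) * Xg n m K l * diagonal fun j => C (u' j)) f = f) : TW f := by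
  intro α hα i
  have key : ∀ s : K, s ≠ 0 → s ^ rowc α i = s ^ colc α i := by
    intro s hs
    let u : Fin n → K := Function.update 1 i s
    have hu : ∀ j, u j ≠ 0 := by
      intro j; by_cases h : j = i
      · subst h; simpa [u] using hs
      · simp [u, h]
    have h1 := hf u (fun j => (u j)⁻¹) (fun j => mul_inv_cancel₀ (hu j))
    rw [aeval_diag] at h1
    have h3 := congrArg (coeff α) h1
    rw [coeff_sum, Finset.sum_eq_single α] at h3
    · have e : (algebraMap K (MvPolynomial (MV n m) K)) (coeff α f) *
          ((∏ i, C (u i) ^ rowc α i * C (u i)⁻¹ ^ colc α i) * ∏ v, ev (Xg n m K) v ^ α v)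
          = monomial α (coeff α f * ∏ i, u i ^ rowc α i * (u i)⁻¹ ^ colc α i) := by
        rw [monomial_eq, Finsupp.prod_fintype _ _ (by simp), algebraMap_eq, C_mul, mul_assoc]
        congr 2
        rw [map_prod]
        refine Finset.prod_congr rfl fun _ _ => by rw [C_mul, C_pow, C_pow]
      rw [e, coeff_monomial, if_pos rfl] at h3
      have h4 := mul_left_cancel₀ (mem_support_iff.1 hα) (h3.trans (mul_one _).symm)
      rw [Finset.prod_eq_single i (by intro j _ hj; simp [u, hj]) (by simp)] at h4
      simp only [u, Function.update_self] at h4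
      rw [inv_pow] at h4
      rwa [mul_inv_eq_one₀ (pow_ne_zero _ hs)] at h4
    · intro β _ hβ
      have e : (algebraMap K (MvPolynomial (MV n m) K)) (coeff β f) *
          ((∏ i, C (u i) ^ rowc β i * C (u i)⁻¹ ^ colc β i) * ∏ v, ev (Xg n m K) v ^ β v)
          = monomial β (coeff β f * ∏ i, u i ^ rowc β i * (u i)⁻¹ ^ colc β i) := by
        rw [monomial_eq, Finsupp.prod_fintype _ _ (by simp), algebraMap_eq, C_mul, mul_assoc]
        congr 2
        rw [map_prod]
        refine Finset.prod_congr rfl fun _ _ => by rw [C_mul, C_pow, C_pow]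
      rw [e, coeff_monomial, if_neg hβ]
    · intro h; exact absurd hα h
  have : (Polynomial.X ^ (rowc α i + 1) : Polynomial K) = Polynomial.X ^ (colc α i + 1) := by
    apply Polynomial.funext
    intro s
    by_cases hs : s = 0
    · simp [hs]
    · simp [pow_succ, key s hs]
  have := congrArg Polynomial.natDegree this
  simpa using this

lemma TW_of_mem {K : Type} [Field K] [Infinite K] {n m : ℕ} {f : MvPolynomial (MV n m) K}
    (hf : f ∈ matrixInvariants K n m) : TW f := by
  refine TW_of_diag fun u u' h => ?_
  rw [inv_of_Lam (mem_S_iff_Lam.1 hf)]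
  · exact aeval_X_left_apply f
  · rw [diagonal_mul_diagonal, ← diagonal_one]; congr 1; funext j
    rw [← C_mul, h j, C_1]

/-! ### homogeneous components -/
lemma coeff_aeval_X_mul {σ : Type*} {R E : Type*} [CommRing R] [CommRing E] [Algebra R E]
    (y : σ → E) (f : MvPolynomial σ R) (D : ℕ) :
    (aeval (fun v => Polynomial.X * Polynomial.C (y v)) f : Polynomial E).coeff D =
      aeval y (homogeneousComponent D f) := by
  induction f using MvPolynomial.induction_on' with
  | monomial α c =>
    rw [homogeneousComponent_of_mem (isHomogeneous_monomial c rfl), aeval_monomial]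
    have : (α.prod fun i k => (Polynomial.X * Polynomial.C (y i)) ^ k) =
        Polynomial.X ^ α.degree * Polynomial.C (α.prod fun i k => y i ^ k) := by
      simp only [mul_pow, Finsupp.prod, Finset.prod_mul_distrib, Finset.prod_pow_eq_pow_sum,
        map_prod, map_pow]
      rfl
    rw [this, IsScalarTower.algebraMap_apply R E (Polynomial E), ← mul_assoc, mul_right_comm,
      Polynomial.algebraMap_eq, ← Polynomial.C_mul, Polynomial.coeff_C_mul, Polynomial.coeff_X_pow]
    split_ifs <;> simp [aeval_monomial]
  | add p q hp hq => simp only [map_add, Polynomial.coeff_add, hp, hq]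

lemma hc_mem {K : Type} [Field K] [Infinite K] {n m : ℕ} {f : MvPolynomial (MV n m) K}
    (hf : f ∈ matrixInvariants K n m) (D : ℕ) :
    homogeneousComponent D f ∈ matrixInvariants K n m := by
  have hf' := mem_S_iff_Lam.1 hf
  rw [mem_S_iff]
  intro A Y
  have h := inv_of_Lam (E := Polynomial K) hf' (g := A.val.map Polynomial.C)
    (g' := (A⁻¹).val.map Polynomial.C)
    (by rw [← Matrix.map_mul, ← Units.val_mul, mul_inv_cancel, Units.val_one]; simp)
    (fun l => (Polynomial.X : Polynomial K) • (Y l).map Polynomial.C)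
  have h' := congrArg (fun p => Polynomial.coeff p D) h
  rw [← coeff_aeval_X_mul, ← coeff_aeval_X_mul]
  have e1 : (fun v => Polynomial.X * Polynomial.C (ev (fun l => A.val * Y l * (A⁻¹).val) v)) =
      ev fun l => A.val.map Polynomial.C * ((Polynomial.X : Polynomial K) • (Y l).map Polynomial.C) *
        (A⁻¹).val.map Polynomial.C := by
    funext v
    simp only [ev, Matrix.mul_apply, Matrix.map_apply, Matrix.smul_apply, smul_eq_mul, map_sum,
      map_mul, Finset.mul_sum, Finset.sum_mul]
    refine Finset.sum_congr rfl fun _ _ => Finset.sum_congr rfl fun _ _ => by ring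
  have e2 : (fun v => Polynomial.X * Polynomial.C (ev Y v)) =
      ev fun l => (Polynomial.X : Polynomial K) • (Y l).map Polynomial.C := by
    funext v
    simp [ev]
  rw [e1, e2]
  exact h'

/-! ### stabilizers, SL2 trick -/
def St {K : Type} [Field K] {n m : ℕ} (f : MvPolynomial (MV n m) K)
    (g g' : Matrix (Fin n) (Fin n) K) : Prop :=
  g * g' = 1 ∧ ∀ Y : Fin m → Matrix (Fin n) (Fin n) K,
    aeval (ev fun l => g * Y l * g') f = aeval (ev Y) f

section
variable {K : Type} [Field K] {n m : ℕ} {f : MvPolynomial (MV n m) K}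

lemma St.mul {g g' h h' : Matrix (Fin n) (Fin n) K} (H : St f g g') (H' : St f h h') :
    St f (g * h) (h' * g') := by
  refine ⟨by rw [mul_assoc, ← mul_assoc h, H'.1, one_mul, H.1], fun Y => ?_⟩
  have h1 := H.2 (fun l => h * Y l * h')
  rw [← H'.2 Y, ← h1]
  simp only [mul_assoc]

lemma St.symm {g g' : Matrix (Fin n) (Fin n) K} (H : St f g g') : St f g' g := by
  have h1 : g' * g = 1 := mul_eq_one_comm.1 H.1
  refine ⟨h1, fun Y => ?_⟩
  rw [← H.2]
  congr 3
  funext l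
  rw [← mul_assoc, ← mul_assoc, H.1, one_mul, mul_assoc, H.1, mul_one]

lemma sneg {R : Type*} [Ring R] (i j : Fin n) (t : R) : single i j (-t) = -single i j t := by
  ext a b; simp only [single_apply, Matrix.neg_apply]; split_ifs <;> simp

/-- root subgroups in the stabilizer -/
def RS (f : MvPolynomial (MV n m) K) (i j : Fin n) : Prop :=
  ∀ t : K, St f (transvection i j t) (transvection i j (-t))

lemma RS.comm {i j k : Fin n} (hij : i ≠ j) (hjk : j ≠ k) (hik : i ≠ k)
    (H : RS f i j) (H' : RS f j k) : RS f i k := by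
  intro t
  have h := ((H t).mul (H' 1)).mul ((H (-t)).mul (H' (-1)))
  simp only [neg_neg] at h
  convert h using 1 <;>
  · simp only [transvection, mul_add, add_mul, mul_one, one_mul, single_mul_single_same,
      single_mul_single_of_ne _ _ _ _ hij.symm, single_mul_single_of_ne _ _ _ _ hjk.symm,
      single_mul_single_of_ne _ _ _ _ hik.symm, sneg, mul_neg, neg_mul, neg_neg,
      mul_zero, zero_mul, ne_eq, hij.symm, hjk.symm, hik.symm, not_false_eq_true]
    abel

lemma const_of_inv [Infinite K] (p r : Polynomial K)
    (h : ∀ s : K, s ≠ 0 → p.eval s = r.eval s⁻¹) (s : K) : p.eval s = p.eval 0 := by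
  have key : p * Polynomial.X ^ (r.natDegree + 1) = Polynomial.reflect (r.natDegree + 1) r := by
    rw [← sub_eq_zero]
    apply Polynomial.eq_zero_of_infinite_isRoot
    refine Set.Infinite.mono (s := {0}ᶜ) ?_ (Set.finite_singleton 0).infinite_compl
    intro x hx
    have hx : x ≠ 0 := hx
    letI := invertibleOfNonzero (inv_ne_zero hx)
    have := Polynomial.eval₂_reflect_mul_pow (RingHom.id K) x⁻¹ (r.natDegree + 1) r (by omega)
    rw [invOf_eq_inv, inv_inv] at this
    change Polynomial.eval x _ = 0
    rw [Polynomial.eval_sub, Polynomial.eval_mul, Polynomial.eval_pow, Polynomial.eval_X, h x hx]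
    change _ = Polynomial.eval _ _ at this
    change Polynomial.eval _ _ * _ = _ at this
    rw [← this, mul_assoc, ← mul_pow, inv_mul_cancel₀ hx, one_pow, mul_one, sub_self]
  have hd : p.natDegree = 0 := by
    by_cases hp : p = 0
    · simp [hp]
    have h1 := congrArg Polynomial.natDegree key
    rw [Polynomial.natDegree_mul hp (by simp), Polynomial.natDegree_X_pow] at h1
    have h2 := Polynomial.natDegree_reflect_le (N := r.natDegree + 1) (p := r)
    rw [max_eq_left (by omega)] at h2
    omega
  rw [Polynomial.eq_C_of_natDegree_eq_zero hd]; simp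

lemma exists_poly (N N' : Matrix (Fin n) (Fin n) (Polynomial K))
    (f : MvPolynomial (MV n m) K) (Y : Fin m → Matrix (Fin n) (Fin n) K) :
    ∃ p : Polynomial K, ∀ s, p.eval s = aeval (ev fun l => N.map (Polynomial.eval s) * Y l *
      N'.map (Polynomial.eval s)) f := by
  refine ⟨aeval (ev fun l => N * (Y l).map Polynomial.C * N') f, fun s => ?_⟩
  rw [← Polynomial.coe_aeval_eq_eval, ← AlgHom.comp_apply, comp_aeval]
  congr 2
  funext v
  simp [ev, Matrix.mul_apply, Polynomial.eval_finsetSum]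

lemma RS.neg [Infinite K] {i j : Fin n} (hij : i ≠ j) (hT : TW f) (H : RS f i j) : RS f j i := by
  -- monomial matrix
  let W : K → Matrix (Fin n) (Fin n) K := fun s =>
    transvection i j (-s⁻¹) * transvection j i s * transvection i j (-s⁻¹)
  let W' : K → Matrix (Fin n) (Fin n) K := fun s =>
    transvection i j (s⁻¹) * transvection j i (-s) * transvection i j (s⁻¹)
  let D : K → Fin n → K := fun s => Function.update (Function.update 1 i s⁻¹) j s
  let D' : K → Fin n → K := fun s => Function.update (Function.update 1 i s) j s⁻¹
  have tm : ∀ (a b : Fin n) (hab : a ≠ b) (c d : K),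
      transvection a b c * transvection a b d = transvection a b (c + d) :=
    fun a b hab c d => transvection_mul_transvection_same a b hab c d
  have hW : ∀ s, s ≠ 0 → W s = 1 - single i i 1 - single j j 1 - single i j s⁻¹ + single j i s := by
    intro s hs
    simp only [W, transvection, mul_add, add_mul, mul_one, one_mul, single_mul_single_same,
      single_mul_single_of_ne _ _ _ _ hij.symm, single_mul_single_of_ne _ _ _ _ hij, sneg,
      mul_neg, neg_mul, neg_neg, inv_mul_cancel₀ hs, mul_inv_cancel₀ hs, zero_mul, neg_zero]
    abel
  have hW' : ∀ s, s ≠ 0 → W' s = 1 - single i i 1 - single j j 1 + single i j s⁻¹ - single j i s := by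
    intro s hs
    simp only [W', transvection, mul_add, add_mul, mul_one, one_mul, single_mul_single_same,
      single_mul_single_of_ne _ _ _ _ hij.symm, single_mul_single_of_ne _ _ _ _ hij, sneg,
      mul_neg, neg_mul, neg_neg, inv_mul_cancel₀ hs, mul_inv_cancel₀ hs, zero_mul, neg_zero]
    abel
  have hDW : ∀ s, s ≠ 0 → W s = diagonal (D s) * W 1 := by
    intro s hs
    rw [hW s hs, hW 1 one_ne_zero]
    ext a b
    rw [diagonal_mul]
    clear hW hW' tm
    simp only [D, Function.update_apply, Matrix.one_apply, single_apply, Matrix.sub_apply,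
      Matrix.add_apply, Pi.one_apply, inv_one]
    have e1 := mul_inv_cancel₀ hs
    grind
  have hDW' : ∀ s, s ≠ 0 → W' s = W' 1 * diagonal (D' s) := by
    intro s hs
    rw [hW' s hs, hW' 1 one_ne_zero]
    ext a b
    rw [mul_diagonal]
    clear hW hW' tm
    simp only [D', Function.update_apply, Matrix.one_apply, single_apply, Matrix.sub_apply,
      Matrix.add_apply, Pi.one_apply, inv_one]
    have e1 := mul_inv_cancel₀ hs
    grind
  have hDst : ∀ s, s ≠ 0 → ∀ Y : Fin m → Matrix (Fin n) (Fin n) K,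
      aeval (ev fun l => diagonal (D s) * Y l * diagonal (D' s)) f = aeval (ev Y) f := by
    intro s hs Y
    apply hT.diag
    intro a
    simp only [D, D', Function.update_apply]
    split_ifs <;> simp [hs]
  have hx : ∀ s, transvection j i s =
      transvection i j s⁻¹ * W s * transvection i j s⁻¹ := by
    intro s
    simp only [W, ← mul_assoc, tm i j hij]
    rw [add_neg_cancel, transvection_zero, one_mul, mul_assoc, tm i j hij, neg_add_cancel,
      transvection_zero, mul_one]
  have hx' : ∀ s, transvection j i (-s) =
      transvection i j (-s⁻¹) * W' s * transvection i j (-s⁻¹) := by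
    intro s
    simp only [W', ← mul_assoc, tm i j hij]
    rw [neg_add_cancel, transvection_zero, one_mul, mul_assoc, tm i j hij, add_neg_cancel,
      transvection_zero, mul_one]
  intro t
  refine ⟨by rw [tm j i hij.symm, add_neg_cancel, transvection_zero], fun Y => ?_⟩
  obtain ⟨p, hp⟩ := exists_poly (transvection j i Polynomial.X)
    (transvection j i (-Polynomial.X)) f Y
  obtain ⟨r, hr⟩ := exists_poly ((W 1).map Polynomial.C * transvection i j Polynomial.X)
    (transvection i j (-Polynomial.X) * (W' 1).map Polynomial.C) f Y
  have tmap : ∀ (a b : Fin n) (u : Polynomial K) (s : K),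
      (transvection a b u).map (Polynomial.eval s) = transvection a b (u.eval s) := by
    intro a b u s
    ext x y
    simp only [transvection, Matrix.map_apply, Matrix.add_apply, Polynomial.eval_add,
      Matrix.one_apply, single_apply]
    split_ifs <;> simp
  have mm : ∀ (A B : Matrix (Fin n) (Fin n) (Polynomial K)) (s : K),
      (A * B).map (Polynomial.eval s) = A.map (Polynomial.eval s) * B.map (Polynomial.eval s) :=
    fun A B s => Matrix.map_mul (f := Polynomial.evalRingHom s)
  have cm : ∀ (A : Matrix (Fin n) (Fin n) K) (s : K),
      (A.map Polynomial.C).map (Polynomial.eval s) = A := by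
    intro A s; ext; simp
  simp only [tmap, mm, cm, Polynomial.eval_X, Polynomial.eval_neg] at hp hr
  have main := const_of_inv p r (fun s hs => by
    rw [hp, hr, hx, hx', hDW s hs, hDW' s hs]
    have a1 := hDst s hs (fun l => W 1 * transvection i j s⁻¹ * Y l *
      (transvection i j (-s⁻¹) * W' 1))
    have a2 := (H s⁻¹).2 (fun l => diagonal (D s) * (W 1 * transvection i j s⁻¹ * Y l *
      (transvection i j (-s⁻¹) * W' 1)) * diagonal (D' s))
    rw [← a1, ← a2]
    simp only [mul_assoc]) t
  rw [hp, hp] at main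
  rw [main]
  simp [transvection_zero]

/-- L1 -/
theorem mem_S_of_simple [Infinite K] (hT : TW f)
    (hU : ∀ i j : Fin n, i.val + 1 = j.val → RS f i j) : f ∈ matrixInvariants K n m := by
  have hall : ∀ d : ℕ, ∀ i j : Fin n, i.val + d + 1 = j.val → RS f i j ∧ RS f j i := by
    intro d
    induction d with
    | zero =>
      intro i j h
      have := hU i j h
      exact ⟨this, this.neg (by intro e; simp [e] at h) hT⟩
    | succ d ih =>
      intro i j h
      let k : Fin n := ⟨i.val + 1, by have := j.2; omega⟩
      have h1 := hU i k rfl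
      have hik : i ≠ k := by intro e; have := congrArg Fin.val e; simp [k] at this
      have hij : i ≠ j := by intro e; have := congrArg Fin.val e; omega
      have h2 := ih k j (by simp [k]; omega)
      have hkj : k ≠ j := by intro e; have := congrArg Fin.val e; simp [k] at this; omega
      exact ⟨h1.comm hik hkj hij h2.1, h2.2.comm hkj.symm hik.symm hij.symm (h1.neg hik hT)⟩
  have hR : ∀ i j : Fin n, i ≠ j → RS f i j := by
    intro i j hij
    rcases lt_or_gt_of_ne (fun e => hij (Fin.ext e) : i.val ≠ j.val) with h | h
    · exact (hall (j.val - i.val - 1) i j (by omega)).1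
    · exact (hall (i.val - j.val - 1) j i (by omega)).2
  rw [mem_S_iff]
  intro A Y
  have hdet : A.val.det ≠ 0 := ((Matrix.isUnit_iff_isUnit_det _).1 A.isUnit).ne_zero
  have := diagonal_transvection_induction_of_det_ne_zero (fun M => ∃ M', St f M M') A.val hdet
    (by
      intro D hD
      rw [det_diagonal, Finset.prod_ne_zero_iff] at hD
      have e : ∀ i, D i * (D i)⁻¹ = 1 := fun i => mul_inv_cancel₀ (hD i (Finset.mem_univ _))
      refine ⟨diagonal fun i => (D i)⁻¹, ?_, fun Y => hT.diag e Y⟩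
      rw [diagonal_mul_diagonal, ← diagonal_one]; congr 1; funext i; exact e i)
    (fun t => ⟨_, hR t.i t.j t.hij t.c⟩)
    (fun A B _ _ ⟨A', hA⟩ ⟨B', hB⟩ => ⟨_, hA.mul hB⟩)
  obtain ⟨M', h1, h2⟩ := this
  have e : (A⁻¹).val = M' := by
    calc (A⁻¹).val = (A⁻¹).val * (A.val * M') := by rw [h1, mul_one]
      _ = M' := by rw [← mul_assoc, ← Units.val_mul, inv_mul_cancel, Units.val_one, one_mul]
  rw [e, h2]
end
end CMProof


namespace CMProof

/-! ### leading monomials w.r.t. a weight -/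
section lead
variable {σ : Type*} {R : Type*} [CommRing R]

noncomputable def wd (w : σ → ℤ) : (σ →₀ ℕ) →+ ℤ := Finsupp.weight w

lemma wd_single (w : σ → ℤ) (v : σ) : wd w (Finsupp.single v 1) = w v := by
  simp [wd, Finsupp.weight_single]

def IsLead (w : σ → ℤ) (f : MvPolynomial σ R) (μ : σ →₀ ℕ) (c : R) : Prop :=
  coeff μ f = c ∧ ∀ α ∈ f.support, α ≠ μ → wd w α < wd w μ

lemma IsLead.one (w : σ → ℤ) : IsLead w (1 : MvPolynomial σ R) 0 1 := by
  classical
  refine ⟨by simp, fun α hα h => absurd ?_ (mem_support_iff.1 hα)⟩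
  rw [coeff_one, if_neg (Ne.symm h)]

lemma IsLead.le {w : σ → ℤ} {f : MvPolynomial σ R} {μ : σ →₀ ℕ} {c : R} (h : IsLead w f μ c)
    {α : σ →₀ ℕ} (hα : α ∈ f.support) : wd w α ≤ wd w μ := by
  by_cases e : α = μ
  · rw [e]
  · exact (h.2 α hα e).le

lemma IsLead.mul {w : σ → ℤ} {f g : MvPolynomial σ R} {μ ν : σ →₀ ℕ} {c d : R}
    (hf : IsLead w f μ c) (hg : IsLead w g ν d) : IsLead w (f * g) (μ + ν) (c * d) := by
  classical
  have key : ∀ a ∈ f.support, ∀ b ∈ g.support, (a ≠ μ ∨ b ≠ ν) → wd w (a + b) < wd w (μ + ν) := by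
    intro a ha b hb h
    rw [map_add, map_add]
    rcases h with h | h
    · exact add_lt_add_of_lt_of_le (hf.2 a ha h) (hg.le hb)
    · exact add_lt_add_of_le_of_lt (hf.le ha) (hg.2 b hb h)
  constructor
  · rw [coeff_mul, Finset.sum_eq_single (μ, ν)]
    · rw [hf.1, hg.1]
    · rintro ⟨a, b⟩ hab hne
      by_contra h0
      have h1 := left_ne_zero_of_mul h0
      have h2 := right_ne_zero_of_mul h0
      have := key a (mem_support_iff.2 h1) b (mem_support_iff.2 h2)
        (by by_contra! h; exact hne (by rw [h.1, h.2]))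
      rw [Finset.HasAntidiagonal.mem_antidiagonal.1 hab] at this
      exact lt_irrefl _ this
    · intro h; exact absurd (by simp) h
  · intro α hα hne
    obtain ⟨a, ha, b, hb, rfl⟩ := Finset.mem_add.1 (support_mul f g hα)
    refine key a ha b hb ?_
    by_contra! h; exact hne (by rw [h.1, h.2])

lemma IsLead.prod {ι : Type*} {w : σ → ℤ} (s : Finset ι) {f : ι → MvPolynomial σ R}
    {μ : ι → σ →₀ ℕ} {c : ι → R} (h : ∀ i ∈ s, IsLead w (f i) (μ i) (c i)) :
    IsLead w (∏ i ∈ s, f i) (∑ i ∈ s, μ i) (∏ i ∈ s, c i) := by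
  classical
  induction s using Finset.induction_on with
  | empty => simpa using IsLead.one w
  | insert a s ha ih =>
    rw [Finset.prod_insert ha, Finset.sum_insert ha, Finset.prod_insert ha]
    exact (h a (by simp)).mul (ih fun i hi => h i (by simp [hi]))

lemma IsLead.pow {w : σ → ℤ} {f : MvPolynomial σ R} {μ : σ →₀ ℕ} {c : R}
    (h : IsLead w f μ c) (k : ℕ) : IsLead w (f ^ k) (k • μ) (c ^ k) := by
  have := IsLead.prod (Finset.range k) (f := fun _ => f) (μ := fun _ => μ) (c := fun _ => c)
    (fun _ _ => h)
  simpa using this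

lemma IsLead.add {w : σ → ℤ} {f g : MvPolynomial σ R} {μ : σ →₀ ℕ} {c : R}
    (h : IsLead w f μ c) (hg : ∀ α ∈ g.support, wd w α < wd w μ) : IsLead w (f + g) μ c := by
  classical
  constructor
  · have : coeff μ g = 0 := by
      by_contra h0; exact lt_irrefl _ (hg μ (mem_support_iff.2 h0))
    rw [coeff_add, h.1, this, add_zero]
  · intro α hα hne
    rcases Finset.mem_union.1 (support_add hα) with h1 | h1
    · exact h.2 α h1 hne
    · exact hg α h1

lemma IsLead.monomial (w : σ → ℤ) (μ : σ →₀ ℕ) (c : R) : IsLead w (monomial μ c) μ c := by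
  classical
  refine ⟨by simp, fun α hα h => absurd ?_ (mem_support_iff.1 hα)⟩
  rw [coeff_monomial, if_neg (Ne.symm h)]

end lead

/-! ### the trace -/
lemma qpos {K : Type} [Field K] (p e : ℕ) [ExpChar K p] : 0 < p ^ e := pow_pos (expChar_pos K p) e

section trace
variable {σ : Type} [Fintype σ] {K : Type} [Field K] (p e : ℕ) [ExpChar K p] [PerfectRing K p]

noncomputable def rt : K ≃+* K := (iterateFrobeniusEquiv K p e).symm

lemma rt_pow (a : K) : rt p e (a ^ p ^ e) = a := by
  rw [← iterateFrobeniusEquiv_def K p e]; exact RingEquiv.symm_apply_apply _ _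

lemma rt_pow' (a : K) : rt p e a ^ p ^ e = a := by
  rw [← iterateFrobeniusEquiv_def K p e]; exact RingEquiv.apply_symm_apply _ _

/-- all exponents `q-1` -/
noncomputable def topm (σ : Type) [Fintype σ] (q : ℕ) : σ →₀ ℕ := Finsupp.equivFunOnFinite.symm fun _ => q - 1

@[simp] lemma topm_apply (q : ℕ) (v : σ) : topm σ q v = q - 1 := rfl

lemma sub_inj {q : ℕ} (hq : 0 < q) : Function.Injective fun β : σ →₀ ℕ => q • β + topm σ q := by
  intro a b h
  ext v
  have := DFunLike.congr_fun h v
  simpa [hq.ne'] using this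

noncomputable def Tr (f : MvPolynomial σ K) : MvPolynomial σ K :=
  ∑ β ∈ f.support.preimage (fun β : σ →₀ ℕ => p ^ e • β + topm σ (p ^ e))
    (sub_inj (qpos (K := K) p e)).injOn, monomial β (rt p e (coeff (p ^ e • β + topm σ (p ^ e)) f))

lemma coeff_Tr (f : MvPolynomial σ K) (β : σ →₀ ℕ) :
    coeff β (Tr p e f) = rt p e (coeff (p ^ e • β + topm σ (p ^ e)) f) := by
  classical
  rw [Tr, coeff_sum]
  simp only [coeff_monomial]
  rw [Finset.sum_ite_eq']
  split_ifs with h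
  · rfl
  · simp only [Finset.mem_preimage, mem_support_iff, not_not] at h
    rw [h, map_zero]

lemma Tr_add (f g : MvPolynomial σ K) : Tr p e (f + g) = Tr p e f + Tr p e g := by
  ext β; simp [coeff_Tr]

lemma Tr_zero : Tr p e (0 : MvPolynomial σ K) = 0 := by
  ext β; simp [coeff_Tr]

lemma Tr_sum {ι : Type*} (s : Finset ι) (f : ι → MvPolynomial σ K) :
    Tr p e (∑ i ∈ s, f i) = ∑ i ∈ s, Tr p e (f i) :=
  map_sum (AddMonoidHom.mk' (Tr p e) (Tr_add p e)) f s

lemma Tr_pow_mul (g f : MvPolynomial σ K) : Tr p e (g ^ p ^ e * f) = g * Tr p e f := by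
  classical
  have hq := qpos (K := K) p e
  induction g using MvPolynomial.induction_on' with
  | monomial γ c =>
    ext β
    rw [coeff_Tr, MvPolynomial.monomial_pow, coeff_monomial_mul', coeff_monomial_mul', coeff_Tr]
    have h1 : (p ^ e • γ ≤ p ^ e • β + topm σ (p ^ e)) ↔ γ ≤ β := by
      rw [Finsupp.le_def, Finsupp.le_def]
      refine forall_congr' fun v => ?_
      simp only [Finsupp.smul_apply, smul_eq_mul, Finsupp.add_apply, topm_apply]
      constructor
      · intro h
        by_contra! hlt
        have : p ^ e * (β v + 1) ≤ p ^ e * γ v := Nat.mul_le_mul_left _ hlt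
        rw [mul_add] at this
        omega
      · intro h; exact (Nat.mul_le_mul_left _ h).trans (Nat.le_add_right _ _)
    simp only [h1]
    split_ifs with h
    · rw [map_mul, rt_pow]
      congr 3
      ext v
      have := Nat.mul_le_mul_left (p ^ e) (h v)
      simp only [Finsupp.tsub_apply, Finsupp.smul_apply, smul_eq_mul, Finsupp.add_apply,
        topm_apply, Nat.mul_sub]
      omega
    · rw [map_zero]
  | add a b ha hb => rw [add_pow_expChar_pow, add_mul, Tr_add, ha, hb, add_mul]

lemma Tr_C_mul (a : K) (f : MvPolynomial σ K) : Tr p e (C a * f) = C (rt p e a) * Tr p e f := by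
  rw [← Tr_pow_mul, ← C_pow, rt_pow']

lemma exists_decomp (α : σ →₀ ℕ) (c : K) : ∃ (g : MvPolynomial σ K) (γ : σ →₀ ℕ),
    (∀ v, γ v ≤ p ^ e - 1) ∧ monomial α c = g ^ p ^ e * monomial γ 1 := by
  refine ⟨monomial (Finsupp.equivFunOnFinite.symm fun v => α v / p ^ e) (rt p e c),
    Finsupp.equivFunOnFinite.symm fun v => α v % p ^ e, fun v => ?_, ?_⟩
  · have := Nat.mod_lt (α v) (qpos (K := K) p e)
    change α v % p ^ e ≤ _; omega
  · rw [MvPolynomial.monomial_pow, monomial_mul, rt_pow', mul_one]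
    have : (p ^ e • Finsupp.equivFunOnFinite.symm fun v => α v / p ^ e) +
        (Finsupp.equivFunOnFinite.symm fun v => α v % p ^ e) = α := by
      ext v
      exact Nat.div_add_mod _ _
    rw [this]

lemma Tr_eq_zero_of_deg {f : MvPolynomial σ K} {D : ℕ} (hf : f.IsHomogeneous D)
    (hD : D < Fintype.card σ * (p ^ e - 1)) : Tr p e f = 0 := by
  ext β
  rw [coeff_Tr, hf.coeff_eq_zero, map_zero, coeff_zero]
  rw [Finsupp.degree_eq_sum]
  simp only [Finsupp.add_apply, Finsupp.smul_apply, topm_apply, Finset.sum_add_distrib,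
    Finset.sum_const, Finset.card_univ, smul_eq_mul]
  omega

lemma Tr_comm (φ : MvPolynomial σ K →ₐ[K] MvPolynomial σ K) (w : σ → ℤ)
    (h1 : ∀ v, (φ (X v)).IsHomogeneous 1) (h2 : ∀ v, IsLead w (φ (X v)) (Finsupp.single v 1) 1)
    (f : MvPolynomial σ K) : Tr p e (φ f) = φ (Tr p e f) := by
  classical
  have hq := qpos (K := K) p e
  have hmon : ∀ γ : σ →₀ ℕ, φ (monomial γ 1) = ∏ v, φ (X v) ^ γ v := by
    intro γ
    rw [monomial_eq, C_1, one_mul, Finsupp.prod_fintype _ _ (by simp), map_prod]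
    simp
  have hhom : ∀ γ : σ →₀ ℕ, (φ (monomial γ 1)).IsHomogeneous (∑ v, γ v) := by
    intro γ
    rw [hmon]
    refine IsHomogeneous.prod _ _ _ fun v _ => ?_
    simpa using (h1 v).pow (γ v)
  induction f using MvPolynomial.induction_on' with
  | monomial α c =>
    obtain ⟨g, γ, hγ, e1⟩ := exists_decomp p e α c
    rw [e1, map_mul, map_pow, Tr_pow_mul, Tr_pow_mul, map_mul]
    congr 1
    by_cases ht : γ = topm σ (p ^ e)
    · have hl := IsLead.prod Finset.univ (fun v _ => (h2 v).pow (γ v))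
      have e2 : ∑ v, γ v • Finsupp.single v 1 = γ := by
        ext u; simp
      rw [← hmon, e2] at hl
      have e3 : Tr p e (φ (monomial γ 1)) = 1 := by
        ext β
        rw [coeff_Tr, coeff_one]
        by_cases hβ : β = 0
        · subst hβ
          rw [smul_zero, zero_add, ← ht, hl.1]; simp
        · rw [if_neg (Ne.symm hβ), (hhom γ).coeff_eq_zero, map_zero]
          rw [Finsupp.degree_eq_sum, ht]
          simp only [Finsupp.add_apply, Finsupp.smul_apply, smul_eq_mul, Finset.sum_add_distrib]
          intro h
          apply hβ
          ext v
          have h3 : ∑ v, p ^ e * β v = 0 := by omega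
          have := Finset.sum_eq_zero_iff.1 h3 v (Finset.mem_univ _)
          exact (mul_eq_zero.1 this).resolve_left hq.ne'
      have e4 : Tr p e (monomial γ (1 : K)) = 1 := by
        ext β
        rw [coeff_Tr, coeff_one, coeff_monomial, ht]
        have : (topm σ (p ^ e) = p ^ e • β + topm σ (p ^ e)) ↔ 0 = β := by
          constructor
          · intro h
            have h3 := sub_inj (σ := σ) hq (a₁ := 0) (a₂ := β) (by simpa using h)
            exact h3
          · rintro rfl; simp
        simp only [this]
        split_ifs <;> simp
      rw [e3, e4, map_one]
    · have hlt : ∑ v, γ v < Fintype.card σ * (p ^ e - 1) := by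
        have : ∃ v, γ v < p ^ e - 1 := by
          by_contra! h
          exact ht (Finsupp.ext fun v => le_antisymm (hγ v) (h v))
        obtain ⟨v, hv⟩ := this
        calc ∑ v, γ v < ∑ v : σ, (p ^ e - 1) :=
              Finset.sum_lt_sum (fun v _ => hγ v) ⟨v, Finset.mem_univ _, hv⟩
          _ = _ := by simp
      rw [Tr_eq_zero_of_deg p e (hhom γ) hlt,
        Tr_eq_zero_of_deg p e (isHomogeneous_monomial (n := ∑ v, γ v) 1 (Finsupp.degree_eq_sum γ)) hlt, map_zero]
  | add a b ha hb => rw [map_add, Tr_add, ha, hb, Tr_add, map_add]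

end trace

/-! ### root subgroup action -/
section root
variable {K : Type} [Field K] {n m : ℕ}

noncomputable def Er (i j : Fin n) (t : K) :
    MvPolynomial (MV n m) K →ₐ[K] MvPolynomial (MV n m) K :=
  aeval (ev fun l => transvection i j (C t) * Xg n m K l * transvection i j (-C t))

lemma aeval_Er (i j : Fin n) (t : K) (f : MvPolynomial (MV n m) K)
    (Y : Fin m → Matrix (Fin n) (Fin n) K) :
    aeval (ev Y) (Er i j t f) =
      aeval (ev fun l => transvection i j t * Y l * transvection i j (-t)) f := by
  rw [Er, ← AlgHom.comp_apply, comp_aeval]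
  congr 2
  funext v
  simp only [ev, Xg, Matrix.mul_apply, map_sum, map_mul, transvection, Matrix.add_apply,
    Matrix.of_apply, aeval_X, map_add, Matrix.one_apply, single_apply]
  refine Finset.sum_congr rfl fun a _ => ?_
  congr 1
  · refine Finset.sum_congr rfl fun a _ => ?_
    congr 1
    split_ifs <;> simp
  · split_ifs <;> simp

lemma Er_of_mem [Infinite K] {f : MvPolynomial (MV n m) K} (hf : f ∈ matrixInvariants K n m)
    {i j : Fin n} (hij : i ≠ j) (t : K) : Er i j t f = f := by
  rw [Er, inv_of_Lam (mem_S_iff_Lam.1 hf)]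
  · exact aeval_X_left_apply f
  · rw [transvection_mul_transvection_same _ _ hij, add_neg_cancel, transvection_zero]

lemma RS_of_Er {f : MvPolynomial (MV n m) K} {i j : Fin n} (hij : i ≠ j)
    (h : ∀ t, Er i j t f = f) : RS f i j := by
  intro t
  refine ⟨by rw [transvection_mul_transvection_same _ _ hij, add_neg_cancel, transvection_zero],
    fun Y => ?_⟩
  rw [← aeval_Er, h]

lemma Er_X (i j : Fin n) (t : K) (l : Fin m) (a b : Fin n) :
    Er i j t (X (l, a, b)) = X (l, a, b) +
      ((if a = i then C t * X (l, j, b) else 0) +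
        (if b = j then - C t * (X (l, a, i) + (if a = i then C t * X (l, j, i) else 0)) else 0)) := by
  simp only [Er, aeval_X, ev, transvection, add_mul, mul_add, one_mul, mul_one, Matrix.add_apply]
  have s1 : ∀ (M : Matrix (Fin n) (Fin n) (MvPolynomial (MV n m) K)) (c) (a b),
      (single i j c * M) a b = if a = i then c * M j b else 0 := by
    intro M c a b
    split_ifs with h
    · subst h; simp
    · rw [single_mul_apply_of_ne (h := h)]
  have s2 : ∀ (M : Matrix (Fin n) (Fin n) (MvPolynomial (MV n m) K)) (c) (a b),
      (M * single i j c) a b = if b = j then M a i * c else 0 := by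
    intro M c a b
    split_ifs with h
    · subst h; simp
    · rw [mul_single_apply_of_ne (hbj := h)]
  rw [s1, s2, s2, s1]
  simp only [Xg, Matrix.of_apply]
  split_ifs <;> ring

def wroot : MV n m → ℤ := fun v => (v.2.2.val : ℤ) - v.2.1.val

lemma Er_hom (i j : Fin n) (t : K) (v : MV n m) : (Er i j t (X v)).IsHomogeneous 1 := by
  obtain ⟨l, a, b⟩ := v
  rw [Er_X]
  have hX : ∀ v : MV n m, (X v : MvPolynomial (MV n m) K).IsHomogeneous 1 := isHomogeneous_X K
  have hC : ∀ (f : MvPolynomial (MV n m) K), f.IsHomogeneous 1 → (C t * f).IsHomogeneous 1 := by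
    intro f hf; simpa using (isHomogeneous_C _ t).mul hf
  refine (hX _).add (IsHomogeneous.add ?_ ?_)
  · split_ifs
    · exact hC _ (hX _)
    · exact isHomogeneous_zero _ _ _
  · split_ifs
    · rw [neg_mul]; exact (hC _ ((hX _).add (hC _ (hX _)))).neg
    · rw [neg_mul]; exact (hC _ ((hX _).add (isHomogeneous_zero _ _ _))).neg
    · exact isHomogeneous_zero _ _ _

lemma supp_aux {σ : Type} (w : σ → ℤ) (f : MvPolynomial σ K) (N : ℤ) :
    (∀ α ∈ f.support, wd w α < N) ↔ ∀ α, N ≤ wd w α → coeff α f = 0 := by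
  constructor
  · intro h α hα
    by_contra h0
    exact absurd (h α (mem_support_iff.2 h0)) (not_lt.2 hα)
  · intro h α hα
    by_contra! h0
    exact mem_support_iff.1 hα (h α h0)

lemma Er_lead {i j : Fin n} (hij : i < j) (t : K) (v : MV n m) :
    IsLead wroot (Er i j t (X v)) (Finsupp.single v 1) 1 := by
  classical
  obtain ⟨l, a, b⟩ := v
  rw [Er_X]
  refine IsLead.add (IsLead.monomial wroot _ 1) ?_
  rw [supp_aux]
  intro α hα
  rw [wd_single] at hα
  have hX : ∀ v : MV n m, wroot v < wroot (l, a, b) →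
      coeff α (X v : MvPolynomial (MV n m) K) = 0 := by
    intro v hv
    rw [coeff_X, if_neg]
    rintro rfl
    rw [wd_single] at hα
    omega
  have hij' : i.val < j.val := hij
  have g1 : a = i → coeff α (X (l, j, b) : MvPolynomial (MV n m) K) = 0 := by
    rintro rfl; apply hX; simp only [wroot]; omega
  have g2 : b = j → coeff α (X (l, a, i) : MvPolynomial (MV n m) K) = 0 := by
    rintro rfl; apply hX; simp only [wroot]; omega
  have g3 : a = i → b = j → coeff α (X (l, j, i) : MvPolynomial (MV n m) K) = 0 := by
    rintro rfl rfl; apply hX; simp only [wroot]; omega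
  split_ifs with h1 h2 h2 <;> simp [coeff_C_mul] <;> simp_all

variable (p e : ℕ) [ExpChar K p] [PerfectRing K p]

lemma Tr_TW {f : MvPolynomial (MV n m) K} (hf : TW f) : TW (Tr p e f) := by
  intro α hα i
  rw [mem_support_iff, coeff_Tr] at hα
  have h := hf (p ^ e • α + topm (MV n m) (p ^ e)) (by
    rw [mem_support_iff]; intro h0; rw [h0, map_zero] at hα; exact hα rfl) i
  have r1 : rowc (p ^ e • α + topm (MV n m) (p ^ e)) i =
      p ^ e * rowc α i + ∑ v : MV n m, if v.2.1 = i then p ^ e - 1 else 0 := by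
    simp only [rowc, Finset.mul_sum, ← Finset.sum_add_distrib]
    refine Finset.sum_congr rfl fun v _ => ?_
    split_ifs <;> simp
  have r2 : colc (p ^ e • α + topm (MV n m) (p ^ e)) i =
      p ^ e * colc α i + ∑ v : MV n m, if v.2.2 = i then p ^ e - 1 else 0 := by
    simp only [colc, Finset.mul_sum, ← Finset.sum_add_distrib]
    refine Finset.sum_congr rfl fun v _ => ?_
    split_ifs <;> simp
  have r3 : (∑ v : MV n m, if v.2.1 = i then p ^ e - 1 else 0) =
      ∑ v : MV n m, if v.2.2 = i then p ^ e - 1 else 0 := by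
    simp only [Fintype.sum_prod_type]
    refine Finset.sum_congr rfl fun l _ => ?_
    exact Finset.sum_comm
  rw [r1, r2, r3] at h
  have := Nat.add_right_cancel h
  exact Nat.eq_of_mul_eq_mul_left (qpos (K := K) p e) this

lemma TW.mul {f g : MvPolynomial (MV n m) K} (hf : TW f) (hg : TW g) : TW (f * g) := by
  classical
  intro α hα i
  obtain ⟨a, ha, b, hb, rfl⟩ := Finset.mem_add.1 (support_mul f g hα)
  have h1 := hf a ha i
  have h2 := hg b hb i
  simp only [rowc, colc] at *
  have : ∀ (P : MV n m → Prop) [DecidablePred P], (∑ v, if P v then (a + b) v else 0) =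
      (∑ v, if P v then a v else 0) + ∑ v, if P v then b v else 0 := by
    intro P _
    rw [← Finset.sum_add_distrib]
    refine Finset.sum_congr rfl fun v _ => ?_
    split_ifs <;> simp
  rw [this, this, h1, h2]

/-- L2 -/
theorem Tr_mul_mem [Infinite K] {h f : MvPolynomial (MV n m) K} (hT : TW h)
    (hd : ∀ i j : Fin n, i.val + 1 = j.val → ∃ hh : ℕ → MvPolynomial (MV n m) K,
      ∀ t, Er i j t h = ∑ k ∈ Finset.range (p ^ e), C (t ^ k) * hh k)
    (hf : f ∈ matrixInvariants K n m) : Tr p e (h * f) ∈ matrixInvariants K n m := by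
  refine mem_S_of_simple (Tr_TW p e (hT.mul (TW_of_mem hf))) fun i j hij => ?_
  have hlt : i < j := Fin.lt_def.2 (by omega)
  obtain ⟨hh, hhh⟩ := hd i j hij
  have key : ∀ τ : K, Er i j (τ ^ p ^ e) (Tr p e (h * f)) =
      ∑ k ∈ Finset.range (p ^ e), C (τ ^ k) * Tr p e (hh k * f) := by
    intro τ
    rw [← Tr_comm p e _ wroot (Er_hom i j _) (Er_lead hlt _), map_mul, Er_of_mem hf hlt.ne, hhh,
      Finset.sum_mul, Tr_sum]
    refine Finset.sum_congr rfl fun k _ => ?_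
    rw [mul_assoc, Tr_C_mul, ← pow_mul, mul_comm (p ^ e), pow_mul, rt_pow]
  refine RS_of_Er hlt.ne fun t => ?_
  apply MvPolynomial.funext
  intro x
  let Y : Fin m → Matrix (Fin n) (Fin n) K := fun l => Matrix.of fun a b => x (l, a, b)
  have hx : ∀ g : MvPolynomial (MV n m) K, eval x g = aeval (ev Y) g := by
    intro g; rw [← coe_aeval_eq_eval]; rfl
  rw [hx, hx]
  obtain ⟨P, hP⟩ := exists_poly (transvection i j Polynomial.X)
    (transvection i j (-Polynomial.X)) (Tr p e (h * f)) Y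
  have tmap : ∀ (u : Polynomial K) (s : K),
      (transvection i j u).map (Polynomial.eval s) = transvection i j (u.eval s) := by
    intro u s
    ext x y
    simp only [transvection, Matrix.map_apply, Matrix.add_apply, Polynomial.eval_add,
      Matrix.one_apply, single_apply]
    split_ifs <;> simp
  simp only [tmap, Polynomial.eval_neg, Polynomial.eval_X, ← aeval_Er] at hP
  have hcomp : P.comp (Polynomial.X ^ p ^ e) = ∑ k ∈ Finset.range (p ^ e),
      Polynomial.C (aeval (ev Y) (Tr p e (hh k * f))) * Polynomial.X ^ k := by
    apply Polynomial.funext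
    intro τ
    rw [Polynomial.eval_comp, Polynomial.eval_pow, Polynomial.eval_X, hP, key]
    simp only [map_sum, map_mul, aeval_C, Algebra.algebraMap_self_apply, Polynomial.eval_finsetSum,
      Polynomial.eval_mul, Polynomial.eval_C, Polynomial.eval_pow, Polynomial.eval_X, mul_comm]
  have hdeg : P.natDegree = 0 := by
    have h1 := congrArg Polynomial.natDegree hcomp
    rw [Polynomial.natDegree_comp, Polynomial.natDegree_X_pow] at h1
    have h2 : P.natDegree * p ^ e ≤ p ^ e - 1 := by
      rw [h1]
      refine Polynomial.natDegree_sum_le_of_forall_le _ _ fun k hk => ?_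
      refine (Polynomial.natDegree_C_mul_X_pow_le _ _).trans ?_
      have := Finset.mem_range.1 hk
      omega
    by_contra h0
    have := Nat.mul_le_mul_right (p ^ e) (Nat.one_le_iff_ne_zero.2 h0)
    have := qpos (K := K) p e
    omega
  have e0 : Er i j (0 : K) (Tr p e (h * f)) = Tr p e (h * f) := by
    rw [Er]
    simp only [map_zero, neg_zero, transvection_zero, one_mul, mul_one]
    exact aeval_X_left_apply _
  rw [← hP, Polynomial.eq_C_of_natDegree_eq_zero hdeg, Polynomial.eval_C,
    Polynomial.coeff_zero_eq_eval_zero, hP, e0]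
end root
end CMProof


namespace CMProof

section lew
variable {σ : Type*} {R : Type*} [CommRing R]

def LeW (w : σ → ℤ) (N : ℤ) (f : MvPolynomial σ R) : Prop := ∀ α ∈ f.support, wd w α ≤ N

lemma LeW.mono {w : σ → ℤ} {N N' : ℤ} {f : MvPolynomial σ R} (h : LeW w N f) (hN : N ≤ N') :
    LeW w N' f := fun α hα => (h α hα).trans hN

lemma LeW.zero (w : σ → ℤ) (N : ℤ) : LeW w N (0 : MvPolynomial σ R) := by
  intro α hα; simp at hα

lemma LeW.mul {w : σ → ℤ} {N N' : ℤ} {f g : MvPolynomial σ R} (h : LeW w N f) (h' : LeW w N' g) :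
    LeW w (N + N') (f * g) := by
  classical
  intro α hα
  obtain ⟨a, ha, b, hb, rfl⟩ := Finset.mem_add.1 (support_mul f g hα)
  rw [map_add]
  exact add_le_add (h a ha) (h' b hb)

lemma LeW.sum {ι : Type*} {w : σ → ℤ} {N : ℤ} (s : Finset ι) {f : ι → MvPolynomial σ R}
    (h : ∀ i ∈ s, LeW w N (f i)) : LeW w N (∑ i ∈ s, f i) := by
  classical
  intro α hα
  obtain ⟨i, hi, h1⟩ := Finset.mem_biUnion.1 (support_sum hα)
  exact h i hi α h1

lemma IsLead.leW {w : σ → ℤ} {f : MvPolynomial σ R} {μ : σ →₀ ℕ} {c : R} (h : IsLead w f μ c) :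
    LeW w (wd w μ) f := fun _ hα => h.le hα

lemma prodX {ι : Type*} (s : Finset ι) (v : ι → σ) :
    (∏ i ∈ s, X (v i) : MvPolynomial σ R) = monomial (∑ i ∈ s, Finsupp.single (v i) 1) 1 := by
  classical
  induction s using Finset.induction_on with
  | empty => simp
  | insert a s ha ih =>
    rw [Finset.prod_insert ha, Finset.sum_insert ha, ih, X, monomial_mul, one_mul]

lemma wd_sum {ι : Type*} (w : σ → ℤ) (s : Finset ι) (v : ι → σ) :
    wd w (∑ i ∈ s, Finsupp.single (v i) 1) = ∑ i ∈ s, w (v i) := by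
  rw [map_sum]; simp only [wd_single]

lemma LeW.monomial (w : σ → ℤ) (μ : σ →₀ ℕ) (c : R) : LeW w (wd w μ) (monomial μ c) :=
  (IsLead.monomial w μ c).leW

lemma LeW.smul_int {w : σ → ℤ} {N : ℤ} {f : MvPolynomial σ R} (h : LeW w N f) (k : ℤ) :
    LeW w N (k • f) := by
  intro α hα
  apply h
  rw [mem_support_iff] at hα ⊢
  intro h0
  apply hα
  rw [← Int.cast_smul_eq_zsmul R, coeff_smul, h0, smul_zero]

lemma IsLead.add' {w : σ → ℤ} {f g : MvPolynomial σ R} {μ : σ →₀ ℕ} {c : R} {N : ℤ}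
    (h : IsLead w f μ c) (hg : LeW w N g) (hN : N < wd w μ) : IsLead w (f + g) μ c :=
  h.add fun α hα => (hg α hα).trans_lt hN
end lew

section wts
variable {n m : ℕ}

/-- the weight function -/
def wl (M : ℤ) : MV n m → ℤ := fun v =>
  M * (-2 * (v.1.val : ℤ) * v.2.1.val + (2 * v.1.val + 1) * v.2.2.val) - v.2.1.val * v.2.2.val

variable {K : Type} [Field K] {ι : Type*} [Fintype ι] [DecidableEq ι]

lemma wl_perm (M : ℤ) (l : Fin m) (u : ι → Fin n) (τ : Equiv.Perm ι) :
    ∑ i, wl (m := m) M (l, u (τ i), u i) =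
      M * ∑ i, ((u i).val : ℤ) - ∑ i, ((u (τ i)).val : ℤ) * (u i).val := by
  simp only [wl, Finset.sum_sub_distrib, ← Finset.mul_sum, Finset.sum_add_distrib, mul_assoc]
  rw [Equiv.sum_comp τ (fun i => ((u i).val : ℤ))]
  simp only [← mul_assoc]
  ring

lemma perm_quad (u : ι → Fin n) (hu : Function.Injective u) (ρ τ : Equiv.Perm ι) (s : ℤ)
    (hρ : ∀ i, ((u (ρ i)).val : ℤ) + (u i).val = s) (hne : τ ≠ ρ) :
    ∑ i, ((u (ρ i)).val : ℤ) * (u i).val < ∑ i, ((u (τ i)).val : ℤ) * (u i).val := by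
  have key : ∀ π : Equiv.Perm ι, 2 * ∑ i, ((u (π i)).val : ℤ) * (u i).val =
      ∑ i, (((u (π i)).val : ℤ) + (u i).val - s) ^ 2 +
        ∑ i, (4 * s * (u i).val - 2 * (u i).val ^ 2 - s ^ 2 : ℤ) := by
    intro π
    have e1 : ∀ i, (((u (π i)).val : ℤ) + (u i).val - s) ^ 2 = 2 * (((u (π i)).val : ℤ) * (u i).val)
        + ((fun i => ((u i).val : ℤ) ^ 2 - 2 * s * (u i).val) (π i) + ((u i).val ^ 2
         - 2 * s * (u i).val + s ^ 2)) := by intro i; ring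
    simp only [e1]
    rw [Finset.sum_add_distrib, Finset.sum_add_distrib,
      Equiv.sum_comp π (fun i => ((u i).val : ℤ) ^ 2 - 2 * s * (u i).val), Finset.mul_sum,
      ← Finset.sum_add_distrib, add_assoc, ← Finset.sum_add_distrib]
    rw [left_eq_add]
    exact Finset.sum_eq_zero fun i _ => by ring
  have h1 := key ρ
  have h2 := key τ
  have h3 : ∑ i, (((u (ρ i)).val : ℤ) + (u i).val - s) ^ 2 = 0 :=
    Finset.sum_eq_zero fun i _ => by rw [hρ]; ring
  have h4 : 0 < ∑ i, (((u (τ i)).val : ℤ) + (u i).val - s) ^ 2 := by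
    obtain ⟨i, hi⟩ : ∃ i, τ i ≠ ρ i := by
      by_contra! h; exact hne (Equiv.ext h)
    refine Finset.sum_pos' (fun i _ => sq_nonneg _) ⟨i, Finset.mem_univ _, ?_⟩
    refine lt_of_le_of_ne (sq_nonneg _) (Ne.symm (pow_ne_zero 2 ?_))
    intro h
    apply hi
    apply hu
    apply Fin.ext
    have := hρ i
    omega
  omega

lemma antidet (M : ℤ) (l : Fin m) (u : ι → Fin n) (hu : Function.Injective u)
    (ρ : Equiv.Perm ι) (s : ℤ) (hρ : ∀ i, ((u (ρ i)).val : ℤ) + (u i).val = s) :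
    IsLead (wl M) (det ((Xg n m K l).submatrix u u)) (∑ i, Finsupp.single (l, u (ρ i), u i) 1)
      ((Equiv.Perm.sign ρ : ℤ) : K) := by
  rw [det_apply, ← Finset.add_sum_erase _ _ (Finset.mem_univ ρ)]
  have e : ∀ τ : Equiv.Perm ι, ∏ i, (Xg n m K l).submatrix u u (τ i) i =
      monomial (∑ i, Finsupp.single (l, u (τ i), u i) 1) 1 := by
    intro τ; rw [← prodX]; rfl
  simp only [e]
  refine IsLead.add' (N := wd (wl M) (∑ i, Finsupp.single (l, u (ρ i), u i) 1) - 1) ?_ ?_ (by omega)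
  · rw [Units.smul_def, ← Int.cast_smul_eq_zsmul K, smul_monomial, smul_eq_mul, mul_one]
    exact IsLead.monomial _ _ _
  · refine LeW.sum _ fun τ hτ => ?_
    rw [Units.smul_def]
    refine LeW.smul_int ((LeW.monomial _ _ _).mono ?_) _
    rw [wd_sum, wd_sum, wl_perm, wl_perm]
    have := perm_quad u hu ρ τ s hρ (Finset.ne_of_mem_erase hτ)
    omega

lemma det_leW (M : ℤ) (l : Fin m) (u : ι → Fin n) :
    LeW (wl M) (M * ∑ i, ((u i).val : ℤ)) (det ((Xg n m K l).submatrix u u)) := by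
  rw [det_apply]
  refine LeW.sum _ fun τ _ => ?_
  have e : ∏ i, (Xg n m K l).submatrix u u (τ i) i =
      monomial (∑ i, Finsupp.single (l, u (τ i), u i) 1) 1 := by
    rw [← prodX]; rfl
  rw [e, Units.smul_def]
  refine LeW.smul_int ((LeW.monomial _ _ _).mono ?_) _
  rw [wd_sum, wl_perm]
  have : 0 ≤ ∑ i, ((u (τ i)).val : ℤ) * (u i).val :=
    Finset.sum_nonneg fun i _ => by positivity
  omega

/-- antidiagonal monomial -/
noncomputable def AD (n : ℕ) {m : ℕ} (l : Fin m) (s : ℕ) : MV n m →₀ ℕ :=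
  Finsupp.equivFunOnFinite.symm fun v => if v.1 = l ∧ v.2.1.val + v.2.2.val = s then 1 else 0

lemma AD_apply (l : Fin m) (s : ℕ) (v : MV n m) :
    AD n l s v = if v.1 = l ∧ v.2.1.val + v.2.2.val = s then 1 else 0 := rfl

lemma AD_eq (l : Fin m) (u : ι → Fin n) (hu : Function.Injective u) (ρ : Equiv.Perm ι) (s : ℕ)
    (hρ : ∀ i, (u (ρ i)).val + (u i).val = s)
    (hs : ∀ a b : Fin n, a.val + b.val = s → ∃ i, u i = b) :
    ∑ i, Finsupp.single (l, u (ρ i), u i) 1 = AD n l s := by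
  classical
  ext ⟨l', a, b⟩
  rw [AD_apply, Finsupp.finsetSum_apply]
  split_ifs with h
  · obtain ⟨rfl, h⟩ := h
    obtain ⟨i, rfl⟩ := hs a b h
    have ha : u (ρ i) = a := by apply Fin.ext; have := hρ i; simp at h; omega
    rw [Finset.sum_eq_single i]
    · rw [ha]; simp
    · intro j _ hj
      rw [Finsupp.single_apply, if_neg]
      intro e; apply hj; apply hu; simpa using congrArg (fun v => v.2.2) e
    · simp
  · refine Finset.sum_eq_zero fun i _ => ?_
    rw [Finsupp.single_apply, if_neg]
    rintro ⟨⟩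
    exact h ⟨rfl, hρ i⟩

/-- comparing sums of finsets -/
lemma sum_lt_of_thr (B B0 : Finset ℕ) (hc : B.card = B0.card) (c : ℕ) (h0 : ∀ x ∈ B0 \ B, c ≤ x)
    (h1 : ∀ x ∈ B \ B0, x < c) (hne : B ≠ B0) : ∑ i ∈ B, i < ∑ i ∈ B0, i := by
  rw [← Finset.sum_inter_add_sum_sdiff B B0, ← Finset.sum_inter_add_sum_sdiff B0 B,
    Finset.inter_comm B0 B, Nat.add_lt_add_iff_left]
  have hc' := Finset.card_sdiff_comm hc
  have hn : (B \ B0).Nonempty := by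
    rw [Finset.sdiff_nonempty]; intro h; exact hne (Finset.eq_of_subset_of_card_le h hc.ge)
  calc ∑ i ∈ B \ B0, i < ∑ i ∈ B \ B0, c := Finset.sum_lt_sum_of_nonempty hn h1
    _ = ∑ i ∈ B0 \ B, c := by simp [hc']
    _ ≤ _ := Finset.sum_le_sum h0

lemma mul_sum_bound (u v : ι → Fin n) (hc : Fintype.card ι ≤ n) :
    ∑ i, ((v i).val : ℤ) * (u i).val ≤ n ^ 3 := by
  calc ∑ i, ((v i).val : ℤ) * (u i).val ≤ ∑ i : ι, (n : ℤ) * n :=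
        Finset.sum_le_sum fun i _ => mul_le_mul (by have := (v i).2; omega)
          (by have := (u i).2; omega) (by positivity) (by positivity)
    _ = Fintype.card ι * (n * n : ℤ) := by simp
    _ ≤ n * (n * n : ℤ) := mul_le_mul_of_nonneg_right (by exact_mod_cast hc) (by positivity)
    _ = _ := by ring

/-- coefficients of the characteristic polynomial -/
noncomputable def sg (K : Type) [Field K] (n : ℕ) {m : ℕ} (l : Fin m) (c : ℕ) :
    MvPolynomial (MV n m) K := (Xg n m K l).charpoly.coeff c

lemma sg_lead {M : ℤ} (hM : (n : ℤ) ^ 3 < M) (l : Fin m) (c : ℕ) (hc : c < n) :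
    ∃ a : K, a ≠ 0 ∧ IsLead (wl M) (sg K n l c) (AD n l (n - 1 + c)) a := by
  classical
  let B0 : Finset (Fin n) := Finset.univ.filter fun i => c ≤ i.val
  have hB0 : B0.map Fin.valEmbedding = Finset.Ico c n := by
    ext x
    simp only [B0, Finset.mem_map, Finset.mem_filter, Finset.mem_univ, true_and, Finset.mem_Ico,
      Fin.valEmbedding_apply]
    exact ⟨fun ⟨a, h, e⟩ => by have := a.2; omega, fun h => ⟨⟨x, h.2⟩, h.1, rfl⟩⟩
  have hcard : B0.card = n - c := by
    rw [← Finset.card_map Fin.valEmbedding, hB0, Nat.card_Ico]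
  have e1 := charpoly_coeff_eq_sum_minors (Xg n m K l) (n - c) (by simp)
  rw [Fintype.card_fin, Nat.sub_sub_self hc.le] at e1
  have hm : B0 ∈ Finset.univ.powersetCard (n - c) := by
    rw [Finset.mem_powersetCard]; exact ⟨Finset.subset_univ _, hcard⟩
  let f : B0 → B0 := fun i => ⟨⟨n - 1 + c - i.1.val, by
    have := (Finset.mem_filter.1 i.2).2; have := i.1.2; omega⟩, by
    have := i.1.2; simp [B0]; omega⟩
  have hf : Function.Involutive f := by
    intro i; apply Subtype.ext; apply Fin.ext
    have := (Finset.mem_filter.1 i.2).2; have := i.1.2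
    simp only [f]; omega
  have hρ : ∀ i : B0, ((f i).1.val) + i.1.val = n - 1 + c := by
    intro i
    have := (Finset.mem_filter.1 i.2).2; have := i.1.2
    simp only [f]; omega
  have had := AD_eq l (fun i : B0 => i.1) Subtype.val_injective (hf.toPerm f) (n - 1 + c) hρ (by
    intro a b h
    refine ⟨⟨b, ?_⟩, rfl⟩
    simp only [B0, Finset.mem_filter, Finset.mem_univ, true_and]
    have := a.2; omega)
  have h1 := antidet (K := K) M l (fun i : B0 => i.1) Subtype.val_injective (hf.toPerm f)
    ((n - 1 + c : ℕ) : ℤ) (fun i => by exact_mod_cast hρ i)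
  have hw : wd (wl M) (AD n l (n - 1 + c)) ≥ M * ∑ i : B0, (i.1.val : ℤ) - n ^ 3 := by
    rw [← had, wd_sum, wl_perm M l (fun i : B0 => i.1)]
    have := mul_sum_bound (fun i : B0 => i.1) (fun i => (hf.toPerm f i).1)
      (by simpa using (Finset.card_le_univ B0))
    omega
  rw [had] at h1
  have h2 := h1.add' (g := ∑ s ∈ (Finset.univ.powersetCard (n - c)).erase B0,
    ((Xg n m K l).submatrix (Subtype.val : s → Fin n) (Subtype.val : s → Fin n)).det)
    (N := M * ∑ i : B0, (i.1.val : ℤ) - M) (by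
      refine LeW.sum _ fun s hs => (det_leW M l _).mono ?_
      rw [Finset.mem_erase, Finset.mem_powersetCard] at hs
      have := sum_lt_of_thr (s.map Fin.valEmbedding) (B0.map Fin.valEmbedding)
        (by simp [hcard, hs.2.2]) c (fun x hx => by
          rw [hB0, Finset.mem_sdiff, Finset.mem_Ico] at hx; exact hx.1.1) (fun x hx => by
          rw [hB0, Finset.mem_sdiff, Finset.mem_Ico, Finset.mem_map] at hx
          obtain ⟨⟨a, _, rfl⟩, h⟩ := hx
          have := a.2
          simp only [Fin.valEmbedding_apply] at *
          omega) (fun h => hs.1 (Finset.map_injective _ h))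
      rw [Finset.sum_map, Finset.sum_map] at this
      simp only [Fin.valEmbedding_apply] at this
      rw [← Finset.sum_coe_sort s, ← Finset.sum_coe_sort B0] at this
      have h3 : ∑ i : s, (i.1.val : ℤ) + 1 ≤ ∑ i : B0, (i.1.val : ℤ) := by exact_mod_cast this
      have h4 := mul_le_mul_of_nonneg_left h3 (show 0 ≤ M by
        have : (0 : ℤ) ≤ (n : ℤ) ^ 3 := by positivity
        omega)
      rw [mul_add, mul_one] at h4
      omega) (by omega)
  rw [Finset.add_sum_erase _ (fun s : Finset (Fin n) => ((Xg n m K l).submatrix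
    (Subtype.val : s → Fin n) (Subtype.val : s → Fin n)).det) hm] at h2
  rw [sg, e1]
  have h5 : IsLead (wl M) ((-1 : MvPolynomial (MV n m) K) ^ (n - c)) 0 ((-1) ^ (n - c)) := by
    have := IsLead.monomial (wl (n := n) (m := m) M) 0 ((-1 : K) ^ (n - c))
    simpa using this
  refine ⟨_, ?_, by simpa only [zero_add] using h5.mul h2⟩
  refine mul_ne_zero (pow_ne_zero _ (by simp)) ?_
  rcases Int.units_eq_one_or (Equiv.Perm.sign (hf.toPerm f)) with h | h <;> rw [h] <;> simp

/-! ### leading minors of the product -/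
noncomputable def Zm (K : Type) [Field K] (n m : ℕ) : ℕ → Matrix (Fin n) (Fin n) (MvPolynomial (MV n m) K)
  | 0 => 1
  | r + 1 => Zm K n m r * (if h : r < m then Xg n m K ⟨r, h⟩ else 1)

lemma det_expand {R : Type*} [CommRing R] (A B : Matrix (Fin n) (Fin n) R) (u f : ι → Fin n) :
    det ((A * B).submatrix u f) = ∑ g : ι → Fin n, (∏ j, B (g j) (f j)) * det (A.submatrix u g) := by
  simp only [det_apply, submatrix_apply, Matrix.mul_apply, Finset.prod_univ_sum,
    Fintype.piFinset_univ, Finset.smul_sum, Finset.mul_sum]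
  rw [Finset.sum_comm]
  refine Finset.sum_congr rfl fun g _ => Finset.sum_congr rfl fun τ _ => ?_
  rw [Finset.prod_mul_distrib, mul_smul_comm, mul_comm]

section V
variable {k : ℕ} (hk : k ≤ n)

def uk : Fin k → Fin n := Fin.castLE hk

lemma uk_inj : Function.Injective (uk hk) := Fin.castLE_injective hk

lemma sum_uk_lt {g : Fin k → Fin n} (hg : Function.Injective g)
    (h : ∀ τ : Equiv.Perm (Fin k), g ≠ uk hk ∘ τ) :
    ∑ i, ((uk hk i).val : ℤ) + 1 ≤ ∑ i, ((g i).val : ℤ) := by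
  classical
  have hi : Function.Injective fun i => (g i).val := Fin.val_injective.comp hg
  have := sum_lt_of_thr (Finset.range k) (Finset.univ.image fun i => (g i).val)
    (by rw [Finset.card_image_of_injective _ hi]; simp) k (by simp) (fun x hx => by simpa using (Finset.mem_sdiff.1 hx).1) (by
      intro e
      have h1 : ∀ i, (g i).val < k := by
        intro i
        have : (g i).val ∈ Finset.range k := by rw [e]; exact Finset.mem_image_of_mem _ (Finset.mem_univ _)
        simpa using this
      let τ : Fin k → Fin k := fun i => ⟨(g i).val, h1 i⟩
      have hτ : Function.Injective τ := fun a b hab => hi (by simpa [τ] using hab)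
      exact h (Equiv.ofBijective τ (Finite.injective_iff_bijective.1 hτ)) (by
        funext i; apply Fin.ext; simp [τ, uk]))
  rw [Finset.sum_image hi.injOn, Finset.sum_range] at this
  exact_mod_cast this

lemma sum_uk_le {g : Fin k → Fin n} (hg : Function.Injective g) :
    ∑ i, ((uk hk i).val : ℤ) ≤ ∑ i, ((g i).val : ℤ) := by
  by_cases h : ∀ τ : Equiv.Perm (Fin k), g ≠ uk hk ∘ τ
  · have := sum_uk_lt hk hg h; omega
  · push Not at h
    obtain ⟨τ, rfl⟩ := h
    simp only [Function.comp]
    rw [Equiv.sum_comp τ (fun i => ((uk hk i).val : ℤ))]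

lemma prod_leW {M : ℤ} (l : Fin m) (g f : Fin k → Fin n) :
    LeW (wl M) (M * (-2 * l.val * ∑ i, ((g i).val : ℤ) + (2 * l.val + 1) * ∑ i, ((f i).val : ℤ)))
      (∏ j, Xg n m K l (g j) (f j)) := by
  have e : ∏ j, Xg n m K l (g j) (f j) = monomial (∑ i, Finsupp.single (l, g i, f i) 1) 1 := by
    rw [← prodX]; rfl
  rw [e]
  refine (LeW.monomial _ _ _).mono ?_
  rw [wd_sum]
  simp only [wl, Finset.sum_sub_distrib, ← Finset.mul_sum, Finset.sum_add_distrib]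
  have : 0 ≤ ∑ i, ((g i).val : ℤ) * (f i).val := Finset.sum_nonneg fun i _ => by positivity
  omega

lemma Zm_leW {M : ℤ} (hM : 0 ≤ M) (r : ℕ) (hr : r ≤ m) (f : Fin k → Fin n) :
    LeW (wl M) (M * ((2 * r - 1) * ∑ i, ((f i).val : ℤ) - (r - 1) * ∑ i, ((uk hk i).val : ℤ)))
      (det ((Zm K n m r).submatrix (uk hk) f)) := by
  induction r generalizing f with
  | zero =>
    rw [det_apply]
    refine LeW.sum _ fun τ _ => ?_
    rw [Units.smul_def]
    refine LeW.smul_int ?_ _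
    by_cases h : ∀ i, uk hk (τ i) = f i
    · have e : ∑ i, ((f i).val : ℤ) = ∑ i, ((uk hk i).val : ℤ) := by
        simp only [← h]
        exact Equiv.sum_comp τ (fun i => ((uk hk i).val : ℤ))
      rw [e, Finset.prod_eq_one]
      · refine (LeW.monomial (wl M) 0 1).mono ?_
        simp
      · intro i _; rw [submatrix_apply, h, Zm, Matrix.one_apply_eq]
    · push Not at h
      obtain ⟨i, hi⟩ := h
      rw [Finset.prod_eq_zero (Finset.mem_univ i)]
      · exact LeW.zero _ _
      · simp [Zm, Matrix.one_apply, hi]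
  | succ r ih =>
    rw [Zm, dif_pos (show r < m by omega), det_expand]
    refine LeW.sum _ fun g _ => ?_
    by_cases hg : Function.Injective g
    · refine ((prod_leW _ g f).mul (ih (by omega) g)).mono ?_
      rw [← mul_add]
      refine mul_le_mul_of_nonneg_left ?_ hM
      have := sum_uk_le hk hg
      push_cast
      nlinarith
    · simp only [Function.Injective] at hg
      push Not at hg
      obtain ⟨a, b, h1, h2⟩ := hg
      rw [det_zero_of_column_eq h2 (by intro x; simp [h1]), mul_zero]
      exact LeW.zero _ _

lemma Zm_lead {M : ℤ} (hM : (m : ℤ) * (n : ℤ) ^ 3 < M) (hk0 : 0 < k) (r : ℕ) (hr : r ≤ m) :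
    ∃ a : K, a ≠ 0 ∧ IsLead (wl M) (det ((Zm K n m r).submatrix (uk hk) (uk hk)))
      (∑ l ∈ Finset.univ.filter (fun l : Fin m => l.val < r), AD n l (k - 1)) a := by
  classical
  have hM0 : 0 ≤ M := by
    have : (0 : ℤ) ≤ (m : ℤ) * (n : ℤ) ^ 3 := by positivity
    omega
  have hρ : ∀ i : Fin k, (uk hk (Fin.revPerm i)).val + (uk hk i).val = k - 1 := by
    intro i; simp [uk, Fin.val_rev]; omega
  have had := fun l : Fin m => AD_eq l (uk hk) (uk_inj hk) Fin.revPerm (k - 1) hρ (by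
    intro a b h
    by_cases hb : b.val < k
    · exact ⟨⟨b.val, hb⟩, rfl⟩
    · omega)
  induction r with
  | zero =>
    refine ⟨1, one_ne_zero, ?_⟩
    have : (Zm K n m 0).submatrix (uk hk) (uk hk) = 1 := by
      rw [Zm, submatrix_one _ (uk_inj hk)]
    rw [this, det_one]
    simpa using IsLead.one (wl M)
  | succ r ih =>
    obtain ⟨a, ha, h⟩ := ih (by omega)
    have hrm : r < m := by omega
    have hl := antidet (K := K) M (⟨r, hrm⟩ : Fin m) (uk hk) (uk_inj hk) Fin.revPerm ((k - 1 : ℕ) : ℤ)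
      (fun i => by exact_mod_cast hρ i)
    rw [had] at hl
    have hw : ∀ l : Fin m, wd (wl M) (AD n l (k - 1)) ≥ M * ∑ i, ((uk hk i).val : ℤ) - n ^ 3 := by
      intro l
      rw [← had, wd_sum, wl_perm M l (uk hk)]
      have := mul_sum_bound (uk hk) (fun i => uk hk (Fin.revPerm i)) (by simpa using hk)
      omega
    have hfil : (Finset.univ.filter (fun l : Fin m => l.val < r + 1)) =
        insert ⟨r, hrm⟩ (Finset.univ.filter (fun l : Fin m => l.val < r)) := by
      ext l; simp [Fin.ext_iff]; omega
    have hsum : ∑ l ∈ Finset.univ.filter (fun l : Fin m => l.val < r + 1), AD n l (k - 1) =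
        AD n ⟨r, hrm⟩ (k - 1) + ∑ l ∈ Finset.univ.filter (fun l : Fin m => l.val < r), AD n l (k - 1) := by
      rw [hfil, Finset.sum_insert (by simp)]
    have hcard : (Finset.univ.filter (fun l : Fin m => l.val < r + 1)).card = r + 1 := by
      have : (Finset.univ.filter (fun l : Fin m => l.val < r + 1)).map Fin.valEmbedding =
          Finset.range (r + 1) := by
        ext x
        simp only [Finset.mem_map, Finset.mem_filter, Finset.mem_univ, true_and, Finset.mem_range,
          Fin.valEmbedding_apply]
        exact ⟨fun ⟨a, h, e⟩ => by omega, fun h => ⟨⟨x, by omega⟩, h, rfl⟩⟩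
      rw [← Finset.card_map Fin.valEmbedding, this, Finset.card_range]
    have hwt : (r + 1 : ℤ) * (M * ∑ i, ((uk hk i).val : ℤ) - n ^ 3) ≤
        wd (wl M) (∑ l ∈ Finset.univ.filter (fun l : Fin m => l.val < r + 1), AD n l (k - 1)) := by
      rw [map_sum]
      refine le_trans ?_ (Finset.sum_le_sum fun l _ => hw l)
      rw [Finset.sum_const, hcard, nsmul_eq_mul]
      push_cast
      exact le_rfl
    refine ⟨(((Equiv.Perm.sign (Fin.revPerm : Equiv.Perm (Fin k)) : ℤ) : K)) * a, ?_, ?_⟩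
    rotate_left
    · rw [Zm, dif_pos hrm, det_expand]
      rw [← Finset.sum_add_sum_compl (Finset.univ.image fun τ : Equiv.Perm (Fin k) => uk hk ∘ τ)]
      rw [Finset.sum_image (g := fun τ : Equiv.Perm (Fin k) => uk hk ∘ τ)
        (fun τ _ τ' _ e => Equiv.ext fun i => uk_inj hk (congrFun e i))]
      have e1 : ∑ τ : Equiv.Perm (Fin k), (∏ j, Xg n m K ⟨r, hrm⟩ ((uk hk ∘ τ) j) (uk hk j)) *
          det ((Zm K n m r).submatrix (uk hk) (uk hk ∘ τ)) =
          det ((Xg n m K ⟨r, hrm⟩).submatrix (uk hk) (uk hk)) *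
            det ((Zm K n m r).submatrix (uk hk) (uk hk)) := by
        rw [det_apply, Finset.sum_mul]
        refine Finset.sum_congr rfl fun τ _ => ?_
        have := det_permute' τ ((Zm K n m r).submatrix (uk hk) (uk hk))
        rw [submatrix_submatrix] at this
        rw [Function.comp_id] at this
        rw [this, Units.smul_def, zsmul_eq_mul]
        simp only [submatrix_apply, Function.comp]
        ring
      rw [e1, hsum]
      refine IsLead.add' (hl.mul h) (N := M * ((r + 1) * ∑ i, ((uk hk i).val : ℤ) - 1)) ?_ ?_
      · refine LeW.sum _ fun g hg => ?_
        by_cases hgi : Function.Injective g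
        · refine ((prod_leW _ g _).mul (Zm_leW hk hM0 r (by omega) g)).mono ?_
          rw [← mul_add]
          refine mul_le_mul_of_nonneg_left ?_ hM0
          have := sum_uk_lt hk hgi (fun τ e => by
            rw [Finset.mem_compl] at hg
            exact hg (Finset.mem_image.2 ⟨τ, Finset.mem_univ _, e.symm⟩))
          push_cast
          nlinarith
        · simp only [Function.Injective] at hgi
          push Not at hgi
          obtain ⟨a, b, h1, h2⟩ := hgi
          rw [det_zero_of_column_eq h2 (by intro x; simp [h1]), mul_zero]
          exact LeW.zero _ _
      · rw [← hsum]
        refine lt_of_lt_of_le ?_ hwt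
        have : (r + 1 : ℤ) * n ^ 3 ≤ m * n ^ 3 :=
          mul_le_mul_of_nonneg_right (by exact_mod_cast hrm) (by positivity)
        nlinarith
    · refine mul_ne_zero ?_ ha
      rcases Int.units_eq_one_or (Equiv.Perm.sign (Fin.revPerm : Equiv.Perm (Fin k))) with h | h <;>
        rw [h] <;> simp
end V
end wts
end CMProof


namespace CMProof
section V
variable {n m : ℕ} {K : Type} [Field K] {k : ℕ} (hk : k ≤ n)

lemma Zm_conj {g g' : Matrix (Fin n) (Fin n) (MvPolynomial (MV n m) K)} (h : g * g' = 1) (r : ℕ) :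
    (Zm K n m r).map (aeval (ev fun l => g * Xg n m K l * g') :
      MvPolynomial (MV n m) K →ₐ[K] MvPolynomial (MV n m) K) = g * Zm K n m r * g' := by
  have h' : g' * g = 1 := mul_eq_one_comm.1 h
  induction r with
  | zero => rw [Zm, Matrix.map_one _ (map_zero _) (map_one _), mul_one, h]
  | succ r ih =>
    rw [Zm, Matrix.map_mul, ih]
    split_ifs with hr
    · have : (Xg n m K ⟨r, hr⟩).map (aeval (ev fun l => g * Xg n m K l * g') :
        MvPolynomial (MV n m) K →ₐ[K] MvPolynomial (MV n m) K) = g * Xg n m K ⟨r, hr⟩ * g' := by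
        ext a b : 2
        simp [Xg, ev]
      rw [this]
      calc _ = g * Zm K n m r * (g' * g) * Xg n m K ⟨r, hr⟩ * g' := by simp only [mul_assoc]
        _ = _ := by rw [h']; simp only [mul_assoc, mul_one, one_mul]
    · rw [Matrix.map_one _ (map_zero _) (map_one _), mul_one, mul_one]

noncomputable def Vk (K : Type) [Field K] {n k : ℕ} (m : ℕ) (hk : k ≤ n) : MvPolynomial (MV n m) K := det ((Zm K n m m).submatrix (uk hk) (uk hk))

lemma Vk_conj {g g' : Matrix (Fin n) (Fin n) (MvPolynomial (MV n m) K)} (h : g * g' = 1) :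
    aeval (ev fun l => g * Xg n m K l * g') (Vk K m hk) =
      det ((g * Zm K n m m * g').submatrix (uk hk) (uk hk)) := by
  rw [← Zm_conj h, Vk, AlgHom.map_det]
  rfl

lemma sub_mul {R : Type*} [CommRing R] (Y T : Matrix (Fin n) (Fin n) R)
    (h : ∀ d b : Fin n, k ≤ d.val → b.val < k → T d b = 0) :
    (Y * T).submatrix (uk hk) (uk hk) = Y.submatrix (uk hk) (uk hk) * T.submatrix (uk hk) (uk hk) := by
  ext a b
  simp only [submatrix_apply, Matrix.mul_apply]
  symm
  refine Finset.sum_of_injOn (uk hk) (uk_inj hk).injOn (fun _ _ => Finset.mem_coe.2 (Finset.mem_univ _)) ?_ (fun _ _ => rfl)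
  intro d _ hd
  rw [h d _ ?_ (by simp [uk]), mul_zero]
  by_contra! hlt
  exact hd ⟨⟨d.val, hlt⟩, by simp, rfl⟩

lemma mul_sub {R : Type*} [CommRing R] (Y T : Matrix (Fin n) (Fin n) R)
    (h : ∀ d b : Fin n, k ≤ d.val → b.val < k → T b d = 0) :
    (T * Y).submatrix (uk hk) (uk hk) = T.submatrix (uk hk) (uk hk) * Y.submatrix (uk hk) (uk hk) := by
  ext a b
  simp only [submatrix_apply, Matrix.mul_apply]
  symm
  refine Finset.sum_of_injOn (uk hk) (uk_inj hk).injOn (fun _ _ => Finset.mem_coe.2 (Finset.mem_univ _)) ?_ (fun _ _ => rfl)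
  intro d _ hd
  rw [h d _ ?_ (by simp [uk]), zero_mul]
  by_contra! hlt
  exact hd ⟨⟨d.val, hlt⟩, by simp, rfl⟩

lemma Vk_TW [Infinite K] : TW (Vk K m hk) := by
  refine TW_of_diag fun u u' h => ?_
  rw [Vk_conj, sub_mul, mul_sub, det_mul, det_mul, Vk]
  · have e : ∀ v : Fin n → K, det ((diagonal fun j => (C (v j) : MvPolynomial (MV n m) K)).submatrix (uk hk) (uk hk)) = ∏ i, C (v (uk hk i)) := by
      intro v
      rw [submatrix_diagonal _ _ (uk_inj hk), det_diagonal]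
      rfl
    rw [e, e, mul_right_comm, ← Finset.prod_mul_distrib]
    simp [← C_mul, h]
  · intro d b h1 h2
    rw [diagonal_apply_ne]; rintro rfl; omega
  · intro d b h1 h2
    rw [diagonal_apply_ne]; rintro rfl; omega
  · rw [diagonal_mul_diagonal]
    simp [← C_mul, h]

lemma trans_apply {R : Type*} [CommRing R] (i j : Fin n) (c : R) (a b : Fin n) :
    transvection i j c a b = (if a = b then 1 else 0) + if i = a ∧ j = b then c else 0 := by
  simp [transvection, Matrix.one_apply, Matrix.single_apply]

lemma det_trans {R : Type*} [CommRing R] {i j : Fin n} (hij : i < j) (c : R) :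
    det ((transvection i j c).submatrix (uk hk) (uk hk)) = 1 := by
  rw [det_of_isUpperTriangular]
  · refine Finset.prod_eq_one fun a _ => ?_
    rw [submatrix_apply, trans_apply, if_pos rfl, if_neg, add_zero]
    rintro ⟨rfl, h⟩; exact hij.ne h.symm
  · intro a b hab
    have hab' : uk hk b < uk hk a := hab
    rw [submatrix_apply, trans_apply, if_neg hab'.ne', if_neg, add_zero]
    rintro ⟨rfl, rfl⟩; exact absurd hij hab'.le.not_gt

lemma Vk_Er {i j : Fin n} (hij : i.val + 1 = j.val) : ∃ W, (i.val + 1 ≠ k → W = 0) ∧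
    ∀ t : K, Er i j t (Vk K m hk) = Vk K m hk + C t * W := by
  have hlt : i < j := Fin.lt_def.2 (by omega)
  have h1 : ∀ t : K, Er i j t (Vk K m hk) =
      det ((transvection i j (C t) * Zm K n m m).submatrix (uk hk) (uk hk)) := by
    intro t
    rw [Er, Vk_conj, sub_mul, det_mul, det_trans hk hlt, mul_one]
    · intro d b h1 h2
      rw [trans_apply, if_neg (by rintro rfl; omega), if_neg, add_zero]
      rintro ⟨rfl, rfl⟩; omega
    · rw [transvection_mul_transvection_same _ _ hlt.ne, add_neg_cancel, transvection_zero]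
  by_cases hik : i.val + 1 = k
  · let i' : Fin k := ⟨i.val, by omega⟩
    have hi' : uk hk i' = i := rfl
    refine ⟨det (((Zm K n m m).submatrix (uk hk) (uk hk)).updateRow i' fun b => Zm K n m m j (uk hk b)),
      fun h => absurd hik h, fun t => ?_⟩
    rw [h1, ← det_updateRow_smul]
    have e : (transvection i j (C t) * Zm K n m m).submatrix (uk hk) (uk hk) =
      ((Zm K n m m).submatrix (uk hk) (uk hk)).updateRow i' (((Zm K n m m).submatrix (uk hk) (uk hk)) i' +
        (C t : MvPolynomial (MV n m) K) • fun b => Zm K n m m j (uk hk b)) := by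
      ext a b : 2
      by_cases ha : a = i'
      · subst ha
        rw [updateRow_self, submatrix_apply, hi', transvection_mul_apply_same]
        rfl
      · rw [updateRow_ne ha, submatrix_apply, transvection_mul_apply_of_ne, submatrix_apply]
        intro e; exact ha (uk_inj hk (e.trans hi'.symm))
    rw [e, det_updateRow_add, updateRow_eq_self]
    rfl
  · refine ⟨0, fun _ => rfl, fun t => ?_⟩
    rw [h1, mul_sub, det_mul, det_trans hk hlt, one_mul, mul_zero, add_zero]
    · rfl
    · intro d b h1 h2
      rw [trans_apply, if_neg (by rintro rfl; omega), if_neg, add_zero]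
      rintro ⟨rfl, rfl⟩; omega

lemma sg_conj {E : Type*} [CommRing E] [Algebra K E] {g g' : Matrix (Fin n) (Fin n) E} (h : g * g' = 1)
    (Y : Fin m → Matrix (Fin n) (Fin n) E) (l : Fin m) (c : ℕ) :
    aeval (ev fun l => g * Y l * g') (sg K n l c) = aeval (ev Y) (sg K n l c) := by
  have h' : g' * g = 1 := mul_eq_one_comm.1 h
  have e : ∀ Y : Fin m → Matrix (Fin n) (Fin n) E, aeval (ev Y) (sg K n l c) = (Y l).charpoly.coeff c := by
    intro Y
    have : (Xg n m K l).map (aeval (ev Y) : _ →ₐ[K] E) = Y l := by ext a b; simp [Xg, ev]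
    rw [← this]
    have h2 := charpoly_map (Xg n m K l) (aeval (ev Y) : MvPolynomial (MV n m) K →ₐ[K] E).toRingHom
    have h3 := congrArg (fun p => p.coeff c) h2
    simp only [Polynomial.coeff_map] at h3
    exact h3.symm
  rw [e, e]
  have := congrArg (fun p => p.coeff c)
    (charpoly_units_conj (⟨g, g', h, h'⟩ : (Matrix (Fin n) (Fin n) E)ˣ) (Y l))
  rw [← Matrix.coe_units_inv] at this
  exact this

lemma sg_mem (l : Fin m) (c : ℕ) : sg K n l c ∈ matrixInvariants K n m := by
  rw [mem_S_iff]
  intro A Y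
  exact sg_conj (Units.mul_inv A) Y l c

lemma TW.prod {ι : Type*} (s : Finset ι) (f : ι → MvPolynomial (MV n m) K) (h : ∀ i ∈ s, TW (f i)) :
    TW (∏ i ∈ s, f i) := by
  classical
  induction s using Finset.induction_on with
  | empty =>
    intro α hα i
    have : α = 0 := by
      by_contra h0
      rw [Finset.prod_empty, mem_support_iff, coeff_one, if_neg (Ne.symm h0)] at hα
      exact hα rfl
    subst this
    simp [rowc, colc]
  | insert a s ha ih =>
    rw [Finset.prod_insert ha]
    exact (h a (by simp)).mul (ih fun i hi => h i (by simp [hi]))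

lemma TW.pow {f : MvPolynomial (MV n m) K} (h : TW f) (k : ℕ) : TW (f ^ k) := by
  have := TW.prod (Finset.range k) (fun _ => f) fun _ _ => h
  rwa [Finset.prod_const, Finset.card_range] at this

theorem L3 (p : ℕ) [ExpChar K p] [PerfectRing K p] [Infinite K] (hp : p.Prime) (hm : 0 < m)
    {Q : MvPolynomial (Fin n) K} (hQ : Q ≠ 0) : ∃ (e : ℕ) (h : MvPolynomial (MV n m) K), TW h ∧
    (∀ i j : Fin n, i.val + 1 = j.val → ∃ hh : ℕ → MvPolynomial (MV n m) K,
      ∀ t, Er i j t h = ∑ k ∈ Finset.range (p ^ e), C (t ^ k) * hh k) ∧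
    coeff 0 (Tr p e (h * aeval (fun c : Fin n => sg K n (⟨0, hm⟩ : Fin m) c) Q)) ≠ 0 := by
  classical
  set l0 : Fin m := ⟨0, hm⟩ with hl0
  set e := Q.totalDegree with he
  set q := p ^ e with hq
  have hqd : Q.totalDegree < q := Nat.lt_pow_self hp.one_lt
  set M : ℤ := m * n ^ 3 + 1 with hM
  have hM1 : (m : ℤ) * (n : ℤ) ^ 3 < M := by omega
  have hM2 : (n : ℤ) ^ 3 < M := by
    have : (1 : ℤ) * (n : ℤ) ^ 3 ≤ m * n ^ 3 :=
      mul_le_mul_of_nonneg_right (by exact_mod_cast hm) (by positivity)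
    omega
  let W : Fin n → ℤ := fun c => wd (wl M) (AD n l0 (n - 1 + c.val))
  obtain ⟨d0, hd0, hmax⟩ := Finset.exists_max_image Q.support (fun d => ∑ c, d c * W c)
    (MvPolynomial.support_nonempty.2 hQ)
  have hdeg : ∀ c, d0 c ≤ q - 1 := by
    intro c
    have h1 := le_totalDegree hd0
    have h2 : d0 c ≤ d0.sum fun _ e => e := by
      rw [Finsupp.sum_fintype _ _ (by simp)]
      exact Finset.single_le_sum (f := fun c => d0 c) (by simp) (Finset.mem_univ c)
    omega
  have hkκ : ∀ κ : Fin (n - 1), κ.val + 1 ≤ n := fun κ => by omega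
  let V : Fin (n - 1) → MvPolynomial (MV n m) K := fun κ => Vk K m (hkκ κ)
  let E : Fin m → Fin n → ℕ := fun l c => q - 1 - if l = l0 then d0 c else 0
  let hV := ∏ κ, V κ ^ (q - 1)
  let hS := ∏ l : Fin m, ∏ c : Fin n, sg K n l c ^ E l c
  have hSm : hS ∈ matrixInvariants K n m :=
    Subalgebra.prod_mem _ fun l _ => Subalgebra.prod_mem _ fun c _ => Subalgebra.pow_mem _ (sg_mem l c) _
  refine ⟨e, hV * hS, ?_, ?_, ?_⟩
  · exact (TW.prod _ _ fun κ _ => (Vk_TW _).pow _).mul (TW_of_mem hSm)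
  · intro i j hij
    have hne : i ≠ j := by rintro rfl; omega
    choose Wf hW0 hW using fun κ : Fin (n - 1) => Vk_Er (K := K) (m := m) (hkκ κ) hij
    let κ0 : Fin (n - 1) := ⟨i.val, by have := j.2; omega⟩
    refine ⟨fun k => Wf κ0 ^ k * V κ0 ^ (q - 1 - k) * ((q - 1).choose k : ℕ) *
      ((∏ κ ∈ Finset.univ.erase κ0, V κ ^ (q - 1)) * hS), fun t => ?_⟩
    rw [map_mul, Er_of_mem hSm hne, map_prod, ← Finset.mul_prod_erase _ _ (Finset.mem_univ κ0)]
    have e1 : ∏ κ ∈ Finset.univ.erase κ0, (Er i j t) (V κ ^ (q - 1)) =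
        ∏ κ ∈ Finset.univ.erase κ0, V κ ^ (q - 1) := by
      refine Finset.prod_congr rfl fun κ hκ => ?_
      rw [map_pow, hW, hW0 κ, mul_zero, add_zero]
      intro h
      exact (Finset.ne_of_mem_erase hκ) (Fin.ext (by simp only [κ0]; omega))
    rw [e1, map_pow, hW, add_comm, add_pow, mul_assoc, Finset.sum_mul]
    have e2 : q - 1 + 1 = q := Nat.sub_add_cancel (by omega)
    rw [e2]
    refine Finset.sum_congr rfl fun k _ => ?_
    rw [mul_pow, C_pow]
    ring
  · rw [coeff_Tr, map_ne_zero_iff _ (RingEquiv.injective _), smul_zero, zero_add, aeval_def, eval₂_eq',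
      Finset.mul_sum, coeff_sum]
    choose aV haV hVl using fun κ : Fin (n - 1) => Zm_lead (K := K) (hkκ κ) hM1 (Nat.succ_pos _) m le_rfl
    choose aS haS hSl using fun (l : Fin m) (c : Fin n) => sg_lead (K := K) hM2 l c.val c.2
    have hfil : Finset.univ.filter (fun l : Fin m => l.val < m) = Finset.univ := by ext l; simp
    simp only [hfil] at hVl
    have h1 := (IsLead.prod Finset.univ fun κ _ => (hVl κ).pow (q - 1)).mul
      (IsLead.prod Finset.univ fun l _ => IsLead.prod Finset.univ fun c _ => (hSl l c).pow (E l c))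
    have h2 : ∀ d : Fin n →₀ ℕ, _ := fun d =>
      h1.mul (IsLead.prod Finset.univ fun c _ => (hSl l0 c).pow (d c))
    set A := ∏ i, aV i ^ (q - 1) with hA
    set B := ∏ l, ∏ c, aS l c ^ E l c with hB
    set ν := ∑ i : Fin (n - 1), (q - 1) • ∑ l, AD n l (i.val + 1 - 1) + ∑ l, ∑ c : Fin n, E l c • AD n l (n - 1 + c.val) with hν
    have hAD : ∀ (d : Fin n →₀ ℕ) (l : Fin m) (a b : Fin n),
        (∑ c : Fin n, d c • AD n l0 (n - 1 + c.val)) (l, a, b) =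
          if h : l = l0 ∧ n - 1 ≤ a.val + b.val then d ⟨a.val + b.val - (n - 1), by omega⟩ else 0 := by
      intro d l a b
      rw [Finsupp.finsetSum_apply]
      simp only [Finsupp.smul_apply, AD_apply, smul_eq_mul]
      split_ifs with h
      · rw [Finset.sum_eq_single ⟨a.val + b.val - (n - 1), by omega⟩]
        · rw [if_pos, mul_one]
          exact ⟨h.1, by simp only []; omega⟩
        · intro c _ hc
          rw [if_neg, mul_zero]
          rintro ⟨_, h'⟩
          exact hc (Fin.ext (by simp only []; omega))
        · simp
      · refine Finset.sum_eq_zero fun c _ => ?_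
        rw [if_neg, mul_zero]
        rintro ⟨rfl, h'⟩; exact h ⟨rfl, by omega⟩
    have htop : ν + ∑ c : Fin n, d0 c • AD n l0 (n - 1 + c.val) = topm (MV n m) q := by
      ext ⟨l, a, b⟩
      rw [Finsupp.add_apply, hAD, hν, Finsupp.add_apply, topm_apply, Finsupp.finsetSum_apply,
        Finsupp.finsetSum_apply]
      simp only [Finsupp.smul_apply, Finsupp.finsetSum_apply, AD_apply, smul_eq_mul]
      by_cases hab : n - 1 ≤ a.val + b.val
      · rw [Finset.sum_eq_zero (fun κ _ => ?_), zero_add, Finset.sum_eq_single l,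
          Finset.sum_eq_single ⟨a.val + b.val - (n - 1), by omega⟩, if_pos ⟨rfl, by simp only []; omega⟩, mul_one]
        · have := hdeg ⟨a.val + b.val - (n - 1), by omega⟩
          by_cases hl : l = l0
          · rw [dif_pos ⟨hl, hab⟩]
            simp only [E, if_pos hl]
            omega
          · rw [dif_neg (fun h => hl h.1)]
            simp only [E, if_neg hl]
            omega
        · intro c _ hc
          rw [if_neg, mul_zero]
          rintro ⟨_, h'⟩
          exact hc (Fin.ext (by simp only []; omega))
        · simp
        · intro l' _ hl'
          refine Finset.sum_eq_zero fun c _ => ?_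
          rw [if_neg, mul_zero]
          rintro ⟨h, _⟩; exact hl' h.symm
        · simp
        · rw [Finset.sum_eq_zero, mul_zero]
          intro l' _
          rw [if_neg]
          rintro ⟨_, h'⟩
          have := κ.2
          omega
      · rw [dif_neg (fun h => hab h.2), add_zero, Finset.sum_eq_single ⟨a.val + b.val, by omega⟩,
          Finset.sum_eq_single l, if_pos ⟨rfl, by simp only []; omega⟩, mul_one, Finset.sum_eq_zero, add_zero]
        · intro l' _
          refine Finset.sum_eq_zero fun c _ => ?_
          rw [if_neg, mul_zero]
          rintro ⟨h, h'⟩; omega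
        · intro l' _ hl'
          rw [if_neg]
          rintro ⟨h, _⟩; exact hl' h.symm
        · simp
        · intro κ _ hκ
          rw [Finset.sum_eq_zero, mul_zero]
          intro l' _
          rw [if_neg]
          rintro ⟨_, h'⟩
          exact hκ (Fin.ext (by simp only []; omega))
        · simp
    have hwν : ∀ d : Fin n →₀ ℕ, wd (wl M) (ν + ∑ c : Fin n, d c • AD n l0 (n - 1 + c.val)) =
        wd (wl M) ν + ∑ c, d c * W c := by
      intro d
      rw [map_add, map_sum]
      simp only [map_nsmul, nsmul_eq_mul, W]
    have hre : ∀ d : Fin n →₀ ℕ, hV * hS * (algebraMap K (MvPolynomial (MV n m) K) (coeff d Q) *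
        ∏ c : Fin n, sg K n l0 c ^ d c) = C (coeff d Q) * (hV * hS * ∏ c : Fin n, sg K n l0 c ^ d c) := by
      intro d; rw [MvPolynomial.algebraMap_eq]; ring
    simp only [hre, coeff_C_mul]
    rw [Finset.sum_eq_single d0]
    · refine mul_ne_zero (mem_support_iff.1 hd0) ?_
      have := (h2 d0).1
      rw [htop] at this
      refine (this.trans_ne ?_)
      refine mul_ne_zero (mul_ne_zero ?_ ?_) ?_
      · exact Finset.prod_ne_zero_iff.2 fun κ _ => pow_ne_zero _ (haV κ)
      · exact Finset.prod_ne_zero_iff.2 fun l _ => Finset.prod_ne_zero_iff.2 fun c _ => pow_ne_zero _ (haS l c)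
      · exact Finset.prod_ne_zero_iff.2 fun c _ => pow_ne_zero _ (haS l0 c)
    · intro d hd hne
      convert mul_zero _
      by_contra h0
      have hne' : topm (MV n m) q ≠ ν + ∑ c : Fin n, d c • AD n l0 (n - 1 + c.val) := by
        rw [← htop]
        intro h
        have h := add_left_cancel h
        apply hne
        ext c
        have h3 := DFunLike.congr_fun h (l0, ⟨n - 1, by have := c.2; omega⟩, c)
        rw [hAD, hAD, dif_pos ⟨rfl, by simp⟩, dif_pos ⟨rfl, by simp⟩] at h3
        simpa using h3.symm
      have h4 := (h2 d).2 _ (mem_support_iff.2 h0) hne'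
      rw [← htop, hwν, hwν] at h4
      have := hmax d hd
      omega
    · intro h; exact absurd hd0 h
end V
end CMProof


namespace CMProof
section ff
variable {n m : ℕ} {ι : Type*} [Fintype ι] [DecidableEq ι]

def TT {R : Type*} [CommRing R] (π : Equiv.Perm ι) (M : ι → Matrix (Fin n) (Fin n) R) : R :=
  ∑ a : ι → Fin n, ∏ k, M k (a k) (a (π k))

lemma TT_map {R R' : Type*} [CommRing R] [CommRing R'] (φ : R →+* R') (π : Equiv.Perm ι)
    (M : ι → Matrix (Fin n) (Fin n) R) : φ (TT π M) = TT π fun k => (M k).map φ := by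
  simp [TT, map_sum, map_prod]

lemma TT_comm {R : Type*} [CommRing R] (π : Equiv.Perm ι) (M : ι → Matrix (Fin n) (Fin n) R)
    (g : Matrix (Fin n) (Fin n) R) : (TT π fun k => g * M k) = TT π fun k => M k * g := by
  simp only [TT, Matrix.mul_apply, Finset.prod_univ_sum, Fintype.piFinset_univ,
    Finset.prod_mul_distrib]
  rw [Finset.sum_comm]
  refine Finset.sum_congr rfl fun b _ => ?_
  refine Fintype.sum_equiv (Equiv.arrowCongr π.symm (Equiv.refl _)) _ _ fun a => ?_
  rw [mul_comm]
  congr 1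
  rw [← Equiv.prod_comp π]
  rfl

lemma TT_conj {R : Type*} [CommRing R] (π : Equiv.Perm ι) (M : ι → Matrix (Fin n) (Fin n) R)
    {g g' : Matrix (Fin n) (Fin n) R} (h : g * g' = 1) : (TT π fun k => g * M k * g') = TT π M := by
  have h' : g' * g = 1 := mul_eq_one_comm.1 h
  simp only [mul_assoc]
  rw [TT_comm π (fun k => M k * g') g]
  simp only [mul_assoc, h', mul_one]

noncomputable def EE {R : Type*} [CommRing R] (A : Matrix (Fin n) (Fin n) R) (x : Fin n → R) (i : Fin n) :
    Matrix (Fin n) (Fin n) R :=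
  Polynomial.aeval A (Polynomial.C (∏ j ∈ Finset.univ.erase i, ∏ k ∈ Finset.univ.erase j, (x j - x k)) *
    ∏ j ∈ Finset.univ.erase i, (Polynomial.X - Polynomial.C (x j)))

lemma EE_map {R R' : Type*} [CommRing R] [CommRing R'] (φ : R →+* R') (A : Matrix (Fin n) (Fin n) R)
    (x : Fin n → R) (i : Fin n) : (EE A x i).map φ = EE (A.map φ) (fun j => φ (x j)) i := by
  rw [EE, ← RingHom.mapMatrix_apply, Polynomial.map_aeval_eq_aeval_map (φ := φ)]
  · simp [EE, Polynomial.map_mul, Polynomial.map_prod, map_prod]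
  · ext r a b
    by_cases h : a = b <;> simp [algebraMap_matrix_apply, h]

lemma EE_conj {R : Type*} [CommRing R] (A : Matrix (Fin n) (Fin n) R)
    (x : Fin n → R) (i : Fin n) {g g' : Matrix (Fin n) (Fin n) R} (h : g * g' = 1) :
    EE (g * A * g') x i = g * EE A x i * g' := by
  have h' : g' * g = 1 := mul_eq_one_comm.1 h
  let u : (Matrix (Fin n) (Fin n) R)ˣ := ⟨g, g', h, h'⟩
  have : ∀ k, (g * A * g') ^ k = g * A ^ k * g' := fun k => Units.conj_pow u A k
  simp only [EE, Polynomial.aeval_eq_sum_range, this, Finset.mul_sum, Finset.sum_mul,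
    mul_smul_comm, smul_mul_assoc]

lemma prod_erase_perm {R : Type*} [CommMonoid R] (τ : Equiv.Perm (Fin n)) (i : Fin n) (f : Fin n → R) :
    ∏ j ∈ Finset.univ.erase i, f (τ j) = ∏ j ∈ Finset.univ.erase (τ i), f j :=
  Finset.prod_bij (fun j _ => τ j) (fun j hj => by simpa using hj) (fun _ _ _ _ h => τ.injective h)
    (fun j hj => ⟨τ.symm j, by simp at hj ⊢; rintro rfl; simp at hj, by simp⟩) fun _ _ => rfl

lemma EE_perm {R : Type*} [CommRing R] (A : Matrix (Fin n) (Fin n) R)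
    (x : Fin n → R) (i : Fin n) (τ : Equiv.Perm (Fin n)) : EE A (fun j => x (τ j)) i = EE A x (τ i) := by
  rw [EE, EE, prod_erase_perm τ i (fun j => Polynomial.X - Polynomial.C (x j))]
  rw [← prod_erase_perm τ i (fun j => ∏ k ∈ Finset.univ.erase j, (x j - x k))]
  congr 4
  funext j
  rw [prod_erase_perm τ j (fun k => x (τ j) - x k)]

def dsc {R : Type*} [CommRing R] (x : Fin n → R) : R := ∏ j, ∏ k ∈ Finset.univ.erase j, (x j - x k)

lemma EE_diag {R : Type*} [CommRing R] (x : Fin n → R) (i : Fin n) :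
    EE (diagonal x) x i = single i i (dsc x) := by
  have h1 : ∀ p : Polynomial R, Polynomial.aeval (diagonal x) p = diagonal fun a => p.eval (x a) := by
    intro p
    rw [Polynomial.aeval_eq_sum_range]
    ext a b
    by_cases h : a = b
    · subst h; simp [Matrix.sum_apply, diagonal_pow, Polynomial.eval_eq_sum_range]
    · simp [Matrix.sum_apply, diagonal_pow, h]
  rw [EE, h1]
  ext a b
  by_cases h : a = b
  · subst h
    rw [diagonal_apply_eq, Polynomial.eval_mul, Polynomial.eval_C, Polynomial.eval_prod]
    simp only [Polynomial.eval_sub, Polynomial.eval_X, Polynomial.eval_C]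
    by_cases ha : a = i
    · subst ha
      rw [single_apply_same, dsc, mul_comm, Finset.mul_prod_erase _
        (fun j => ∏ k ∈ Finset.univ.erase j, (x j - x k)) (Finset.mem_univ a)]
    · rw [single_apply, if_neg (by rintro ⟨h, _⟩; exact ha h.symm),
        Finset.prod_eq_zero (s := Finset.univ.erase i) (i := a) (f := fun j => x a - x j) (by simp [ha]) (sub_self _), mul_zero]
  · rw [diagonal_apply_ne _ h, single_apply, if_neg]
    rintro ⟨rfl, h'⟩; exact h h'

noncomputable def FF {R : Type*} [CommRing R] (Y : Fin m → Matrix (Fin n) (Fin n) R) (l0 : Fin m)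
    (x : Fin n → R) (π : Equiv.Perm ι) (l : ι → Fin m) (i : ι → Fin n) : R :=
  ∑ σ : Equiv.Perm (Fin n), TT π fun k => EE (Y l0) x (σ (i k)) * Y (l k)

variable (l0 : Fin m) (π : Equiv.Perm ι) (l : ι → Fin m) (i : ι → Fin n)
lemma FF_map {R R' : Type*} [CommRing R] [CommRing R'] (φ : R →+* R')
    (Y : Fin m → Matrix (Fin n) (Fin n) R) (x : Fin n → R) :
    φ (FF Y l0 x π l i) = FF (fun l => (Y l).map φ) l0 (fun j => φ (x j)) π l i := by
  simp only [FF, map_sum, TT_map, Matrix.map_mul, EE_map]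

lemma FF_conj {R : Type*} [CommRing R] (Y : Fin m → Matrix (Fin n) (Fin n) R) (x : Fin n → R)
    {g g' : Matrix (Fin n) (Fin n) R} (h : g * g' = 1) :
    FF (fun l => g * Y l * g') l0 x π l i = FF Y l0 x π l i := by
  have h' : g' * g = 1 := mul_eq_one_comm.1 h
  simp only [FF]
  refine Finset.sum_congr rfl fun σ _ => ?_
  rw [← TT_conj π (fun k => EE (Y l0) x (σ (i k)) * Y (l k)) h]
  congr 1
  funext k
  rw [EE_conj _ _ _ h]
  calc _ = g * EE (Y l0) x (σ (i k)) * (g' * g) * Y (l k) * g' := by simp only [mul_assoc]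
    _ = _ := by rw [h']; simp only [mul_assoc, mul_one, one_mul]

lemma FF_perm {R : Type*} [CommRing R] (Y : Fin m → Matrix (Fin n) (Fin n) R) (x : Fin n → R)
    (τ : Equiv.Perm (Fin n)) : FF Y l0 (fun j => x (τ j)) π l i = FF Y l0 x π l i := by
  simp only [FF, EE_perm]
  exact Equiv.sum_comp (Equiv.mulLeft τ) (fun σ : Equiv.Perm (Fin n) => TT π fun k => EE (Y l0) x (σ (i k)) * Y (l k))

lemma FF_diag {R : Type*} [CommRing R] (Y : Fin m → Matrix (Fin n) (Fin n) R) (x : Fin n → R)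
    (hY : Y l0 = diagonal x) : FF Y l0 x π l i =
      dsc x ^ Fintype.card ι * ∑ σ : Equiv.Perm (Fin n), ∏ k, Y (l k) (σ (i k)) (σ (i (π k))) := by
  rw [FF, hY, Finset.mul_sum]
  refine Finset.sum_congr rfl fun σ _ => ?_
  simp only [EE_diag, TT]
  rw [Finset.sum_eq_single fun k => σ (i k)]
  · rw [← Finset.card_univ, ← Finset.prod_const, ← Finset.prod_mul_distrib]
    refine Finset.prod_congr rfl fun k _ => ?_
    rw [single_mul_apply_same]
  · intro a _ ha
    obtain ⟨k, hk⟩ : ∃ k, a k ≠ σ (i k) := by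
      by_contra! h; exact ha (funext h)
    refine Finset.prod_eq_zero (Finset.mem_univ k) ?_
    rw [single_mul_apply_of_ne _ _ _ _ _ hk]
  · simp
end ff

lemma card_perm {ι κ : Type*} [Fintype ι] [DecidableEq κ] (f g : ι → κ)
    (h : ∀ a, Fintype.card {k // f k = a} = Fintype.card {k // g k = a}) :
    ∃ π : Equiv.Perm ι, ∀ k, g k = f (π k) := by
  let e := fun a => Fintype.equivOfCardEq (h a)
  refine ⟨((Equiv.sigmaFiberEquiv g).symm.trans (Equiv.sigmaCongrRight fun a => (e a).symm)).trans
    (Equiv.sigmaFiberEquiv f), fun k => ?_⟩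
  exact ((e (g k)).symm ⟨k, rfl⟩).2.symm

lemma wt0_perm {n m : ℕ} {α : MV n m →₀ ℕ} (h : wt0 α) :
    ∃ π : Equiv.Perm (Σ v : MV n m, Fin (α v)), ∀ k, k.1.2.2 = (π k).1.2.1 := by
  have key : ∀ (F : MV n m → Fin n) (a : Fin n),
      Fintype.card {k : Σ v : MV n m, Fin (α v) // F k.1 = a} = ∑ v, if F v = a then α v else 0 := by
    intro F a
    rw [Fintype.card_subtype, Finset.card_filter, Fintype.sum_sigma]
    refine Finset.sum_congr rfl fun v _ => ?_
    change (∑ _y : Fin (α v), if F v = a then 1 else 0) = _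
    rw [Finset.sum_const]
    split_ifs <;> simp
  refine card_perm (fun k : (Σ v : MV n m, Fin (α v)) => k.1.2.1)
    (fun k : (Σ v : MV n m, Fin (α v)) => k.1.2.2) fun a => ?_
  rw [key (fun v => v.2.1), key (fun v => v.2.2)]
  exact h a

lemma monomial_sigma {n m : ℕ} {K : Type} [Field K] (α : MV n m →₀ ℕ) :
    (monomial α 1 : MvPolynomial (MV n m) K) = ∏ k : (Σ v : MV n m, Fin (α v)), X k.1 := by
  rw [Fintype.prod_sigma, MvPolynomial.monomial_eq, C_1, one_mul, Finsupp.prod_fintype _ _ (by simp)]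
  simp
end CMProof


namespace CMProof
section es
variable {n m : ℕ} {K : Type} [Field K]

lemma sg_eval {E : Type*} [CommRing E] [Algebra K E] (Y : Fin m → Matrix (Fin n) (Fin n) E) (l : Fin m) (c : ℕ) :
    aeval (ev Y) (sg K n l c) = (Y l).charpoly.coeff c := by
  have : (Xg n m K l).map (aeval (ev Y) : _ →ₐ[K] E) = Y l := by ext a b; simp [Xg, ev]
  rw [← this]
  have h2 := charpoly_map (Xg n m K l) (aeval (ev Y) : MvPolynomial (MV n m) K →ₐ[K] E).toRingHom
  have h3 := congrArg (fun p => p.coeff c) h2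
  simp only [Polynomial.coeff_map] at h3
  exact h3.symm

noncomputable def es (K : Type) [Field K] (n : ℕ) {m : ℕ} (l0 : Fin m) (i : Fin n) : MvPolynomial (MV n m) K :=
  (-1) ^ (i.val + 1) * sg K n l0 (n - 1 - i)

lemma es_mem (l0 : Fin m) (i : Fin n) : es K n l0 i ∈ matrixInvariants K n m :=
  mul_mem (pow_mem (neg_mem (one_mem _)) _) (sg_mem _ _)

lemma es_eval {E : Type*} [CommRing E] [Algebra K E] (Y : Fin m → Matrix (Fin n) (Fin n) E) (l0 : Fin m)
    (α : Fin n → E) (h : (Y l0).charpoly = ∏ i, (Polynomial.X - Polynomial.C (α i))) (i : Fin n) :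
    aeval (ev Y) (es K n l0 i) = aeval α (esymm (Fin n) K (i + 1)) := by
  rw [es, map_mul, sg_eval, h, aeval_esymm_eq_multiset_esymm]
  have h1 := Multiset.prod_X_sub_C_coeff (Finset.univ.val.map α) (k := n - 1 - i) (by simp; omega)
  rw [Multiset.map_map] at h1
  have h2 : Multiset.card (Finset.univ.val.map α) - (n - 1 - i) = i + 1 := by simp; omega
  rw [h2] at h1
  have h3 : ∏ i, (Polynomial.X - Polynomial.C (α i)) = (Finset.univ.val.map ((fun t => Polynomial.X - Polynomial.C t) ∘ α)).prod := rfl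
  rw [h3, h1, map_pow, map_neg, map_one, ← mul_assoc, ← mul_pow]
  simp

lemma aes_eval {E : Type*} [CommRing E] [Algebra K E] (Y : Fin m → Matrix (Fin n) (Fin n) E) (l0 : Fin m)
    (α : Fin n → E) (h : (Y l0).charpoly = ∏ i, (Polynomial.X - Polynomial.C (α i))) (Q : MvPolynomial (Fin n) K) :
    aeval (ev Y) (aeval (es K n l0) Q) = aeval α (aeval (fun i : Fin n => esymm (Fin n) K (i + 1)) Q) := by
  rw [← AlgHom.comp_apply, ← AlgHom.comp_apply, comp_aeval, comp_aeval]
  congr 2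
  funext i
  exact es_eval Y l0 α h i

lemma exists_symm {R : Type*} [CommRing R] (F : MvPolynomial (Fin n) R) (hF : F.IsSymmetric) :
    ∃ G : MvPolynomial (Fin n) R, aeval (fun i : Fin n => esymm (Fin n) R (i + 1)) G = F := by
  obtain ⟨G, hG⟩ := (esymmAlgHom_fin_bijective R n).2 ⟨F, hF⟩
  exact ⟨G, by rw [← esymmAlgHom_apply, hG]⟩

lemma symm_inj {R : Type*} [CommRing R] {G G' : MvPolynomial (Fin n) R}
    (h : aeval (fun i : Fin n => esymm (Fin n) R (i + 1)) G = aeval (fun i : Fin n => esymm (Fin n) R (i + 1)) G') :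
    G = G' := by
  apply (esymmAlgHom_fin_bijective R n).1
  apply Subtype.ext
  rw [esymmAlgHom_apply, esymmAlgHom_apply, h]

lemma dsc_map {R R' : Type*} [CommRing R] [CommRing R'] (φ : R →+* R') (x : Fin n → R) :
    φ (dsc x) = dsc fun i => φ (x i) := by simp [dsc, map_prod]

lemma dsc_perm {R : Type*} [CommRing R] (x : Fin n → R) (τ : Equiv.Perm (Fin n)) :
    dsc (fun j => x (τ j)) = dsc x := by
  rw [dsc, dsc, ← Equiv.prod_comp τ (fun j => ∏ k ∈ Finset.univ.erase j, (x j - x k))]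
  refine Finset.prod_congr rfl fun j _ => ?_
  rw [prod_erase_perm τ j (fun k => x (τ j) - x k)]

lemma dsc_symm (R : Type*) [CommRing R] : (dsc (X : Fin n → MvPolynomial (Fin n) R)).IsSymmetric := by
  intro τ
  have := dsc_map (rename τ : MvPolynomial (Fin n) R →ₐ[R] _).toRingHom (X : Fin n → MvPolynomial (Fin n) R)
  simp only [AlgHom.toRingHom_eq_coe, RingHom.coe_coe, rename_X] at this
  rw [this]
  exact dsc_perm X τ

noncomputable def DD (K : Type) [Field K] (n : ℕ) : MvPolynomial (Fin n) K :=
  (exists_symm _ (dsc_symm (n := n) K)).choose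

lemma DD_spec : aeval (fun i : Fin n => esymm (Fin n) K (i + 1)) (DD K n) = dsc X :=
  (exists_symm _ (dsc_symm (n := n) K)).choose_spec

noncomputable def dl (K : Type) [Field K] (n : ℕ) {m : ℕ} (l0 : Fin m) : MvPolynomial (MV n m) K :=
  aeval (es K n l0) (DD K n)

lemma aes_mem (l0 : Fin m) (Q : MvPolynomial (Fin n) K) : aeval (es K n l0) Q ∈ matrixInvariants K n m := by
  induction Q using MvPolynomial.induction_on with
  | C a => rw [aeval_C]; exact Subalgebra.algebraMap_mem _ _
  | add p q hp hq => rw [map_add]; exact add_mem hp hq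
  | mul_X p i hp => rw [map_mul, aeval_X]; exact mul_mem hp (es_mem _ _)

lemma dl_mem (l0 : Fin m) : dl K n l0 ∈ matrixInvariants K n m := aes_mem _ _

lemma dl_eval {E : Type*} [CommRing E] [Algebra K E] (Y : Fin m → Matrix (Fin n) (Fin n) E) (l0 : Fin m)
    (α : Fin n → E) (h : (Y l0).charpoly = ∏ i, (Polynomial.X - Polynomial.C (α i))) :
    aeval (ev Y) (dl K n l0) = dsc α := by
  rw [dl, aes_eval Y l0 α h, DD_spec]
  have := dsc_map (aeval α : MvPolynomial (Fin n) K →ₐ[K] E).toRingHom X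
  simp only [AlgHom.toRingHom_eq_coe, RingHom.coe_coe, aeval_X] at this
  exact this

noncomputable def tt (K : Type) [Field K] (n : ℕ) {m : ℕ} (l0 : Fin m) (i : Fin n) : MvPolynomial (MV n m) K := X (l0, i, i)

noncomputable def Xr (K : Type) [Field K] (n : ℕ) {m : ℕ} (l0 : Fin m) (l : Fin m) :
    Matrix (Fin n) (Fin n) (MvPolynomial (MV n m) K) := if l = l0 then diagonal (tt K n l0) else Xg n m K l

noncomputable def rho (K : Type) [Field K] (n : ℕ) {m : ℕ} (l0 : Fin m) : MvPolynomial (MV n m) K →ₐ[K] MvPolynomial (MV n m) K :=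
  aeval (ev (Xr K n l0))

lemma charpoly_diag {R : Type*} [CommRing R] (x : Fin n → R) :
    (diagonal x).charpoly = ∏ i, (Polynomial.X - Polynomial.C (x i)) := Matrix.charpoly_diagonal x

lemma rho_aes (l0 : Fin m) (Q : MvPolynomial (Fin n) K) : rho K n l0 (aeval (es K n l0) Q) =
    aeval (tt K n l0) (aeval (fun i : Fin n => esymm (Fin n) K (i + 1)) Q) :=
  aes_eval _ l0 _ (by rw [Xr, if_pos rfl, charpoly_diag]) _

lemma rho_dl (l0 : Fin m) : rho K n l0 (dl K n l0) = dsc (tt K n l0) :=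
  dl_eval _ l0 _ (by rw [Xr, if_pos rfl, charpoly_diag])

lemma dsc_ne {R : Type*} [CommRing R] [IsDomain R] (x : Fin n → R) : dsc x ≠ 0 ↔ Function.Injective x := by
  rw [dsc, Finset.prod_ne_zero_iff]
  simp only [Finset.prod_ne_zero_iff, Finset.mem_univ, Finset.mem_erase, sub_ne_zero, and_true, true_imp_iff]
  constructor
  · intro h a b hab
    by_contra hne
    exact h a b (Ne.symm hne) hab
  · intro h a b hab h'
    exact hab (h h').symm

lemma tt_inj (l0 : Fin m) : Function.Injective (tt K n l0) := fun a b h => by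
  have := X_injective h
  simpa using this

lemma dl_ne (l0 : Fin m) : dl K n l0 ≠ 0 := fun h =>
  (dsc_ne _).2 (tt_inj (K := K) (n := n) l0) (by rw [← rho_dl, h, map_zero])

lemma exists_tuple {α : Type*} (s : Multiset α) (h : Multiset.card s = n) : ∃ a : Fin n → α, Finset.univ.val.map a = s := by
  subst h
  induction s using Quotient.inductionOn with
  | h l => exact ⟨fun i => l.get i, by rw [Fin.univ_val_map]; simp⟩

lemma diagonalize [IsAlgClosed K] (A : Matrix (Fin n) (Fin n) K) : ∃ α : Fin n → K,
    A.charpoly = ∏ i, (Polynomial.X - Polynomial.C (α i)) ∧ (Function.Injective α →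
      ∃ g g' : Matrix (Fin n) (Fin n) K, g * g' = 1 ∧ A = g * diagonal α * g') := by
  have hs := IsAlgClosed.splits A.charpoly
  obtain ⟨α, hα⟩ := exists_tuple (n := n) A.charpoly.roots (by
    rw [← hs.natDegree_eq_card_roots, charpoly_natDegree_eq_dim]; simp)
  have h1 : A.charpoly = ∏ i, (Polynomial.X - Polynomial.C (α i)) := by
    have := hs.eq_prod_roots_of_monic A.charpoly_monic
    rw [← hα, Multiset.map_map] at this
    exact this
  refine ⟨α, h1, fun hinj => ?_⟩
  have h2 : ∀ i, ∃ v, v ≠ 0 ∧ A *ᵥ v = α i • v := by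
    intro i
    have h3 : A.charpoly.eval (α i) = 0 := by
      rw [h1, Polynomial.eval_prod]
      exact Finset.prod_eq_zero (Finset.mem_univ i) (by simp)
    rw [Matrix.eval_charpoly] at h3
    obtain ⟨v, hv, hv'⟩ := Matrix.exists_mulVec_eq_zero_iff.2 h3
    refine ⟨v, hv, ?_⟩
    rw [Matrix.sub_mulVec, sub_eq_zero] at hv'
    rw [← hv']
    simp [Matrix.scalar_apply]
  choose v hv hv' using h2
  have hli : LinearIndependent K v := by
    apply Module.End.eigenvectors_linearIndependent' (Matrix.toLin' A) α hinj v
    intro i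
    refine ⟨?_, hv i⟩
    rw [Module.End.mem_eigenspace_iff]
    simpa using hv' i
  let g : Matrix (Fin n) (Fin n) K := Matrix.of fun a b => v b a
  have hg : IsUnit g := by
    rw [← Matrix.linearIndependent_cols_iff_isUnit]
    exact hli
  obtain ⟨u, hu⟩ := hg
  refine ⟨g, u⁻¹.val, by rw [← hu]; simp, ?_⟩
  have : A * g = g * diagonal α := by
    ext a b
    rw [mul_diagonal]
    have := congrFun (hv' b) a
    simp only [Pi.smul_apply, smul_eq_mul] at this
    simp only [g, of_apply, mul_comm _ (α b)]
    rw [← this]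
    rfl
  rw [← this, ← hu]
  simp [mul_assoc]

lemma aeval_rho {E : Type*} [CommRing E] [Algebra K E] (Y : Fin m → Matrix (Fin n) (Fin n) E) (l0 : Fin m)
    (x : Fin n → E) (h : Y l0 = diagonal x) (f : MvPolynomial (MV n m) K) :
    aeval (ev Y) (rho K n l0 f) = aeval (ev Y) f := by
  rw [rho, ← AlgHom.comp_apply, comp_aeval]
  congr 2
  funext v
  obtain ⟨l, a, b⟩ := v
  by_cases hl : l = l0
  · subst hl
    by_cases hab : a = b
    · subst hab; simp [ev, Xr, tt]
    · simp [ev, Xr, hab, h]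
  · simp [ev, Xr, hl, Xg]

theorem rho_inj [IsAlgClosed K] (l0 : Fin m) {f : MvPolynomial (MV n m) K} (hf : f ∈ matrixInvariants K n m)
    (h : rho K n l0 f = 0) : f = 0 := by
  have hinf : Infinite K := IsAlgClosed.instInfinite
  have : f * dl K n l0 = 0 := by
    apply MvPolynomial.funext
    intro x
    rw [map_mul, map_zero]
    let Y : Fin m → Matrix (Fin n) (Fin n) K := fun l => Matrix.of fun a b => x (l, a, b)
    have hx : ∀ f : MvPolynomial (MV n m) K, eval x f = aeval (ev Y) f := fun f => by
      rw [MvPolynomial.aeval_eq_eval]; rfl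
    rw [hx, hx]
    obtain ⟨α, h1, h2⟩ := diagonalize (Y l0)
    rw [dl_eval Y l0 α h1]
    by_cases hd : dsc α = 0
    · rw [hd, mul_zero]
    · obtain ⟨g, g', hg, hY⟩ := h2 ((dsc_ne α).1 hd)
      have hg' : g' * g = 1 := mul_eq_one_comm.1 hg
      have h4 := inv_of_Lam (mem_S_iff_Lam.1 hf) hg' Y
      rw [← h4, ← aeval_rho _ l0 α _ f, h, map_zero, zero_mul]
      rw [hY]
      calc _ = (g' * g) * diagonal α * (g' * g) := by simp only [mul_assoc]
        _ = _ := by simp [hg']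
  rcases mul_eq_zero.1 this with h | h
  · exact h
  · exact absurd h (dl_ne l0)
end es
end CMProof


namespace CMProof
section claim
variable {n m : ℕ} {K : Type} [Field K]

noncomputable def act (K : Type) [Field K] {n : ℕ} (m : ℕ) (σ : Equiv.Perm (Fin n)) : MvPolynomial (MV n m) K →ₐ[K] MvPolynomial (MV n m) K :=
  rename fun v => (v.1, σ v.2.1, σ v.2.2)

noncomputable def psi (f : MvPolynomial (MV n m) K) : MvPolynomial (MV n m) K := ∑ σ : Equiv.Perm (Fin n), act K m σ f

lemma psi_add (f g : MvPolynomial (MV n m) K) : psi (f + g) = psi f + psi g := by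
  simp [psi, Finset.sum_add_distrib]

lemma psi_C_mul (a : K) (f : MvPolynomial (MV n m) K) : psi (C a * f) = C a * psi f := by
  rw [psi, psi, Finset.mul_sum]
  refine Finset.sum_congr rfl fun σ _ => ?_
  rw [map_mul]; simp [act]

lemma mem_S_of_gen {f : MvPolynomial (MV n m) K}
    (h : ∀ g g' : Matrix (Fin n) (Fin n) K, g * g' = 1 →
      aeval (ev fun l => g.map C * Xg n m K l * g'.map C) f = f) : f ∈ matrixInvariants K n m := by
  rw [mem_S_iff]
  intro A Y
  have h1 := congrArg (aeval (ev Y)) (h A.val (A⁻¹).val (Units.mul_inv A))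
  rw [← h1, ← AlgHom.comp_apply, comp_aeval]
  congr 2
  funext v
  simp [ev, Matrix.mul_apply, map_sum, Xg]

lemma claim [Infinite K] (l0 : Fin m) (α : MV n m →₀ ℕ) (hα : wt0 α) (hoff : ∀ a b, a ≠ b → α (l0, a, b) = 0) :
    ∃ s ∈ matrixInvariants K n m, ∃ N, rho K n l0 s = dsc (tt K n l0) ^ N * psi (monomial α 1) := by
  classical
  obtain ⟨π, hπ⟩ := wt0_perm hα
  let ι := Σ v : MV n m, Fin (α v)
  let ll : ι → Fin m := fun k => k.1.1
  let ii : ι → Fin n := fun k => k.1.2.1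
  let F : MvPolynomial (Fin n) (MvPolynomial (MV n m) K) :=
    FF (fun l => (Xg n m K l).map C) l0 X π ll ii
  have hF : F.IsSymmetric := by
    intro τ
    have := FF_map l0 π ll ii (rename τ : MvPolynomial (Fin n) (MvPolynomial (MV n m) K) →ₐ[_] _).toRingHom
      (fun l => (Xg n m K l).map C) X
    have e1 : (fun l => ((Xg n m K l).map C).map
      ((rename τ : MvPolynomial (Fin n) (MvPolynomial (MV n m) K) →ₐ[MvPolynomial (MV n m) K] _).toRingHom)) = fun l => (Xg n m K l).map C := by
      funext l; ext a b : 2; simp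
    have e2 : (fun j => (rename τ : MvPolynomial (Fin n) (MvPolynomial (MV n m) K) →ₐ[MvPolynomial (MV n m) K] _).toRingHom (X j)) =
      fun j => X (τ j) := by funext j; simp
    rw [e1, e2, FF_perm] at this
    exact this
  obtain ⟨G, hG⟩ := exists_symm F hF
  let s : MvPolynomial (MV n m) K := aeval (es K n l0) G
  have hes : ∀ (φ : MvPolynomial (MV n m) K →+* MvPolynomial (MV n m) K), φ s = eval₂ φ (fun i => φ (es K n l0 i)) G := by
    intro φ
    change φ (aeval (es K n l0) G) = _
    rw [MvPolynomial.aeval_def, MvPolynomial.hom_eval₂]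
    rfl
  refine ⟨s, mem_S_of_gen fun g g' hg => ?_, Fintype.card ι, ?_⟩
  · set γ : MvPolynomial (MV n m) K →ₐ[K] MvPolynomial (MV n m) K := aeval (ev fun l => g.map C * Xg n m K l * g'.map C)
    have hCC : g.map C * g'.map C = (1 : Matrix (Fin n) (Fin n) (MvPolynomial (MV n m) K)) := by
      rw [← Matrix.map_mul, hg, Matrix.map_one _ (map_zero _) (map_one _)]
    have hγ : ∀ i, γ (es K n l0 i) = es K n l0 i := fun i =>
      have h1 := inv_of_Lam (mem_S_iff_Lam.1 (es_mem (K := K) l0 i)) hCC (Xg n m K)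
      h1.trans (by
        have : (ev (Xg n m K)) = (X : MV n m → MvPolynomial (MV n m) K) := by funext v; rfl
        rw [this, aeval_X_left_apply])
    have hmF : map γ.toRingHom F = F := by
      have := FF_map l0 π ll ii (map γ.toRingHom) (fun l => (Xg n m K l).map C) X
      have e1 : (fun l => ((Xg n m K l).map C).map (map γ.toRingHom)) =
          fun l => (g.map C).map C * (Xg n m K l).map C * ((g'.map C).map C : Matrix (Fin n) (Fin n) (MvPolynomial (Fin n) (MvPolynomial (MV n m) K))) := by
        funext l
        rw [← Matrix.map_mul, ← Matrix.map_mul]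
        ext a b : 1
        simp only [Matrix.map_apply, map_C, Xg, of_apply]
        congr 1
        change γ (X (l, a, b)) = _
        simp only [γ, aeval_X, ev]
        rfl
      rw [e1, FF_conj (g := (g.map C).map C) (g' := (g'.map C).map C) l0 π ll ii _ _ (by rw [← Matrix.map_mul, hCC, Matrix.map_one _ (map_zero _) (map_one _)])] at this
      simp only [map_X] at this
      exact this
    have hmG : map γ.toRingHom G = G := by
      apply symm_inj
      rw [hG, ← hmF, ← hG]
      rw [MvPolynomial.map_aeval, MvPolynomial.aeval_def, MvPolynomial.eval₂_map, MvPolynomial.coe_eval₂Hom]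
      have e1 : (algebraMap (MvPolynomial (MV n m) K) (MvPolynomial (Fin n) (MvPolynomial (MV n m) K))).comp γ.toRingHom =
          (MvPolynomial.map γ.toRingHom).comp (algebraMap (MvPolynomial (MV n m) K) (MvPolynomial (Fin n) (MvPolynomial (MV n m) K))) :=
        RingHom.ext fun r => by simp [MvPolynomial.algebraMap_eq]
      rw [e1]
      congr 1
      funext i
      rw [MvPolynomial.map_esymm]
    have h1 := hes γ.toRingHom
    have h2 : (fun i => γ.toRingHom (es K n l0 i)) = es K n l0 := funext hγ
    rw [h2] at h1
    change γ.toRingHom s = s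
    rw [h1]
    have h3 : s = eval₂ (RingHom.id _) (es K n l0) G := rfl
    rw [h3]
    conv_rhs => rw [← hmG, eval₂_map]
    rfl
  · have h1 := hes (rho K n l0).toRingHom
    change (rho K n l0).toRingHom s = _
    rw [h1]
    have h2 : eval₂ (rho K n l0).toRingHom (tt K n l0) F = eval₂ (rho K n l0).toRingHom (fun i => (rho K n l0).toRingHom (es K n l0 i)) G := by
      rw [← hG, ← MvPolynomial.coe_eval₂Hom, MvPolynomial.map_aeval, MvPolynomial.coe_eval₂Hom]
      congr 1
      · exact RingHom.ext fun r => by simp [MvPolynomial.algebraMap_eq]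
      · funext i
        have : (rho K n l0).toRingHom (es K n l0 i) = aeval (tt K n l0) (esymm (Fin n) K (i + 1)) :=
          es_eval _ l0 _ (by rw [Xr, if_pos rfl, charpoly_diag]) i
        rw [this]
        simp [esymm, map_sum, map_prod]
    rw [← h2]
    have h3 := FF_map l0 π ll ii (eval₂Hom (rho K n l0).toRingHom (tt K n l0)) (fun l => (Xg n m K l).map C) X
    have h4 : (fun l => ((Xg n m K l).map C).map (eval₂Hom (rho K n l0).toRingHom (tt K n l0))) = Xr K n l0 := by
      funext l
      ext a b : 2
      simp [Xg, rho, ev]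
    rw [h4] at h3
    simp only [eval₂Hom_X'] at h3
    rw [FF_diag l0 π ll ii (Xr K n l0) (tt K n l0) (by rw [Xr, if_pos rfl])] at h3
    refine Eq.trans h3 ?_
    congr 1
    rw [psi, monomial_sigma]
    refine Finset.sum_congr rfl fun σ _ => ?_
    rw [map_prod]
    refine Finset.prod_congr rfl fun k _ => ?_
    simp only [ll, ii, act, rename_X]
    rw [← hπ]
    obtain ⟨⟨l, a, b⟩, k⟩ := k
    by_cases hl : l = l0
    · subst hl
      by_cases hab : a = b
      · subst hab; simp [Xr, tt]
      · have := hoff a b hab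
        rw [this] at k
        exact k.elim0
    · simp [Xr, hl, Xg]

def PP (l0 : Fin m) (f : MvPolynomial (MV n m) K) : Prop :=
  ∃ N0, ∀ N, N0 ≤ N → ∃ s ∈ matrixInvariants K n m, rho K n l0 s = dsc (tt K n l0) ^ N * psi f

lemma PP.add {l0 : Fin m} {f g : MvPolynomial (MV n m) K} (hf : PP l0 f) (hg : PP l0 g) : PP l0 (f + g) := by
  obtain ⟨N, h⟩ := hf
  obtain ⟨N', h'⟩ := hg
  refine ⟨max N N', fun M hM => ?_⟩
  obtain ⟨s, hs, e⟩ := h M (le_of_max_le_left hM)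
  obtain ⟨s', hs', e'⟩ := h' M (le_of_max_le_right hM)
  exact ⟨s + s', add_mem hs hs', by rw [map_add, e, e', psi_add, mul_add]⟩

lemma rho_monomial (l0 : Fin m) (α : MV n m →₀ ℕ) (c : K) : 
    ((∀ a b, a ≠ b → α (l0, a, b) = 0) → rho K n l0 (monomial α c) = monomial α c) ∧
    (¬ (∀ a b, a ≠ b → α (l0, a, b) = 0) → rho K n l0 (monomial α c) = 0) := by
  rw [rho, aeval_monomial, Finsupp.prod_fintype _ _ (by simp)]
  constructor
  · intro h
    rw [MvPolynomial.monomial_eq, Finsupp.prod_fintype _ _ (by simp)]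
    congr 1
    refine Finset.prod_congr rfl fun v _ => ?_
    obtain ⟨l, a, b⟩ := v
    by_cases hl : l = l0
    · subst hl
      by_cases hab : a = b
      · subst hab; simp [Xr, tt, ev]
      · rw [h a b hab, pow_zero, pow_zero]
    · simp [Xr, hl, Xg, ev]
  · intro h
    push Not at h
    obtain ⟨a, b, hab, h⟩ := h
    rw [Finset.prod_eq_zero (Finset.mem_univ (l0, a, b)), mul_zero]
    simp [ev, Xr, hab, h]

lemma coeff_rho (l0 : Fin m) (f : MvPolynomial (MV n m) K) (β : MV n m →₀ ℕ) :
    ((∀ a b, a ≠ b → β (l0, a, b) = 0) → coeff β (rho K n l0 f) = coeff β f) ∧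
    (¬ (∀ a b, a ≠ b → β (l0, a, b) = 0) → coeff β (rho K n l0 f) = 0) := by
  classical
  induction f using MvPolynomial.induction_on' with
  | monomial α c =>
    by_cases h : ∀ a b, a ≠ b → α (l0, a, b) = 0
    · rw [(rho_monomial l0 α c).1 h]
      refine ⟨fun _ => rfl, fun h' => ?_⟩
      rw [coeff_monomial, if_neg (by rintro rfl; exact h' h)]
    · rw [(rho_monomial l0 α c).2 h]
      refine ⟨fun h' => ?_, fun _ => coeff_zero _⟩
      rw [coeff_monomial, if_neg (by rintro rfl; exact h h'), coeff_zero]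
  | add f g hf hg =>
    simp only [map_add, coeff_add]
    exact ⟨fun h => by rw [hf.1 h, hg.1 h], fun h => by rw [hf.2 h, hg.2 h, add_zero]⟩

lemma PP_of [Infinite K] (l0 : Fin m) {f : MvPolynomial (MV n m) K} (hf : TW f) (hr : rho K n l0 f = f) : PP l0 f := by
  rw [f.as_sum]
  refine Finset.sum_induction _ (PP l0) (fun _ _ => PP.add) ⟨0, fun N _ => ⟨0, zero_mem _, by simp [psi]⟩⟩ ?_
  intro α hα
  obtain ⟨s, hs, N0, h⟩ := claim (K := K) l0 α (hf α hα) (by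
    by_contra h
    rw [mem_support_iff, ← hr, (coeff_rho l0 f α).2 h] at hα
    exact hα rfl)
  refine ⟨N0, fun N hN => ⟨C (coeff α f) * dl K n l0 ^ (N - N0) * s, ?_, ?_⟩⟩
  · exact mul_mem (mul_mem (Subalgebra.algebraMap_mem _ (coeff α f)) (pow_mem (dl_mem l0) _)) hs
  · rw [map_mul, map_mul, map_pow, rho_dl, h]
    have e1 : monomial α (coeff α f) = C (coeff α f) * monomial α 1 := by rw [C_mul_monomial, mul_one]
    rw [e1, psi_C_mul]
    have : rho K n l0 (C (coeff α f)) = C (coeff α f) := by rw [rho, aeval_C]; rfl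
    rw [this, mul_assoc, ← mul_assoc (dsc _ ^ _), ← pow_add, Nat.sub_add_cancel hN]
    ring

lemma act_rho [Infinite K] (l0 : Fin m) {s : MvPolynomial (MV n m) K} (hs : s ∈ matrixInvariants K n m)
    (σ : Equiv.Perm (Fin n)) : act K m σ (rho K n l0 s) = rho K n l0 s := by
  let P : Matrix (Fin n) (Fin n) (MvPolynomial (MV n m) K) := (1 : Matrix (Fin n) (Fin n) _).submatrix σ id
  let P' : Matrix (Fin n) (Fin n) (MvPolynomial (MV n m) K) := (1 : Matrix (Fin n) (Fin n) _).submatrix id σ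
  have hP : P * P' = 1 := by
    ext a b
    simp [P, P', Matrix.mul_apply, Matrix.one_apply]
  have := inv_of_Lam (mem_S_iff_Lam.1 hs) hP (Xr K n l0)
  rw [rho, ← AlgHom.comp_apply, comp_aeval, ← this]
  congr 2
  funext v
  obtain ⟨l, a, b⟩ := v
  have h1 : (P * Xr K n l0 l * P') a b = Xr K n l0 l (σ a) (σ b) := by
    simp [P, P', Matrix.mul_apply, Matrix.one_apply]
  simp only [ev]
  rw [h1]
  by_cases hl : l = l0
  · subst hl
    by_cases hab : a = b
    · subst hab; simp [Xr, tt, act]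
    · simp [Xr, hab]
  · simp [Xr, hl, Xg, act]

lemma psi_rho_mul [Infinite K] (l0 : Fin m) {s : MvPolynomial (MV n m) K} (hs : s ∈ matrixInvariants K n m)
    (f : MvPolynomial (MV n m) K) : psi (rho K n l0 s * f) = rho K n l0 s * psi f := by
  simp [psi, act_rho l0 hs, Finset.mul_sum]
end claim
end CMProof


namespace CMProof
section CP
variable {n m : ℕ} {K : Type} [Field K]

lemma hc_mul {σ : Type*} {R : Type*} [CommRing R] {z : MvPolynomial σ R} {D : ℕ} (hz : z.IsHomogeneous D) (s : MvPolynomial σ R) (N : ℕ) :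
    homogeneousComponent N (z * s) = if D ≤ N then z * homogeneousComponent (N - D) s else 0 := by
  classical
  conv_lhs => rw [← sum_homogeneousComponent s, Finset.mul_sum, map_sum]
  have h : ∀ i, homogeneousComponent N (z * homogeneousComponent i s) = if D + i = N then z * homogeneousComponent i s else 0 := by
    intro i
    rw [homogeneousComponent_of_mem (hz.mul (homogeneousComponent_isHomogeneous i s))]
    split_ifs <;> simp_all
  simp only [h]
  split_ifs with hN
  · rw [Finset.sum_eq_single (N - D)]
    · rw [if_pos (by omega)]
    · intro b _ hb; rw [if_neg (by omega)]
    · intro hb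
      rw [if_pos (by omega), homogeneousComponent_eq_zero, mul_zero]
      simp at hb; omega
  · exact Finset.sum_eq_zero fun i _ => if_neg (by omega)

noncomputable def BB (K : Type) [Field K] (n : ℕ) : MvPolynomial (Fin n) K := ∑ σ : Equiv.Perm (Fin n), ∏ i, X (σ i) ^ i.val

lemma BB_symm : (BB K n).IsSymmetric := by
  intro τ
  simp only [BB, map_sum, map_prod, map_pow, rename_X]
  exact Equiv.sum_comp (Equiv.mulLeft τ) (fun σ : Equiv.Perm (Fin n) => ∏ i, (X (σ i) : MvPolynomial (Fin n) K) ^ i.val)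

lemma BB_ne : BB K n ≠ 0 := by
  classical
  intro h
  have h1 : ∀ σ : Equiv.Perm (Fin n), (∏ i, (X (σ i) : MvPolynomial (Fin n) K) ^ i.val) =
      monomial (Finsupp.equivFunOnFinite.symm fun j => (σ.symm j).val) 1 := by
    intro σ
    rw [MvPolynomial.monomial_eq, C_1, one_mul, Finsupp.prod_fintype _ _ (by simp)]
    rw [← Equiv.prod_comp σ (fun i => (X i : MvPolynomial (Fin n) K) ^ _)]
    simp
  have h2 := congrArg (coeff (Finsupp.equivFunOnFinite.symm fun j : Fin n => j.val)) h
  simp only [BB, h1, coeff_sum, coeff_monomial, coeff_zero] at h2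
  rw [Finset.sum_eq_single 1] at h2
  · simp at h2
    exact h2 rfl
  · intro σ _ hσ
    rw [if_neg]
    intro h3
    apply hσ
    have h4 := Finsupp.equivFunOnFinite.symm.injective h3
    rw [← Equiv.symm_symm σ]
    have : σ.symm = 1 := Equiv.ext fun j => Fin.ext (congrFun h4 j)
    rw [this]; rfl
  · simp

lemma coeff_Tr_mono (p e : ℕ) [ExpChar K p] [PerfectRing K p] {σ : Type} [Fintype σ] {μ : σ →₀ ℕ} (hμ : ∀ v, μ v < p ^ e)
    (g : MvPolynomial σ K) (β : σ →₀ ℕ) :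
    coeff β (Tr p e (monomial (topm σ (p ^ e) - μ) 1 * g)) = rt p e (coeff (p ^ e • β + μ) g) := by
  rw [coeff_Tr]
  have : p ^ e • β + topm σ (p ^ e) = (topm σ (p ^ e) - μ) + (p ^ e • β + μ) := by
    ext v
    have := hμ v
    simp only [Finsupp.add_apply, Finsupp.smul_apply, topm_apply, Finsupp.tsub_apply, smul_eq_mul]
    omega
  rw [this, coeff_monomial_mul, one_mul]

lemma aes_inj (l0 : Fin m) {Q : MvPolynomial (Fin n) K} (hQ : aeval (es K n l0) Q = 0) : Q = 0 := by
  have h1 := congrArg (rho K n l0) hQ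
  rw [rho_aes, map_zero] at h1
  apply symm_inj
  rw [map_zero]
  have h2 : aeval (tt K n l0) = rename (fun i : Fin n => ((l0, i, i) : MV n m)) (R := K) := by
    ext i : 1; simp [tt]
  rw [h2] at h1
  refine rename_injective _ ?_ (h1.trans (map_zero _).symm)
  intro a b h; simpa using h

lemma exPhi (p : ℕ) [hp : Fact p.Prime] [CharP K p] [IsAlgClosed K] (l0 : Fin m) {c : MvPolynomial (MV n m) K}
    (hc : c ∈ matrixInvariants K n m) (hc0 : c ≠ 0) :
    ∃ (e1 : ℕ) (Φ : MvPolynomial (MV n m) K →+ MvPolynomial (MV n m) K) (Q : MvPolynomial (Fin n) K),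
      Q ≠ 0 ∧ Φ c = rho K n l0 (aeval (es K n l0) Q) ∧
      (∀ s ∈ matrixInvariants K n m, ∀ x, Φ (s ^ p ^ e1 * x) = rho K n l0 s * Φ x) ∧
      (∀ s ∈ matrixInvariants K n m, ∃ N0, ∀ N, N0 ≤ N → ∃ s' ∈ matrixInvariants K n m, rho K n l0 s' = dsc (tt K n l0) ^ N * Φ s) := by
  classical
  have hinf : Infinite K := IsAlgClosed.instInfinite
  have hrc : rho K n l0 c ≠ 0 := fun h => hc0 (rho_inj l0 hc h)
  obtain ⟨μ, hμ⟩ := ne_zero_iff.1 hrc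
  let e1 := (rho K n l0 c).totalDegree
  have hlt : ∀ α ∈ (rho K n l0 c).support, ∀ v, α v < p ^ e1 := by
    intro α hα v
    refine lt_of_le_of_lt ?_ (Nat.lt_pow_self (n := e1) hp.out.one_lt)
    refine le_trans ?_ (le_totalDegree hα)
    by_cases hv : v ∈ α.support
    · exact Finset.single_le_sum (f := fun v => α v) (fun _ _ => Nat.zero_le _) hv
    · simp at hv; omega
  have hμ' := hlt μ (mem_support_iff.2 hμ)
  have hrTW : ∀ s ∈ matrixInvariants K n m, TW (rho K n l0 s) := by
    intro s hs α hα
    refine TW_of_mem hs α ?_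
    rw [mem_support_iff] at hα ⊢
    by_cases h : ∀ a b, a ≠ b → α (l0, a, b) = 0
    · rwa [(coeff_rho l0 s α).1 h] at hα
    · rw [(coeff_rho l0 s α).2 h] at hα; exact absurd rfl hα
  have hμw : wt0 μ := hrTW c hc μ (mem_support_iff.2 hμ)
  let h' : MvPolynomial (MV n m) K := monomial (topm (MV n m) (p ^ e1) - μ) 1
  let b : MvPolynomial (MV n m) K := ∏ i, tt K n l0 i ^ i.val
  have hbT : TW b := TW.prod _ _ fun i _ => TW.pow (by
    intro α hα j
    rw [tt, support_X, Finset.mem_singleton] at hα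
    subst hα
    simp [rowc, colc, Finsupp.single_apply, Finset.sum_ite]) _
  have hbr : rho K n l0 b = b := by
    simp [b, rho, tt, map_prod, ev, Xr]
  let Φ : MvPolynomial (MV n m) K →+ MvPolynomial (MV n m) K :=
    { toFun := fun s => psi (b * Tr p e1 (h' * rho K n l0 s))
      map_zero' := by simp [Tr_zero, psi]
      map_add' := fun x y => by rw [map_add, mul_add, Tr_add, mul_add, psi_add] }
  have hΦ : ∀ s, Φ s = psi (b * Tr p e1 (h' * rho K n l0 s)) := fun _ => rfl
  obtain ⟨Q0, hQ0⟩ := exists_symm _ (BB_symm (K := K) (n := n))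
  have hQne : Q0 ≠ 0 := by rintro rfl; exact BB_ne (K := K) (n := n) (by rw [← hQ0, map_zero])
  set κ := rt p e1 (coeff μ (rho K n l0 c)) with hκ
  have hκ0 : κ ≠ 0 := by rw [hκ]; simpa using hμ
  have hTc : Tr p e1 (h' * rho K n l0 c) = C κ := by
    ext β
    rw [coeff_Tr_mono p e1 hμ', coeff_C]
    split_ifs with h0
    · subst h0; simp [hκ]
    · have : coeff (p ^ e1 • β + μ) (rho K n l0 c) = 0 := by
        by_contra h
        obtain ⟨v, hv⟩ := Finsupp.ne_iff.1 (Ne.symm h0)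
        have := hlt _ (mem_support_iff.2 h) v
        simp only [Finsupp.add_apply, Finsupp.smul_apply, smul_eq_mul] at this
        have hv1 : 1 ≤ β v := Nat.one_le_iff_ne_zero.2 hv
        have := Nat.le_mul_of_pos_right (p ^ e1) hv1
        omega
      rw [this, map_zero]
  have hpsib : psi b = rho K n l0 (aeval (es K n l0) Q0) := by
    rw [rho_aes, hQ0]
    simp [psi, b, BB, act, tt, map_prod, map_sum]
  refine ⟨e1, Φ, C κ * Q0, mul_ne_zero (by simpa using hκ0) hQne, ?_, ?_, ?_⟩
  · rw [hΦ, hTc, mul_comm, psi_C_mul, hpsib, map_mul, map_mul, aeval_C]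
    congr 1
    rw [MvPolynomial.algebraMap_eq, rho, aeval_C]; rfl
  · intro s hs x
    rw [hΦ, hΦ, map_mul, map_pow, mul_left_comm, Tr_pow_mul, mul_left_comm, psi_rho_mul l0 hs]
  · intro s hs
    rw [hΦ]
    refine PP_of l0 (hbT.mul ?_) ?_
    · intro α hα i
      rw [mem_support_iff, coeff_Tr_mono p e1 hμ'] at hα
      have h1 := hrTW s hs (p ^ e1 • α + μ) (by
        rw [mem_support_iff]; intro h; rw [h, map_zero] at hα; exact hα rfl) i
      have h2 := hμw i
      simp only [rowc, colc] at h1 h2 ⊢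
      have : ∀ (P : MV n m → Prop) [DecidablePred P], (∑ v, if P v then (p ^ e1 • α + μ) v else 0) =
          p ^ e1 * (∑ v, if P v then α v else 0) + ∑ v, if P v then μ v else 0 := by
        intro P _
        rw [Finset.mul_sum, ← Finset.sum_add_distrib]
        refine Finset.sum_congr rfl fun v _ => ?_
        split_ifs <;> simp
      rw [this, this, h2] at h1
      exact Nat.eq_of_mul_eq_mul_left (qpos (K := K) p e1) (Nat.add_right_cancel h1)
    · rw [map_mul, hbr]
      congr 1
      ext α
      by_cases h : ∀ a b, a ≠ b → α (l0, a, b) = 0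
      · rw [(coeff_rho l0 _ α).1 h]
      · rw [(coeff_rho l0 _ α).2 h, coeff_Tr_mono p e1 hμ', (coeff_rho l0 _ _).2, map_zero]
        intro h'
        apply h
        intro a b hab
        have := h' a b hab
        simp at this
        exact this.1.resolve_left (fun h => hp.out.ne_zero h.1)

theorem CP (p : ℕ) [hp : Fact p.Prime] [CharP K p] [IsAlgClosed K] (hm : 0 < m) {ιd ιf ιz : Type}
    [Fintype ιd] [Fintype ιf] [Fintype ιz] {c a : MvPolynomial (MV n m) K} {y : ιd → MvPolynomial (MV n m) K}
    {f : ιf → MvPolynomial (MV n m) K} {z : ιz → MvPolynomial (MV n m) K}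
    (hc : c ∈ matrixInvariants K n m) (hc0 : c ≠ 0) (ha : a ∈ matrixInvariants K n m)
    (hy : ∀ i, y i ∈ matrixInvariants K n m) (hf : ∀ i, f i ∈ matrixInvariants K n m)
    (hz : ∀ i, z i ∈ matrixInvariants K n m) {da D : ℕ} (had : a.IsHomogeneous da) (hzd : ∀ i, (z i).IsHomogeneous D)
    (H : ∀ e, ∃ g : ιz → ιf → MvPolynomial ιd K,
      c * a ^ p ^ e = ∑ i, ∑ j, z i ^ p ^ e * (aeval y (g i j) * f j)) :
    ∃ s : ιz → MvPolynomial (MV n m) K, (∀ i, s i ∈ matrixInvariants K n m) ∧ a = ∑ i, z i * s i := by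
  classical
  have hinf : Infinite K := IsAlgClosed.instInfinite
  let l0 : Fin m := ⟨0, hm⟩
  obtain ⟨e1, Φ, Q0, hQ0, hΦc, hΦl, hΦN⟩ := exPhi p l0 hc hc0
  have hym : ∀ g : MvPolynomial ιd K, aeval y g ∈ matrixInvariants K n m := by
    intro g
    induction g using MvPolynomial.induction_on with
    | C a => rw [aeval_C]; exact Subalgebra.algebraMap_mem _ _
    | add p q hp hq => rw [map_add]; exact add_mem hp hq
    | mul_X p i hp => rw [map_mul, aeval_X]; exact mul_mem hp (hy _)
  -- uniform N
  have hN : ∃ N, ∀ (g : MvPolynomial ιd K) (j : ιf), ∃ s' ∈ matrixInvariants K n m,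
      rho K n l0 s' = dsc (tt K n l0) ^ N * Φ (aeval y g * f j) := by
    choose N0 hN0 using fun (γj : (ιd → Fin (p ^ e1)) × ιf) => hΦN
      (aeval y (monomial (Finsupp.equivFunOnFinite.symm fun v => (γj.1 v).val) (1 : K)) * f γj.2) (mul_mem (hym _) (hf _))
    refine ⟨Finset.univ.sup N0, fun g j => ?_⟩
    induction g using MvPolynomial.induction_on' with
    | monomial α k =>
      obtain ⟨g, γ, hγ, e⟩ := exists_decomp p e1 α k
      have hq := qpos (K := K) p e1
      let γ' : ιd → Fin (p ^ e1) := fun v => ⟨γ v, by have := hγ v; omega⟩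
      obtain ⟨s', hs', h⟩ := hN0 (γ', j) _ (Finset.le_sup (Finset.mem_univ _))
      have hγ' : (Finsupp.equivFunOnFinite.symm fun v => (γ' v).val) = γ := by ext v; rfl
      simp only [hγ'] at h
      refine ⟨aeval y g * s', mul_mem (hym _) hs', ?_⟩
      rw [e, map_mul, map_mul (aeval y), map_pow, mul_assoc, hΦl _ (hym _), h]
      ring
    | add g g' hg hg' =>
      obtain ⟨s, hs, h⟩ := hg
      obtain ⟨s', hs', h'⟩ := hg'
      exact ⟨s + s', add_mem hs hs', by rw [map_add, map_add, add_mul, map_add, h, h', mul_add]⟩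
  obtain ⟨N, hN⟩ := hN
  set Q := DD K n ^ N * Q0 with hQdef
  have hDD : DD K n ≠ 0 := by
    intro h
    apply dl_ne (K := K) (n := n) l0
    rw [dl, h, map_zero]
  have hQ : Q ≠ 0 := mul_ne_zero (pow_ne_zero _ hDD) hQ0
  have step : ∀ e, ∃ s : ιz → MvPolynomial (MV n m) K, (∀ i, s i ∈ matrixInvariants K n m) ∧
      aeval (es K n l0) Q * a ^ p ^ e = ∑ i, z i ^ p ^ e * s i := by
    intro e
    obtain ⟨g, hg⟩ := H (e + e1)
    choose s hs hs' using fun i j => hN (g i j) j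
    refine ⟨fun i => ∑ j, s i j, fun i => sum_mem fun j _ => hs i j, ?_⟩
    rw [← sub_eq_zero]
    apply rho_inj l0
    · exact sub_mem (mul_mem (aes_mem _ _) (pow_mem ha _)) (sum_mem fun i _ => mul_mem (pow_mem (hz i) _) (sum_mem fun j _ => hs i j))
    · rw [map_sub, sub_eq_zero]
      have h1 := congrArg Φ hg
      rw [mul_comm c] at h1
      simp only [pow_add, pow_mul, map_sum] at h1
      rw [hΦl _ (pow_mem ha _), hΦc] at h1
      have h2 : ∀ i j, Φ ((z i ^ p ^ e) ^ p ^ e1 * (aeval y (g i j) * f j)) = rho K n l0 (z i ^ p ^ e) * Φ (aeval y (g i j) * f j) :=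
        fun i j => hΦl _ (pow_mem (hz i) _) _
      simp only [h2] at h1
      have h3 : rho K n l0 (aeval (es K n l0) Q) = dsc (tt K n l0) ^ N * rho K n l0 (aeval (es K n l0) Q0) := by
        rw [hQdef, map_mul, map_mul, map_pow, map_pow, ← rho_dl, dl]
      rw [map_mul, h3, mul_assoc, mul_comm (rho K n l0 (aeval _ Q0)), h1]
      simp only [map_sum, map_mul, hs', Finset.mul_sum]
      refine Finset.sum_congr rfl fun i _ => Finset.sum_congr rfl fun j _ => by ring
  -- convert to sg
  let Q' : MvPolynomial (Fin n) K := aeval (fun i : Fin n => (-1) ^ (i.val + 1) * X (Fin.rev i)) Q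
  have hQ' : aeval (fun c : Fin n => sg K n l0 c) Q' = aeval (es K n l0) Q := by
    simp only [Q']
    rw [← AlgHom.comp_apply, comp_aeval]
    congr 2
    funext i
    rw [map_mul, aeval_X, es, Fin.val_rev, map_pow, map_neg, map_one]
    congr 2
    omega
  have hQ'0 : Q' ≠ 0 := by
    intro h
    rw [h, map_zero] at hQ'
    exact hQ (aes_inj l0 hQ'.symm)
  obtain ⟨e, h, hT, hE, hne⟩ := L3 p (m := m) hp.out hm hQ'0
  change coeff 0 (Tr p e (h * aeval (fun c : Fin n => sg K n l0 c) Q')) ≠ 0 at hne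
  rw [hQ'] at hne
  obtain ⟨s, hs, hsum⟩ := step e
  set u := Tr p e (h * aeval (es K n l0) Q) with hu
  have h1 : a * u = ∑ i, z i * Tr p e (h * s i) := by
    rw [hu, ← Tr_pow_mul, mul_left_comm, mul_comm (a ^ _), hsum, Finset.mul_sum, Tr_sum]
    refine Finset.sum_congr rfl fun i _ => ?_
    rw [mul_left_comm, Tr_pow_mul]
  have h2 := congrArg (homogeneousComponent da) h1
  rw [hc_mul had, if_pos le_rfl, Nat.sub_self, homogeneousComponent_zero, map_sum] at h2
  simp only [hc_mul (hzd _)] at h2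
  have hsS : ∀ i, Tr p e (h * s i) ∈ matrixInvariants K n m := fun i => Tr_mul_mem p e hT hE (hs i)
  refine ⟨fun i => if D ≤ da then C (coeff 0 u)⁻¹ * homogeneousComponent (da - D) (Tr p e (h * s i)) else 0, fun i => ?_, ?_⟩
  · dsimp only
    split_ifs
    · exact mul_mem (Subalgebra.algebraMap_mem _ _) (hc_mem (hsS i) _)
    · exact zero_mem _
  · calc a = C (coeff 0 u)⁻¹ * (a * C (coeff 0 u)) := by
          rw [mul_left_comm, ← C_mul, inv_mul_cancel₀ hne, C_1, mul_one]
      _ = _ := by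
          rw [h2, Finset.mul_sum]
          refine Finset.sum_congr rfl fun i _ => ?_
          split_ifs
          · ring
          · simp
end CP
end CMProof


namespace CMProof
section lev
variable {K : Type*} {B : Type*} [Field K] [Ring B] [Algebra K B]

lemma coeff_mem [Infinite K] (J : Submodule K B) (d : ℕ) (v : ℕ → B)
    (h : ∀ t : K, ∑ k ∈ Finset.range d, t ^ k • v k ∈ J) (k : ℕ) (hk : k < d) : v k ∈ J := by
  rw [← Submodule.Quotient.mk_eq_zero, ← Module.forall_dual_apply_eq_zero_iff K]
  intro φ
  let q : Polynomial K := ∑ k ∈ Finset.range d, Polynomial.C (φ (Submodule.Quotient.mk (v k))) * Polynomial.X ^ k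
  have hq : q = 0 := by
    apply Polynomial.funext
    intro t
    have h1 := (Submodule.Quotient.mk_eq_zero J).2 (h t)
    have h2 := congrArg φ h1
    rw [← Submodule.mkQ_apply, map_sum, map_sum, map_zero] at h2
    rw [Polynomial.eval_zero, ← h2, Polynomial.eval_finsetSum]
    refine Finset.sum_congr rfl fun k _ => ?_
    rw [map_smul, map_smul, Polynomial.eval_mul, Polynomial.eval_C, Polynomial.eval_pow, Polynomial.eval_X, smul_eq_mul, mul_comm]
    rfl
  have := congrArg (fun r => Polynomial.coeff r k) hq
  simpa [q, Polynomial.finsetSum_coeff, Polynomial.coeff_X_pow, hk] using this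

/-- first-order term of the power -/
lemma pow_expand (a b : B) (n : ℕ) : ∃ v : ℕ → B, v 1 = ∑ i ∈ Finset.range (n + 1), a ^ i * b * a ^ (n - i) ∧
    ∀ t : K, (a + t • b) ^ (n + 1) = ∑ k ∈ Finset.range (n + 2), t ^ k • v k := by
  have key : ∀ n : ℕ, ∃ v : ℕ → B, v 0 = a ^ n ∧ v 1 = ∑ i ∈ Finset.range n, a ^ i * b * a ^ (n - 1 - i) ∧
      (∀ k, n < k → v k = 0) ∧
      ∀ t : K, (a + t • b) ^ n = ∑ k ∈ Finset.range (n + 1), t ^ k • v k := by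
    intro n
    induction n with
    | zero => exact ⟨fun k => if k = 0 then 1 else 0, by simp, by simp, fun k hk => by simp; omega, by simp⟩
    | succ n ih =>
      obtain ⟨v, h0, h1, h2, h3⟩ := ih
      refine ⟨fun k => v k * a + if k = 0 then 0 else v (k - 1) * b, ?_, ?_, ?_, ?_⟩
      · simp [h0, pow_succ]
      · simp only [if_neg one_ne_zero, Nat.sub_self, h0, h1]
        rw [Finset.sum_range_succ, Finset.sum_mul]
        congr 1
        · refine Finset.sum_congr rfl fun i hi => ?_
          have := Finset.mem_range.1 hi
          rw [mul_assoc, ← pow_succ]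
          congr 2; omega
        · simp
      · intro k hk
        dsimp only
        rw [h2 k (by omega), if_neg (by omega), h2 (k - 1) (by omega)]; simp
      · intro t
        rw [pow_succ, h3, mul_add, Finset.sum_mul, Finset.sum_mul]
        simp only [smul_add, Finset.sum_add_distrib]
        congr 1
        · rw [Finset.sum_range_succ _ (n + 1), h2 (n + 1) (by omega)]; simp
        · rw [Finset.sum_range_succ' _ (n + 1)]
          simp only [pow_zero, if_true, smul_zero, add_zero, if_neg (Nat.succ_ne_zero _), Nat.add_sub_cancel]
          refine Finset.sum_congr rfl fun k _ => ?_
          rw [mul_smul_comm, smul_mul_assoc, smul_smul, pow_succ']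
  obtain ⟨v, _, h1, _, h3⟩ := key (n + 1)
  exact ⟨v, h1, h3⟩

/-- ideal generated by `J` and `a^n`, `a ∈ F` -/
def JF (J : Submodule K B) (n : ℕ) (F : Set B) : Submodule K B :=
  J ⊔ Submodule.span K {x | ∃ a ∈ F, ∃ u v : B, x = u * a ^ n * v}

lemma JF_left {J : Submodule K B} (hl : ∀ b, ∀ j ∈ J, b * j ∈ J) (n : ℕ) (F : Set B) :
    ∀ b, ∀ j ∈ JF J n F, b * j ∈ JF J n F := by
  intro b j hj
  obtain ⟨x, hx, y, hy, rfl⟩ := Submodule.mem_sup.1 hj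
  rw [mul_add]
  refine add_mem (Submodule.mem_sup_left (hl b x hx)) (Submodule.mem_sup_right ?_)
  clear hj
  induction hy using Submodule.span_induction with
  | mem x h =>
    obtain ⟨a, ha, u, v, rfl⟩ := h
    exact Submodule.subset_span ⟨a, ha, b * u, v, by simp only [mul_assoc]⟩
  | zero => simp
  | add x y hx' hy' h1 h2 => rw [mul_add]; exact add_mem h1 h2
  | smul t x hx' h => rw [mul_smul_comm]; exact Submodule.smul_mem _ _ h

lemma JF_right {J : Submodule K B} (hl : ∀ b, ∀ j ∈ J, j * b ∈ J) (n : ℕ) (F : Set B) :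
    ∀ b, ∀ j ∈ JF J n F, j * b ∈ JF J n F := by
  intro b j hj
  obtain ⟨x, hx, y, hy, rfl⟩ := Submodule.mem_sup.1 hj
  rw [add_mul]
  refine add_mem (Submodule.mem_sup_left (hl b x hx)) (Submodule.mem_sup_right ?_)
  clear hj
  induction hy using Submodule.span_induction with
  | mem x h =>
    obtain ⟨a, ha, u, v, rfl⟩ := h
    exact Submodule.subset_span ⟨a, ha, u, v * b, by simp only [mul_assoc]⟩
  | zero => simp
  | add x y hx' hy' h1 h2 => rw [add_mul]; exact add_mem h1 h2
  | smul t x hx' h => rw [smul_mul_assoc]; exact Submodule.smul_mem _ _ h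

lemma JF_mono {J : Submodule K B} (n : ℕ) {F F' : Set B} (h : F ⊆ F') : JF J n F ≤ JF J n F' :=
  sup_le_sup_left (Submodule.span_mono (by rintro _ ⟨a, ha, u, v, rfl⟩; exact ⟨a, h ha, u, v, rfl⟩)) _

lemma JF_fin {J : Submodule K B} (n : ℕ) {F : Set B} {x : B} (hx : x ∈ JF J n F) :
    ∃ F' : Finset B, (F' : Set B) ⊆ F ∧ x ∈ JF J n (F' : Set B) := by
  classical
  obtain ⟨x1, hx1, y, hy, rfl⟩ := Submodule.mem_sup.1 hx
  have : ∃ F' : Finset B, (F' : Set B) ⊆ F ∧ y ∈ JF J n (F' : Set B) := by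
    clear hx
    clear hx1
    induction hy using Submodule.span_induction with
    | mem x h =>
      obtain ⟨a, ha, u, v, rfl⟩ := h
      exact ⟨{a}, by simpa using ha, Submodule.mem_sup_right (Submodule.subset_span ⟨a, by simp, u, v, rfl⟩)⟩
    | zero => exact ⟨∅, by simp, zero_mem _⟩
    | add x y _ _ h1 h2 =>
      obtain ⟨F1, h1, h1'⟩ := h1
      obtain ⟨F2, h2, h2'⟩ := h2
      refine ⟨F1 ∪ F2, by simp [h1, h2], add_mem (JF_mono n (by simp) h1') (JF_mono n (by simp) h2')⟩
    | smul t x _ h =>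
      obtain ⟨F1, h1, h1'⟩ := h
      exact ⟨F1, h1, Submodule.smul_mem _ _ h1'⟩
  obtain ⟨F', h, h'⟩ := this
  exact ⟨F', h, add_mem (Submodule.mem_sup_left hx1) h'⟩

theorem lev [Infinite K] {m : ℕ} (x : Fin m → B) (V : Submodule K B)
    (hV : ∀ b, ∃ κ : K, ∃ a ∈ V, b = algebraMap K B κ + a) (hx : ∀ l, x l ∈ V) (n : ℕ) :
    ∀ J : Submodule K B, (∀ b, ∀ j ∈ J, b * j ∈ J) → (∀ b, ∀ j ∈ J, j * b ∈ J) → (∀ a ∈ V, a ^ n ∈ J) →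
      ∃ N, ∀ w : List (Fin m), w.length = N → (w.map x).prod ∈ J := by
  classical
  induction n with
  | zero =>
    intro J _ _ h
    refine ⟨0, fun w hw => ?_⟩
    rw [List.length_eq_zero_iff.1 hw]
    simpa using h 0 (zero_mem _)
  | succ n ih =>
    intro J hl hr hnil
    rcases Nat.eq_zero_or_pos n with hn | hn
    · subst hn
      refine ⟨1, fun w hw => ?_⟩
      obtain ⟨l, rfl⟩ := List.length_eq_one_iff.1 hw
      simpa using hnil _ (hx l)
    have hsand : ∀ a ∈ V, ∀ b, a ^ n * b * a ^ n ∈ J := by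
      intro a ha b
      obtain ⟨κ, b, hb, rfl⟩ := hV b
      rw [mul_add, add_mul]
      refine add_mem ?_ ?_
      · rw [mul_assoc, ← Algebra.smul_def, mul_smul_comm, ← pow_add]
        refine Submodule.smul_mem _ _ ?_
        obtain ⟨k, hk⟩ : ∃ k, n + n = (n + 1) + k := ⟨n - 1, by omega⟩
        rw [hk, pow_add]
        exact hr _ _ (hnil a ha)
      · obtain ⟨v, h1, h2⟩ := pow_expand (K := K) a b n
        have h3 := coeff_mem J (n + 2) v (fun t => by
          rw [← h2]; exact hnil _ (add_mem ha (Submodule.smul_mem _ _ hb))) 1 (by omega)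
        have h4 := hl (a ^ n) _ h3
        rw [h1, Finset.sum_range_succ', mul_add] at h4
        have h5 : a ^ n * ∑ k ∈ Finset.range n, a ^ (k + 1) * b * a ^ (n - (k + 1)) ∈ J := by
          rw [Finset.mul_sum]
          refine sum_mem fun k _ => ?_
          have : a ^ n * (a ^ (k + 1) * b * a ^ (n - (k + 1))) = a ^ (n + 1) * (a ^ k * b * a ^ (n - (k + 1))) := by
            simp only [← mul_assoc, ← pow_add]; congr 3; omega
          rw [this]
          exact hr _ _ (hnil a ha)
        have h6 := (Submodule.add_mem_iff_right J h5).1 h4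
        simpa [mul_assoc] using h6
    obtain ⟨N, hN⟩ := ih (JF J n V) (JF_left hl n _) (JF_right hr n _) (fun a ha =>
      Submodule.mem_sup_right (Submodule.subset_span ⟨a, ha, 1, 1, by simp⟩))
    -- finitely many
    have hfin : {w : List (Fin m) | w.length = N}.Finite := List.finite_length_eq _ _
    choose F hF hF' using fun (w : {w : List (Fin m) // w.length = N}) => JF_fin n (hN w.1 w.2)
    haveI : Fintype {w : List (Fin m) // w.length = N} := hfin.fintype
    let G : Finset B := Finset.univ.biUnion F
    have hG : (G : Set B) ⊆ V := by
      intro a ha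
      simp only [G, Finset.coe_biUnion, Set.mem_iUnion] at ha
      obtain ⟨w, _, hw⟩ := ha
      exact hF w hw
    have hG' : ∀ w : List (Fin m), w.length = N → (w.map x).prod ∈ JF J n (G : Set B) := by
      intro w hw
      refine JF_mono n ?_ (hF' ⟨w, hw⟩)
      intro a ha
      simp only [G, Finset.coe_biUnion, Set.mem_iUnion]
      exact ⟨⟨w, hw⟩, by simp, ha⟩
    clear_value G
    clear hF hF' hN
    induction G using Finset.induction_on generalizing N with
    | empty =>
      refine ⟨N, fun w hw => ?_⟩
      have := hG' w hw
      simpa [JF] using this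
    | insert a G haG ihG =>
      refine ihG (N + N) (List.finite_length_eq _ _) (fun _ => ∅) (List.finite_length_eq _ _).fintype
        (fun b hb => hG (by simp at hb ⊢; exact Or.inr hb)) ?_
      intro w hw
      have hsplit : w = w.take N ++ w.drop N := (List.take_append_drop N w).symm
      rw [hsplit, List.map_append, List.prod_append]
      have h1 := hG' (w.take N) (by rw [List.length_take]; omega)
      have h2 := hG' (w.drop N) (by rw [List.length_drop]; omega)
      have haV : a ∈ V := hG (by simp)
      generalize ((w.take N).map x).prod = X1 at h1
      generalize ((w.drop N).map x).prod = X2 at h2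
      have hdec : ∀ X, X ∈ JF J n (↑(insert a G) : Set B) → ∃ y ∈ JF J n (G : Set B), ∃ z ∈ Submodule.span K {x | ∃ u v : B, x = u * a ^ n * v}, X = y + z := by
        intro X hX
        have hle : JF J n (↑(insert a G) : Set B) ≤ JF J n (G : Set B) ⊔ Submodule.span K {x | ∃ u v : B, x = u * a ^ n * v} := by
          refine sup_le (le_sup_left.trans le_sup_left) (Submodule.span_le.2 ?_)
          rintro _ ⟨a', ha', u, v, rfl⟩
          rcases Finset.mem_insert.1 (Finset.mem_coe.1 ha') with rfl | h
          · exact Submodule.mem_sup_right (Submodule.subset_span ⟨u, v, rfl⟩)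
          · exact Submodule.mem_sup_left (Submodule.mem_sup_right (Submodule.subset_span ⟨a', h, u, v, rfl⟩))
        obtain ⟨y, hy, z, hz, h⟩ := Submodule.mem_sup.1 (hle hX)
        exact ⟨y, hy, z, hz, h.symm⟩
      obtain ⟨y1, hy1, z1, hz1, rfl⟩ := hdec _ h1
      obtain ⟨y2, hy2, z2, hz2, rfl⟩ := hdec _ h2
      rw [add_mul, mul_add]
      refine add_mem (add_mem (JF_left hl n _ _ _ hy2) (JF_right hr n _ _ _ hy1)) ?_
      rw [mul_add]
      refine add_mem (JF_left hl n _ _ _ hy2) (Submodule.mem_sup_left ?_)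
      have := Submodule.mul_mem_mul hz1 hz2
      rw [Submodule.span_mul_span] at this
      refine Submodule.span_le.2 ?_ this
      rintro _ ⟨_, ⟨u, v, rfl⟩, _, ⟨u', v', rfl⟩, rfl⟩
      have h := hl u _ (hr v' _ (hsand a haV (v * u')))
      simpa only [mul_assoc, SetLike.mem_coe] using h
end lev
end CMProof


namespace CMProof
section integ
variable {K : Type} [Field K] {n m : ℕ}

/-- words in generic matrices -/
noncomputable def wX (K : Type) [Field K] (n m : ℕ) (w : List (Fin m)) : Matrix (Fin n) (Fin n) (MvPolynomial (MV n m) K) :=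
  (w.map (Xg n m K)).prod

/-- image of free algebra -/
noncomputable def phi (K : Type) [Field K] (n m : ℕ) : FreeAlgebra K (Fin m) →ₐ[K] Matrix (Fin n) (Fin n) (MvPolynomial (MV n m) K) :=
  FreeAlgebra.lift K (Xg n m K)

/-- ideal generated by positive-degree invariants -/
noncomputable def J0 (K : Type) [Field K] (n m : ℕ) : Submodule K (Matrix (Fin n) (Fin n) (MvPolynomial (MV n m) K)) :=
  Submodule.span K {M | ∃ s ∈ matrixInvariants K n m, coeff 0 s = 0 ∧ ∃ w, M = s • wX K n m w}

lemma J0_left (b : FreeAlgebra K (Fin m)) : ∀ M ∈ J0 K n m, phi K n m b * M ∈ J0 K n m := by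
  induction b using FreeAlgebra.induction with
  | grade0 r => 
    intro M hM
    rw [AlgHom.commutes, ← Algebra.smul_def]; exact Submodule.smul_mem _ _ hM
  | grade1 l =>
    intro M hM
    induction hM using Submodule.span_induction with
    | mem x h =>
      obtain ⟨s, hs, h0, w, rfl⟩ := h
      exact Submodule.subset_span ⟨s, hs, h0, l :: w, by simp [wX, phi]⟩
    | zero => simp
    | add x y _ _ h1 h2 => rw [mul_add]; exact add_mem h1 h2
    | smul t x _ h => rw [mul_smul_comm]; exact Submodule.smul_mem _ _ h
  | mul a b ha hb => intro M hM; rw [map_mul, mul_assoc]; exact ha _ (hb _ hM)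
  | add a b ha hb => intro M hM; rw [map_add, add_mul]; exact add_mem (ha _ hM) (hb _ hM)

lemma J0_right (b : FreeAlgebra K (Fin m)) : ∀ M ∈ J0 K n m, M * phi K n m b ∈ J0 K n m := by
  induction b using FreeAlgebra.induction with
  | grade0 r => 
    intro M hM
    rw [AlgHom.commutes, ← Algebra.commutes, ← Algebra.smul_def]; exact Submodule.smul_mem _ _ hM
  | grade1 l =>
    intro M hM
    induction hM using Submodule.span_induction with
    | mem x h =>
      obtain ⟨s, hs, h0, w, rfl⟩ := h
      exact Submodule.subset_span ⟨s, hs, h0, w ++ [l], by simp [wX, phi]⟩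
    | zero => simp
    | add x y _ _ h1 h2 => rw [add_mul]; exact add_mem h1 h2
    | smul t x _ h => rw [smul_mul_assoc]; exact Submodule.smul_mem _ _ h
  | mul a b ha hb => intro M hM; rw [map_mul, ← mul_assoc]; exact hb _ (ha _ hM)
  | add a b ha hb => intro M hM; rw [map_add, mul_add]; exact add_mem (ha _ hM) (hb _ hM)

lemma J0_phi {s : MvPolynomial (MV n m) K} (hs : s ∈ matrixInvariants K n m) (h0 : coeff 0 s = 0) (b : FreeAlgebra K (Fin m)) :
    s • phi K n m b ∈ J0 K n m := by
  have := J0_left (n := n) b (s • 1) (Submodule.subset_span ⟨s, hs, h0, [], by simp [wX]⟩)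
  simpa using this

lemma phi_cc (b : FreeAlgebra K (Fin m)) : ∃ κ : K, (constantCoeff (R := K) (σ := MV n m)).mapMatrix (phi K n m b) = algebraMap K _ κ := by
  induction b using FreeAlgebra.induction with
  | grade0 r => 
    refine ⟨r, ?_⟩
    rw [AlgHom.commutes]
    ext i j
    by_cases h : i = j <;> simp [Matrix.algebraMap_matrix_apply, h]
  | grade1 l => 
    refine ⟨0, ?_⟩
    ext i j
    simp [phi, Xg]
  | mul a b ha hb => 
    obtain ⟨κ, h1⟩ := ha
    obtain ⟨κ', h2⟩ := hb
    exact ⟨κ * κ', by rw [map_mul, map_mul, h1, h2, map_mul]⟩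
  | add a b ha hb => 
    obtain ⟨κ, h1⟩ := ha
    obtain ⟨κ', h2⟩ := hb
    exact ⟨κ + κ', by rw [map_add, map_add, h1, h2, map_add]⟩

lemma phi_conj {g g' : Matrix (Fin n) (Fin n) K} (hg : g * g' = 1) (b : FreeAlgebra K (Fin m)) :
    (aeval (ev fun l => g.map C * Xg n m K l * g'.map C) : MvPolynomial (MV n m) K →ₐ[K] _).mapMatrix (phi K n m b) =
      g.map C * phi K n m b * g'.map C := by
  have hG : (g.map C * g'.map C : Matrix (Fin n) (Fin n) (MvPolynomial (MV n m) K)) = 1 := by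
    rw [← Matrix.map_mul, hg, Matrix.map_one _ (map_zero _) (map_one _)]
  have hG' := mul_eq_one_comm.1 hG
  induction b using FreeAlgebra.induction with
  | grade0 r => 
    rw [AlgHom.commutes, AlgHom.commutes, ← Algebra.commutes, mul_assoc, hG, mul_one]
  | grade1 l => 
    ext i j
    simp [phi, Xg, ev]
  | mul a b ha hb =>
    rw [map_mul, map_mul, ha, hb]
    calc _ = g.map C * phi K n m a * (g'.map C * g.map C) * phi K n m b * g'.map C := by simp only [mul_assoc]
      _ = _ := by rw [hG']; simp only [mul_assoc, mul_one]
  | add a b ha hb => rw [map_add, map_add, ha, hb, mul_add, add_mul]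

lemma cp_conj {R : Type*} [CommRing R] {g g' : Matrix (Fin n) (Fin n) R} (hg : g * g' = 1) (M : Matrix (Fin n) (Fin n) R) :
    (g * M * g').charpoly = M.charpoly := by
  obtain ⟨u, rfl, rfl⟩ : ∃ u : (Matrix (Fin n) (Fin n) R)ˣ, u.val = g ∧ u⁻¹.val = g' :=
    ⟨⟨g, g', hg, mul_eq_one_comm.1 hg⟩, rfl, rfl⟩
  rw [Matrix.coe_units_inv]
  exact Matrix.charpoly_units_conj u M

lemma phi_charpoly [IsAlgClosed K] (b : FreeAlgebra K (Fin m)) (i : ℕ) : (phi K n m b).charpoly.coeff i ∈ matrixInvariants K n m := by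
  apply mem_S_of_gen
  intro g g' hg
  have hG : (g.map C * g'.map C : Matrix (Fin n) (Fin n) (MvPolynomial (MV n m) K)) = 1 := by
    rw [← Matrix.map_mul, hg, Matrix.map_one _ (map_zero _) (map_one _)]
  have h1 := phi_conj hg b
  have h2 := congrArg Matrix.charpoly h1
  rw [AlgHom.mapMatrix_apply] at h2
  have h3 : (g.map C * phi K n m b * g'.map C).charpoly = (phi K n m b).charpoly := by
    exact cp_conj hG _
  rw [h3] at h2
  have h4 := Matrix.charpoly_map (phi K n m b) (aeval (ev fun l => g.map C * Xg n m K l * g'.map C) : MvPolynomial (MV n m) K →ₐ[K] _).toRingHom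
  have h5 := (h4.symm.trans h2)
  have h6 := congrArg (fun r => Polynomial.coeff r i) h5
  simpa [Polynomial.coeff_map] using h6

lemma J0_words [IsAlgClosed K] : ∃ N, ∀ w : List (Fin m), w.length = N → wX K n m w ∈ J0 K n m := by
  haveI : Infinite K := IsAlgClosed.instInfinite
  let V : Submodule K (FreeAlgebra K (Fin m)) :=
    { carrier := {b | (constantCoeff (R := K) (σ := MV n m)).mapMatrix (phi K n m b) = 0}
      add_mem' := by
        intro a b ha hb
        simp only [Set.mem_setOf_eq, map_add] at *
        rw [ha, hb, add_zero]
      zero_mem' := by simp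
      smul_mem' := by
        intro t b hb
        simp only [Set.mem_setOf_eq, Algebra.smul_def, map_mul] at *
        rw [hb, mul_zero] }
  obtain ⟨N, hN⟩ := lev (K := K) (FreeAlgebra.ι K) V (fun b => by
    obtain ⟨κ, hκ⟩ := phi_cc (n := n) b
    refine ⟨κ, b - algebraMap K _ κ, ?_, by abel⟩
    show (constantCoeff (R := K) (σ := MV n m)).mapMatrix (phi K n m _) = 0
    rw [map_sub, map_sub, hκ, AlgHom.commutes, sub_eq_zero]
    ext i j
    by_cases h : i = j <;> simp [Matrix.algebraMap_matrix_apply, h]) (fun l => by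
    show (constantCoeff (R := K) (σ := MV n m)).mapMatrix (phi K n m _) = 0
    ext i j
    simp [phi, Xg]) n ((J0 K n m).comap (phi K n m).toLinearMap)
    (fun b j hj => by
      simp only [Submodule.mem_comap, AlgHom.toLinearMap_apply, map_mul] at *
      exact J0_left b _ hj)
    (fun b j hj => by
      simp only [Submodule.mem_comap, AlgHom.toLinearMap_apply, map_mul] at *
      exact J0_right b _ hj)
    (fun a ha => by
      change (constantCoeff (R := K) (σ := MV n m)).mapMatrix (phi K n m _) = 0 at ha
      simp only [Submodule.mem_comap, AlgHom.toLinearMap_apply, map_pow]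
      have hCH := Matrix.aeval_self_charpoly (phi K n m a)
      rw [Polynomial.aeval_eq_sum_range, Matrix.charpoly_natDegree_eq_dim, Fintype.card_fin, Finset.sum_range_succ] at hCH
      have hlead : (phi K n m a).charpoly.coeff n = 1 := by
        have := Matrix.charpoly_monic (phi K n m a)
        rw [Polynomial.Monic, Polynomial.leadingCoeff, Matrix.charpoly_natDegree_eq_dim, Fintype.card_fin] at this
        exact this
      rw [hlead, one_smul] at hCH
      rw [eq_neg_of_add_eq_zero_right hCH]
      refine neg_mem (sum_mem fun i hi => ?_)
      rw [← map_pow]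
      refine J0_phi (phi_charpoly a i) ?_ _
      have h4 := Matrix.charpoly_map (phi K n m a) (constantCoeff (R := K) (σ := MV n m))
      rw [← RingHom.mapMatrix_apply, ha, Matrix.charpoly_zero] at h4
      have h6 := congrArg (fun r => Polynomial.coeff r i) h4
      simp only [Polynomial.coeff_map, Fintype.card_fin, Polynomial.coeff_X_pow, (Finset.mem_range.1 hi).ne, if_false] at h6
      exact h6.symm)
  refine ⟨N, fun w hw => ?_⟩
  have := hN w hw
  simp only [Submodule.mem_comap, AlgHom.toLinearMap_apply, map_list_prod, List.map_map] at this
  convert this using 3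
  simp [wX, phi, Function.comp_def]

lemma wX_hom (w : List (Fin m)) (i j : Fin n) : (wX K n m w i j).IsHomogeneous w.length := by
  induction w generalizing i j with
  | nil => 
    by_cases h : i = j
    · simp [wX, h, isHomogeneous_one]
    · simp [wX, h, isHomogeneous_zero]
  | cons l w ih =>
    have : wX K n m (l :: w) i j = ∑ k, X (l, i, k) * wX K n m w k j := by
      simp [wX, Matrix.mul_apply, Xg]
    rw [this, List.length_cons, add_comm]
    exact IsHomogeneous.sum _ _ _ fun k _ => (isHomogeneous_X _ _).mul (ih k j)

noncomputable def sh (m N : ℕ) : Finset (List (Fin m)) := (List.finite_length_lt (Fin m) N).toFinset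
lemma mem_sh {m N : ℕ} {w : List (Fin m)} : w ∈ sh m N ↔ w.length < N := by simp [sh]

lemma words [IsAlgClosed K] : ∃ N, ∃ s : List (Fin m) → List (Fin m) → MvPolynomial (MV n m) K,
    (∀ w w', s w w' ∈ matrixInvariants K n m ∧ (s w w').IsHomogeneous (N - w'.length)) ∧
    ∀ w, w.length = N → wX K n m w = ∑ w' ∈ sh m N, s w w' • wX K n m w' := by
  classical
  haveI : Infinite K := IsAlgClosed.instInfinite
  obtain ⟨N, hN⟩ := J0_words (K := K) (n := n) (m := m)
  refine ⟨N, ?_⟩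
  have key : ∀ M ∈ J0 K n m, ∃ s : List (Fin m) → MvPolynomial (MV n m) K,
     (∀ w', s w' ∈ matrixInvariants K n m ∧ (s w').IsHomogeneous (N - w'.length)) ∧
     M.map (homogeneousComponent N) = ∑ w' ∈ sh m N, s w' • wX K n m w' := by
    intro M hM
    induction hM using Submodule.span_induction with
    | mem x h =>
      obtain ⟨s, hs, h0, w, rfl⟩ := h
      refine ⟨fun w' => if w' = w then homogeneousComponent (N - w'.length) s else 0, fun w' => ?_, ?_⟩
      · dsimp only
        split_ifs
        · exact ⟨hc_mem hs _, homogeneousComponent_isHomogeneous _ _⟩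
        · exact ⟨zero_mem _, isHomogeneous_zero _ _ _⟩
      · simp only [ite_smul, zero_smul, Finset.sum_ite_eq', mem_sh]
        ext1 i j
        rw [Matrix.map_apply, Matrix.smul_apply, smul_eq_mul, mul_comm, hc_mul (wX_hom w i j)]
        rcases lt_trichotomy w.length N with h | h | h
        · rw [if_pos h.le, if_pos h, Matrix.smul_apply, smul_eq_mul, mul_comm]
        · subst h
          simp [h0, homogeneousComponent_zero]
        · rw [if_neg (by omega), if_neg (by omega)]; rfl
    | zero => 
      refine ⟨0, fun w' => ⟨zero_mem _, isHomogeneous_zero _ _ _⟩, ?_⟩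
      ext1 i j; simp
    | add x y _ _ h1 h2 =>
      obtain ⟨s, h1, h1'⟩ := h1
      obtain ⟨s', h2, h2'⟩ := h2
      refine ⟨s + s', fun w' => ⟨add_mem (h1 w').1 (h2 w').1, (h1 w').2.add (h2 w').2⟩, ?_⟩
      simp only [Pi.add_apply, add_smul, Finset.sum_add_distrib, ← h1', ← h2']
      ext1 i j; simp
    | smul t x _ h =>
      obtain ⟨s, h1, h1'⟩ := h
      refine ⟨t • s, fun w' => ⟨Subalgebra.smul_mem _ (h1 w').1 _, (homogeneousSubmodule _ _ _).smul_mem t (h1 w').2⟩, ?_⟩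
      simp only [Pi.smul_apply, smul_assoc, ← Finset.smul_sum, ← h1']
      ext1 i j; simp
  have h1 : ∀ w : List (Fin m), ∃ s : List (Fin m) → MvPolynomial (MV n m) K,
     (∀ w', s w' ∈ matrixInvariants K n m ∧ (s w').IsHomogeneous (N - w'.length)) ∧
     (w.length = N → wX K n m w = ∑ w' ∈ sh m N, s w' • wX K n m w') := by
    intro w
    by_cases hw : w.length = N
    · obtain ⟨s, h1, h2⟩ := key _ (hN w hw)
      refine ⟨s, h1, fun _ => ?_⟩
      rw [← h2]
      ext1 i j
      rw [Matrix.map_apply, homogeneousComponent_of_mem (wX_hom w i j), if_pos hw.symm]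
    · exact ⟨0, fun w' => ⟨zero_mem _, isHomogeneous_zero _ _ _⟩, fun h => absurd h hw⟩
  choose s h1 h2 using h1
  exact ⟨s, h1, h2⟩
end integ
end CMProof


namespace CMProof
section val
variable {K : Type} [Field K] {n m : ℕ}

lemma val_mem [IsAlgClosed K] (hn : 0 < n) {L : Type} [Field L] [Algebra K L] (V : ValuationSubring L)
    (hK : ∀ t : K, algebraMap K L t ∈ V) (Y : Fin m → Matrix (Fin n) (Fin n) L)
    (N : ℕ) (s : List (Fin m) → List (Fin m) → L) (hs : ∀ w w', w'.length < N → s w w' ∈ V)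
    (hw : ∀ w : List (Fin m), w.length = N → (w.map Y).prod = ∑ w' ∈ sh m N, s w w' • (w'.map Y).prod)
    {f : MvPolynomial (MV n m) K} (hf : f ∈ matrixInvariants K n m) : aeval (ev Y) f ∈ V := by
  classical
  have hinf : Infinite K := IsAlgClosed.instInfinite
  have hN : 0 < N := by
    rcases Nat.eq_zero_or_pos N with h | h
    · subst h
      have h1 := hw [] rfl
      have h2 : sh m 0 = ∅ := by ext w; simp [mem_sh]
      rw [h2] at h1
      have h3 := congrFun (congrFun h1 ⟨0, hn⟩) ⟨0, hn⟩
      simp at h3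
    · exact h
  let u : (sh m N) × Fin n → Fin n → L := fun p i => (p.1.1.map Y).prod i p.2
  have hne : Nonempty (sh m N × Fin n) := ⟨⟨⟨[], mem_sh.2 hN⟩, ⟨0, hn⟩⟩⟩
  obtain ⟨c, hc⟩ := Finite.exists_max (fun c : Fin n → sh m N × Fin n => V.valuation (Matrix.of fun i j => u (c j) i).det)
  set g : Matrix (Fin n) (Fin n) L := Matrix.of fun i j => u (c j) i with hg
  have hdet : g.det ≠ 0 := by
    have h1 := hc (fun j => ⟨⟨[], mem_sh.2 hN⟩, j⟩)
    have h2 : (Matrix.of fun i j => u (⟨⟨[], mem_sh.2 hN⟩, j⟩) i) = (1 : Matrix (Fin n) (Fin n) L) := by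
      ext i j; simp [u]
    rw [h2, det_one, map_one] at h1
    intro h0
    rw [h0, map_zero] at h1
    exact absurd h1 (by simp)
  have hgg : g * g⁻¹ = 1 := Matrix.mul_nonsing_inv _ (isUnit_iff_ne_zero.2 hdet)
  have hgg' : g⁻¹ * g = 1 := Matrix.nonsing_inv_mul _ (isUnit_iff_ne_zero.2 hdet)
  have hu : ∀ p i, (g⁻¹ *ᵥ u p) i ∈ V := by
    intro p i
    have h1 : g⁻¹ *ᵥ u p = g.det⁻¹ • g.cramer (u p) := by
      have h2 := Matrix.mulVec_cramer g (u p)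
      calc g⁻¹ *ᵥ u p = g.det⁻¹ • (g⁻¹ *ᵥ (g.det • u p)) := by
            rw [Matrix.mulVec_smul, smul_smul, inv_mul_cancel₀ hdet, one_smul]
        _ = _ := by rw [← h2, Matrix.mulVec_mulVec, hgg', Matrix.one_mulVec]
    rw [h1, Pi.smul_apply, cramer_apply, smul_eq_mul, ← V.valuation_le_one_iff, map_mul, map_inv₀]
    have h3 := hc (Function.update c i p)
    have h4 : (Matrix.of fun i' j => u (Function.update c i p j) i') = g.updateCol i (u p) := by
      ext a b
      by_cases hb : b = i
      · subst hb; simp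
      · simp [hb, hg, Matrix.updateCol_ne]
    rw [h4] at h3
    have h5 : V.valuation g.det ≠ 0 := by simpa using hdet
    calc _ ≤ (V.valuation g.det)⁻¹ * V.valuation g.det := mul_le_mul_right h3 _
      _ = 1 := inv_mul_cancel₀ h5
  have hY : ∀ l i j, (g⁻¹ * Y l * g) i j ∈ V := by
    intro l i j
    have h1 : (g⁻¹ * Y l * g) i j = (g⁻¹ *ᵥ (fun k => ((l :: (c j).1.1).map Y).prod k (c j).2)) i := by
      rw [mul_assoc, Matrix.mul_apply, Matrix.mulVec, dotProduct]
      refine Finset.sum_congr rfl fun k _ => ?_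
      congr 1
    rw [h1]
    have hl : (c j).1.1.length < N := mem_sh.1 (c j).1.2
    by_cases h : (l :: (c j).1.1).length < N
    · exact hu ⟨⟨_, mem_sh.2 h⟩, (c j).2⟩ i
    · have h2 := hw (l :: (c j).1.1) (by simp at h ⊢; omega)
      have h3 : (fun k => ((l :: (c j).1.1).map Y).prod k (c j).2) = ∑ w' : sh m N, s (l :: (c j).1.1) w'.1 • u (w', (c j).2) := by
        funext k
        rw [h2, Matrix.sum_apply, Finset.sum_apply, ← Finset.sum_coe_sort]
        rfl
      rw [h3, Matrix.mulVec_sum, Finset.sum_apply]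
      refine sum_mem fun w' _ => ?_
      rw [Matrix.mulVec_smul, Pi.smul_apply, smul_eq_mul]
      exact mul_mem (hs _ _ (mem_sh.1 w'.2)) (hu _ _)
  rw [← inv_of_Lam (mem_S_iff_Lam.1 hf) hgg' Y]
  clear hf hw
  induction f using MvPolynomial.induction_on with
  | C a => rw [aeval_C]; exact hK a
  | add p q hp hq => rw [map_add]; exact add_mem hp hq
  | mul_X p i hp => rw [map_mul, aeval_X]; exact mul_mem hp (hY _ _ _)

lemma exists_val {A L : Type*} [CommRing A] [Field L] [Algebra A L] {x : L} (hx : ¬ IsIntegral A x) :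
    ∃ V : ValuationSubring L, (∀ a, algebraMap A L a ∈ V) ∧ x ∉ V := by
  let R := (integralClosure A L).toSubring
  have hR : IsIntegrallyClosedIn R L := by
    rw [Subring.isIntegrallyClosedIn_iff]
    intro x hx
    have : IsIntegral (integralClosure A L) x := hx
    exact isIntegral_trans (R := A) (A := integralClosure A L) x this
  obtain ⟨V, hV1, hV2⟩ := Subring.exists_le_valuationSubring_of_isIntegrallyClosedIn (R := R) hx
  exact ⟨V, fun a => hV1 (isIntegral_algebraMap (R := A) (A := L) (x := a)), hV2⟩

lemma val_mem' [IsAlgClosed K] (hn : 0 < n) : ∃ (N : ℕ) (s : List (Fin m) → List (Fin m) → MvPolynomial (MV n m) K),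
    (∀ w w', s w w' ∈ matrixInvariants K n m ∧ (s w w').IsHomogeneous (N - w'.length)) ∧
    ∀ f ∈ matrixInvariants K n m, IsIntegral (Algebra.adjoin K ((fun p : List (Fin m) × List (Fin m) => s p.1 p.2) '' {p | p.1.length = N ∧ p.2.length < N})) f := by
  obtain ⟨N, s, h1, h2⟩ := words (K := K) (n := n) (m := m)
  refine ⟨N, fun w w' => if w.length = N then s w w' else 0, fun w w' => ?_, fun f hf => ?_⟩
  · dsimp only; split_ifs
    · exact h1 w w'
    · exact ⟨zero_mem _, isHomogeneous_zero _ _ _⟩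
  set A := Algebra.adjoin K ((fun p : List (Fin m) × List (Fin m) => if p.1.length = N then s p.1 p.2 else 0) '' {p | p.1.length = N ∧ p.2.length < N}) with hA
  let L := FractionRing (MvPolynomial (MV n m) K)
  suffices IsIntegral A (algebraMap _ L f) by
    exact (isIntegral_algebraMap_iff (IsFractionRing.injective (MvPolynomial (MV n m) K) L)).1 this
  by_contra hcon
  obtain ⟨V, hV1, hV2⟩ := exists_val hcon
  apply hV2
  have hAV : ∀ a ∈ A, algebraMap _ L a ∈ V := fun a ha => hV1 ⟨a, ha⟩
  have h3 := val_mem hn V (fun t => by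
    have := hAV (algebraMap K _ t) (Subalgebra.algebraMap_mem _ _)
    rwa [← IsScalarTower.algebraMap_apply] at this) (fun l => (Xg n m K l).map (algebraMap _ L)) N
    (fun w w' => if w.length = N then algebraMap _ L (s w w') else 0) (fun w w' hw' => by
      split_ifs with h
      · exact hAV _ (Algebra.subset_adjoin ⟨(w, w'), ⟨h, hw'⟩, by simp [h]⟩)
      · exact zero_mem _) (fun w hw => by
      have h4 := congrArg (algebraMap (MvPolynomial (MV n m) K) L).mapMatrix (h2 w hw)
      simp only [wX, map_list_prod, List.map_map, map_sum] at h4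
      simp only [if_pos hw]
      refine h4.trans (Finset.sum_congr rfl fun w' _ => ?_)
      ext i j
      simp only [RingHom.mapMatrix_apply, Matrix.map_apply, Matrix.smul_apply, smul_eq_mul, map_mul]
      congr 1
      rw [← Matrix.map_apply (f := algebraMap (MvPolynomial (MV n m) K) L), ← RingHom.mapMatrix_apply, map_list_prod, List.map_map]
      rfl) hf
  convert h3 using 1
  have h5 : (aeval (ev fun l => (Xg n m K l).map (algebraMap (MvPolynomial (MV n m) K) L)) : MvPolynomial (MV n m) K →ₐ[K] L) = IsScalarTower.toAlgHom K (MvPolynomial (MV n m) K) L := by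
    ext v
    simp [ev, Xg]
  rw [h5]; rfl

lemma int_trans {P : Type*} [CommRing P] [Algebra K P] {A A' : Subalgebra K P} (h : ∀ a ∈ A, IsIntegral A' a) {f : P}
    (hf : IsIntegral A f) : IsIntegral A' f := by
  have h1 : IsIntegral (integralClosure A' P) f := by
    obtain ⟨q, hq, hq'⟩ := hf
    let i : A →+* integralClosure A' P := ((algebraMap A P).codRestrict (integralClosure A' P).toSubring (fun a => h a.1 a.2))
    refine ⟨q.map i, hq.map i, ?_⟩
    rw [Polynomial.eval₂_map]
    exact hq'
  exact isIntegral_trans (R := A') (A := integralClosure A' P) f h1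

lemma int_gen {P : Type*} [CommRing P] [Algebra K P] {T : Set P} {A' : Subalgebra K P} (h : ∀ a ∈ T, IsIntegral A' a) {f : P}
    (hf : IsIntegral (Algebra.adjoin K T) f) : IsIntegral A' f := by
  refine int_trans (A := Algebra.adjoin K T) ?_ hf
  have : Algebra.adjoin K T ≤ (integralClosure A' P).restrictScalars K := Algebra.adjoin_le h
  exact fun a ha => this ha

/-- finitely many homogeneous invariants of the same positive degree, with `S` integral over them -/
lemma int_same_deg [IsAlgClosed K] (hn : 0 < n) : ∃ (r D : ℕ) (e : Fin r → MvPolynomial (MV n m) K), 0 < D ∧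
    (∀ i, e i ∈ matrixInvariants K n m ∧ (e i).IsHomogeneous D) ∧
    ∀ f ∈ matrixInvariants K n m, IsIntegral (Algebra.adjoin K (Set.range e)) f := by
  obtain ⟨N, s, h1, h2⟩ := val_mem' (K := K) (n := n) (m := m) hn
  have hfin : {p : List (Fin m) × List (Fin m) | p.1.length = N ∧ p.2.length < N}.Finite :=
    ((List.finite_length_eq (Fin m) N).prod (List.finite_length_lt (Fin m) N)).subset fun p hp => hp
  have := hfin.fintype
  let ι := {p : List (Fin m) × List (Fin m) // p.1.length = N ∧ p.2.length < N}
  haveI : Fintype ι := this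
  let eq := Fintype.equivFin ι
  refine ⟨Fintype.card ι, N.factorial, fun i => s (eq.symm i).1.1 (eq.symm i).1.2 ^ (N.factorial / (N - (eq.symm i).1.2.length)), Nat.factorial_pos _, fun i => ?_, fun f hf => ?_⟩
  · refine ⟨pow_mem (h1 _ _).1 _, ?_⟩
    have h3 := ((h1 (eq.symm i).1.1 (eq.symm i).1.2).2.pow (N.factorial / (N - (eq.symm i).1.2.length)))
    have h4 := (eq.symm i).2.2
    rwa [Nat.mul_div_cancel' (Nat.dvd_factorial (by omega) (by omega))] at h3
  · refine int_gen ?_ (h2 f hf)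
    rintro _ ⟨p, hp, rfl⟩
    have h4 : 0 < N.factorial / (N - p.2.length) := Nat.div_pos (Nat.le_of_dvd (Nat.factorial_pos _) (Nat.dvd_factorial (by have := hp.2; omega) (by omega))) (by have := hp.2; omega)
    refine IsIntegral.of_pow h4 ?_
    have hmem : s p.1 p.2 ^ (N.factorial / (N - p.2.length)) ∈ Algebra.adjoin K (Set.range fun i => s (eq.symm i).1.1 (eq.symm i).1.2 ^ (N.factorial / (N - (eq.symm i).1.2.length))) :=
      Algebra.subset_adjoin ⟨eq ⟨p, hp⟩, by simp⟩
    exact isIntegral_algebraMap (R := Algebra.adjoin K (Set.range _)) (x := ⟨_, hmem⟩)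
end val
end CMProof


namespace CMProof
section noeth
variable {K : Type} [Field K]

lemma ae {σ : Type*} {R : Type*} [CommRing R] (x : σ → R) (F : MvPolynomial σ R) : aeval x F = eval x F := by
  rw [← coe_aeval_eq_eval]; rfl

lemma aeval_scale {σ : Type*} [Fintype σ] {E : Type*} [CommRing E] [Algebra K E] {F : MvPolynomial σ K} {j : ℕ} (hF : F.IsHomogeneous j)
    (t : E) (x : σ → E) : aeval (fun i => t * x i) F = t ^ j * aeval x F := by
  classical
  rw [aeval_def, aeval_def, eval₂_eq', eval₂_eq', Finset.mul_sum]
  refine Finset.sum_congr rfl fun d hd => ?_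
  have h := hF (mem_support_iff.1 hd)
  rw [Finsupp.weight_apply, Finsupp.sum_fintype _ _ (by simp)] at h
  simp only [Pi.one_apply, smul_eq_mul, mul_one] at h
  simp only [mul_pow, Finset.prod_mul_distrib, Finset.prod_pow_eq_pow_sum, h]
  ring

lemma noeth_int {P : Type} [CommRing P] [IsDomain P] [Algebra K P] {r : ℕ} (F : MvPolynomial (Fin r) K) {j : ℕ} (hF : F.IsHomogeneous j)
    (β : Fin r → K) (hβ : eval β F ≠ 0) (e' : Fin r → P) (t : P) (h0 : aeval (fun i => e' i + algebraMap K P (β i) * t) F = 0)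
    (A : Subalgebra K P) (he : ∀ i, e' i ∈ A) : IsIntegral A t := by
  let L := FractionRing P
  suffices IsIntegral A (algebraMap _ L t) from (isIntegral_algebraMap_iff (IsFractionRing.injective P L)).1 this
  by_contra hcon
  obtain ⟨V, hV, ht⟩ := exists_val hcon
  apply ht
  set τ := algebraMap P L t with hτ
  have hτ0 : τ ≠ 0 := by intro h; rw [h] at ht; exact ht (zero_mem _)
  have hτi : τ⁻¹ ∈ V := (V.mem_or_inv_mem τ).resolve_left ht
  have hKV : ∀ k : K, algebraMap K L k ∈ V := fun k => by
    have := hV (algebraMap K A k)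
    rwa [← IsScalarTower.algebraMap_apply] at this
  letI : Algebra K V := ((algebraMap K L).codRestrict V.toSubring hKV).toAlgebra
  have hst : IsScalarTower K V L := IsScalarTower.of_algebraMap_eq fun k => rfl
  let u : Fin r → V := fun i => ⟨algebraMap P L (e' i), hV ⟨e' i, he i⟩⟩
  let ti : V := ⟨τ⁻¹, hτi⟩
  have h1 : aeval (fun i => algebraMap K V (β i) + ti * u i) F = 0 := by
    have hinj : Function.Injective (algebraMap V L) := Subtype.val_injective
    apply hinj
    rw [map_zero, ← aeval_algebraMap_apply]
    have h2 := congrArg (algebraMap P L) h0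
    rw [map_zero, ← aeval_algebraMap_apply] at h2
    have h3 := aeval_scale hF τ⁻¹ (fun i => algebraMap P L (e' i + algebraMap K P (β i) * t))
    rw [Function.comp_def] at h2
    rw [h2, mul_zero] at h3
    rw [← h3]
    congr 2
    funext i
    rw [Function.comp_apply, map_add, map_add, map_mul, map_mul, ← IsScalarTower.algebraMap_apply, ← IsScalarTower.algebraMap_apply, mul_add, ← hτ,
      mul_comm (algebraMap K L _), ← mul_assoc, inv_mul_cancel₀ hτ0, one_mul, add_comm]
    rfl
  have h2 := congrArg (Ideal.Quotient.mkₐ K (Ideal.span {ti})) h1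
  rw [map_zero, ← AlgHom.comp_apply, comp_aeval] at h2
  have h3 : (fun i => Ideal.Quotient.mkₐ K (Ideal.span {ti}) (algebraMap K V (β i) + ti * u i)) = fun i => algebraMap K _ (β i) := by
    funext i
    rw [map_add, AlgHom.commutes]
    have : Ideal.Quotient.mkₐ K (Ideal.span {ti}) (ti * u i) = 0 := 
      Ideal.Quotient.eq_zero_iff_mem.2 (Ideal.mul_mem_right _ _ (Ideal.mem_span_singleton_self _))
    rw [this, add_zero]
  rw [h3] at h2
  have h4 : aeval (fun i => algebraMap K (V ⧸ Ideal.span {ti}) (β i)) F = algebraMap K _ (eval β F) := by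
    rw [← ae, ← aeval_algebraMap_apply]; rfl
  rw [h4, ← AlgHom.commutes (Ideal.Quotient.mkₐ K (Ideal.span {ti}))] at h2
  have h5 := Ideal.mem_span_singleton.1 (Ideal.Quotient.eq_zero_iff_mem.1 h2)
  obtain ⟨v, hv⟩ := h5
  have h6 := congrArg (algebraMap V L) hv
  rw [← IsScalarTower.algebraMap_apply, map_mul] at h6
  have h7 : τ = algebraMap K L (eval β F)⁻¹ * v.1 := by
    have h8 : algebraMap K L (eval β F) ≠ 0 := by simpa using hβ
    rw [map_inv₀, h6]
    have : algebraMap V L ti = τ⁻¹ := rfl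
    have h9 : algebraMap V L v = v.1 := rfl
    rw [this, h9] at h6 ⊢
    have hv0 : v.1 ≠ 0 := by intro h; rw [h, mul_zero] at h6; exact h8 h6
    rw [mul_inv, inv_inv, mul_assoc, inv_mul_cancel₀ hv0, mul_one]
  rw [h7]
  exact mul_mem (hKV _) v.2

lemma noether {σ : Type} [Infinite K] {D : ℕ} (hD : 0 < D) (T : Set (MvPolynomial σ K)) (W : Submodule K (MvPolynomial σ K))
    (hW : ∀ w ∈ W, w.IsHomogeneous D) : ∀ (r : ℕ) (e : Fin r → MvPolynomial σ K), (∀ i, e i ∈ W) →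
    (∀ f ∈ T, IsIntegral (Algebra.adjoin K (Set.range e)) f) →
    ∃ (d : ℕ) (y : Fin d → MvPolynomial σ K), (∀ i, y i ∈ W) ∧ AlgebraicIndependent K y ∧ 
      (∀ f ∈ T, IsIntegral (Algebra.adjoin K (Set.range y)) f) := by
  classical
  intro r
  induction r with
  | zero =>
    intro e he h
    exact ⟨0, e, he, algebraicIndependent_empty_type, h⟩
  | succ r ih =>
    intro e he h
    by_cases hind : AlgebraicIndependent K e
    · exact ⟨_, e, he, hind, h⟩
    rw [algebraicIndependent_iff] at hind
    push Not at hind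
    obtain ⟨F, hF, hF0⟩ := hind
    obtain ⟨j, hj⟩ : ∃ j, homogeneousComponent j F ≠ 0 := by
      by_contra hcon
      push Not at hcon
      apply hF0
      rw [← sum_homogeneousComponent F]
      exact Finset.sum_eq_zero fun i _ => hcon i
    set G := homogeneousComponent j F with hG
    have hGh : G.IsHomogeneous j := homogeneousComponent_isHomogeneous _ _
    have hG0 : aeval e G = 0 := by
      have h1 := congrArg (homogeneousComponent (D * j)) hF
      rw [map_zero, ← sum_homogeneousComponent F, map_sum, map_sum] at h1
      by_cases hjr : j ∈ Finset.range (F.totalDegree + 1)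
      · rw [Finset.sum_eq_single_of_mem j hjr] at h1
        · rwa [homogeneousComponent_of_mem ((homogeneousComponent_isHomogeneous _ _).aeval _ fun i => hW _ (he i)), if_pos rfl] at h1
        · intro i _ hij
          rw [homogeneousComponent_of_mem ((homogeneousComponent_isHomogeneous _ _).aeval _ fun i => hW _ (he i)), if_neg]
          intro h2
          exact hij (Nat.eq_of_mul_eq_mul_left hD h2).symm
      · rw [hG, homogeneousComponent_eq_zero _ _ (by simpa using hjr), map_zero]
    obtain ⟨α, hα⟩ : ∃ α, eval α (G * X (Fin.last r)) ≠ 0 := by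
      by_contra hcon
      push Not at hcon
      exact mul_ne_zero hj (X_ne_zero _) (MvPolynomial.funext fun x => by rw [hcon x, map_zero])
    rw [map_mul, eval_X] at hα
    have hα1 := left_ne_zero_of_mul hα
    have hα2 := right_ne_zero_of_mul hα
    set β : Fin (r + 1) → K := fun i => (α (Fin.last r))⁻¹ * α i with hβ
    have hGβ : eval β G ≠ 0 := by
      have := aeval_scale hGh (α (Fin.last r))⁻¹ α
      rw [ae, ae] at this
      rw [hβ, this]
      exact mul_ne_zero (pow_ne_zero _ (inv_ne_zero hα2)) hα1
    let e' : Fin r → MvPolynomial σ K := fun i => e i.castSucc - β i.castSucc • e (Fin.last r)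
    have hlast : IsIntegral (Algebra.adjoin K (Set.range e')) (e (Fin.last r)) := by
      refine noeth_int G hGh β hGβ (fun i => e i - β i • e (Fin.last r)) _ ?_ _ ?_
      · rw [← hG0]
        congr 2
        funext i
        rw [Algebra.smul_def]; ring
      · intro i
        refine Fin.lastCases ?_ (fun i => Algebra.subset_adjoin ⟨i, rfl⟩) i
        have : β (Fin.last r) = 1 := inv_mul_cancel₀ hα2
        rw [this, one_smul, sub_self]; exact zero_mem _
    refine ih e' (fun i => sub_mem (he _) (Submodule.smul_mem _ _ (he _))) fun f hf => ?_
    refine int_gen ?_ (h f hf)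
    rintro _ ⟨i, rfl⟩
    refine Fin.lastCases hlast (fun i => ?_) i
    have h1 : e i.castSucc = e' i + β i.castSucc • e (Fin.last r) := by simp [e']
    rw [h1]
    refine IsIntegral.add ?_ ?_
    · exact isIntegral_algebraMap (R := Algebra.adjoin K (Set.range e')) (x := ⟨_, Algebra.subset_adjoin ⟨i, rfl⟩⟩)
    · rw [Algebra.smul_def]
      refine IsIntegral.mul ?_ hlast
      exact isIntegral_algebraMap (R := Algebra.adjoin K (Set.range e')) (x := algebraMap K _ _)

theorem hsop [IsAlgClosed K] {n m : ℕ} (hn : 0 < n) : ∃ (d D : ℕ) (y : Fin d → MvPolynomial (MV n m) K), 0 < D ∧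
    (∀ i, y i ∈ matrixInvariants K n m) ∧ (∀ i, (y i).IsHomogeneous D) ∧ AlgebraicIndependent K y ∧
    ∀ f ∈ matrixInvariants K n m, IsIntegral (Algebra.adjoin K (Set.range y)) f := by
  have : Infinite K := IsAlgClosed.instInfinite
  obtain ⟨r, D, e, hD, he, hi⟩ := int_same_deg (K := K) (n := n) (m := m) hn
  obtain ⟨d, y, h1, h2, h3⟩ := noether hD (matrixInvariants K n m : Set _) 
    ((Subalgebra.toSubmodule (matrixInvariants K n m)) ⊓ homogeneousSubmodule _ _ D) (fun w hw => hw.2) r e he hi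
  exact ⟨d, D, y, hD, fun i => (h1 i).1, fun i => (h1 i).2, h2, h3⟩
end noeth
end CMProof


namespace CMProof
section spread

lemma cert {K : Type*} [Field K] {E U : Type*} [Fintype U] (T : E → U → K) (v : E → K)
    (h : ¬ ∃ x : U → K, ∀ e, ∑ u, x u * T e u = v e) :
    ∃ l : E →₀ K, (∀ u, (l.sum fun e r => r * T e u) = 0) ∧ (l.sum fun e r => r * v e) = 1 := by
  classical
  let row : E → (U → K) × K := fun e => (T e, v e)
  have key : ((0, 1) : (U → K) × K) ∈ Submodule.span K (Set.range row) := by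
    by_contra hn
    obtain ⟨φ, hφ, hk⟩ := Submodule.exists_le_ker_of_notMem hn
    refine h ⟨fun u => - φ (Pi.single u 1, 0) / φ (0, 1), fun e => ?_⟩
    have h1 : φ (row e) = 0 := hk (Submodule.subset_span ⟨e, rfl⟩)
    have h2 : row e = ∑ u, T e u • ((Pi.single u 1, 0) : (U → K) × K) + v e • (0, 1) := by
      refine Prod.ext ?_ ?_
      · simp only [row, Prod.fst_add, Prod.fst_sum, Prod.smul_fst, smul_zero, add_zero]
        exact pi_eq_sum_univ' (T e)
      · simp [row, Prod.snd_sum]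
    rw [h2, map_add, map_sum, map_smul] at h1
    simp only [map_smul, smul_eq_mul] at h1
    have h3 : ∑ u, - φ (Pi.single u 1, 0) / φ (0, 1) * T e u = (- ∑ u, T e u * φ (Pi.single u 1, 0)) / φ (0, 1) := by
      rw [← Finset.sum_neg_distrib, Finset.sum_div]
      exact Finset.sum_congr rfl fun u _ => by ring
    rw [h3, div_eq_iff hφ]
    linear_combination -h1
  obtain ⟨l, hl⟩ := Finsupp.mem_span_range_iff_exists_finsupp.1 key
  refine ⟨l, fun u => ?_, ?_⟩
  · have := congrFun (congrArg Prod.fst hl) u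
    simpa [Finsupp.sum, Prod.fst_sum, row] using this
  · have := congrArg Prod.snd hl
    simpa [Finsupp.sum, Prod.snd_sum, row] using this

lemma jac_int : IsJacobsonRing ℤ := by
  rw [isJacobsonRing_iff_sInf_maximal']
  intro I hI
  by_cases h : I = ⊥
  · refine ⟨{J | J.IsMaximal}, fun J hJ => hJ.1.2, ?_⟩
    subst h
    refine le_antisymm bot_le fun x hx => ?_
    obtain ⟨p, hp, hpp⟩ := Nat.exists_infinite_primes (x.natAbs + 1)
    have hpi : Prime (p : ℤ) := Nat.prime_iff_prime_int.1 hpp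
    have hx2 := (Submodule.mem_sInf.1 hx) (Ideal.span {(p : ℤ)}) (((Ideal.span_singleton_prime hpi.ne_zero).2 hpi).isMaximal
      (by simpa using hpp.ne_zero))
    rw [Ideal.mem_span_singleton] at hx2
    have := Int.eq_zero_of_abs_lt_dvd hx2 (by rw [Int.abs_eq_natAbs]; omega)
    simpa using this
  · exact ⟨{I}, by rintro J rfl; exact (hI.isMaximal h).1.2, by simp⟩

lemma exists_theta {K : Type} [Field K] (E : Set K) (hE : E.Finite) :
    ∃ (p : ℕ) (_ : Fact p.Prime) (k : Type) (_ : Field k) (_ : CharP k p) (_ : IsAlgClosed k),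
      Nonempty (Algebra.adjoin ℤ E →+* k) := by
  have hft : Algebra.FiniteType ℤ (Algebra.adjoin ℤ E) := by
    rw [← Subalgebra.fg_iff_finiteType]
    have := Subalgebra.fg_adjoin_finset (R := ℤ) hE.toFinset
    simpa using this
  obtain ⟨M, hM⟩ := Ideal.exists_maximal (Algebra.adjoin ℤ E)
  let F := (Algebra.adjoin ℤ E) ⧸ M
  let : Field F := Ideal.Quotient.field M
  have hf2 : Algebra.FiniteType ℤ F := Algebra.FiniteType.trans hft inferInstance
  have := jac_int
  have hfin : Module.Finite ℤ F := finite_of_finite_type_of_isJacobsonRing ℤ F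
  obtain ⟨p, hp⟩ := CharP.exists F
  have hp0 : p ≠ 0 := by
    rintro rfl
    have : CharZero F := CharP.charP_to_charZero F
    have hint : Algebra.IsIntegral ℤ F := inferInstance
    have := isField_of_isIntegral_of_isField (R := ℤ) (S := F) (algebraMap ℤ F).injective_int (Field.toIsField F)
    exact Int.not_isField this
  have hpp : Fact p.Prime := ⟨(CharP.char_is_prime_or_zero F p).resolve_right hp0⟩
  have : CharP (AlgebraicClosure F) p := charP_of_injective_algebraMap (algebraMap F _).injective p
  exact ⟨p, hpp, AlgebraicClosure F, inferInstance, this, inferInstance, ⟨(algebraMap F _).comp (Ideal.Quotient.mk M)⟩⟩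

lemma sum_pow_q {B : Type*} [CommRing B] {p : ℕ} (hp : p.Prime) (e : ℕ) {ι : Type*} (s : Finset ι) (x : ι → B) :
    ∃ r, (∑ i ∈ s, x i) ^ p ^ e = ∑ i ∈ s, x i ^ p ^ e + p * r := by
  classical
  induction s using Finset.induction_on with
  | empty => exact ⟨0, by simp [hp.ne_zero]⟩
  | insert i s hi ih =>
    obtain ⟨r, hr⟩ := ih
    obtain ⟨r', hr'⟩ := exists_add_pow_prime_pow_eq hp (x i) (∑ i ∈ s, x i) e
    exact ⟨r + x i * (∑ i ∈ s, x i) * r', by rw [Finset.sum_insert hi, Finset.sum_insert hi, hr', hr]; ring⟩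

lemma CC {R B : Type*} [CommRing R] [CommRing B] {d : ℕ} [Algebra (MvPolynomial (Fin d) R) B] {ι : Type*} [Fintype ι]
    {f : ι → B} (hf : LinearIndependent (MvPolynomial (Fin d) R) f) (c : MvPolynomial (Fin d) R)
    (M : Subalgebra (MvPolynomial (Fin d) R) B)
    (hM : ∀ x ∈ M, c • x ∈ Submodule.span (MvPolynomial (Fin d) R) (Set.range f)) {a : B} {b : Fin d → B}
    (ha : a ∈ M) (hb : ∀ i, b i ∈ M) (k : Fin d) (I : Finset (Fin d))
    (hab : (X k : MvPolynomial (Fin d) R) • a = ∑ i ∈ I, (X i : MvPolynomial (Fin d) R) • b i) {p : ℕ} (hp : p.Prime) (e : ℕ) :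
    ∃ (α : ι → MvPolynomial (Fin d) R), c • a ^ p ^ e = ∑ j, α j • f j ∧
      ∀ j, ∃ (β : Fin d → MvPolynomial (Fin d) R) (γ : MvPolynomial (Fin d) R), α j * X k ^ p ^ e = ∑ i ∈ I, β i * X i ^ p ^ e + (p : MvPolynomial (Fin d) R) * γ := by
  obtain ⟨r, hr⟩ := sum_pow_q (B := M) hp e I (fun i => (X i : MvPolynomial (Fin d) R) • ⟨b i, hb i⟩)
  have h0 := congrArg (Subtype.val : M → B) hr
  have hr' : ((X k : MvPolynomial (Fin d) R) • a) ^ p ^ e =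
      ∑ i ∈ I, ((X i : MvPolynomial (Fin d) R) • b i) ^ p ^ e + p * r.1 := by
    rw [hab]; simpa using h0
  have hx : ∀ x ∈ M, ∃ α : ι → MvPolynomial (Fin d) R, ∑ j, α j • f j = c • x := fun x hx =>
    (Submodule.mem_span_range_iff_exists_fun _).1 (hM x hx)
  obtain ⟨α, hα⟩ := hx _ (pow_mem ha (p ^ e))
  choose β hβ using fun i => hx _ (pow_mem (hb i) (p ^ e))
  obtain ⟨γ, hγ⟩ := hx _ r.2
  refine ⟨α, hα.symm, fun j => ⟨fun i => β i j, γ j, ?_⟩⟩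
  have h1 : ∑ j, (α j * X k ^ p ^ e - (∑ i ∈ I, β i j * X i ^ p ^ e + (p : MvPolynomial (Fin d) R) * γ j)) • f j = 0 := by
    have h2 : ∀ j, (α j * X k ^ p ^ e - (∑ i ∈ I, β i j * X i ^ p ^ e + (p : MvPolynomial (Fin d) R) * γ j)) • f j =
      (X k : MvPolynomial (Fin d) R) ^ p ^ e • (α j • f j) - (∑ i ∈ I, (X i : MvPolynomial (Fin d) R) ^ p ^ e • (β i j • f j) + (p : MvPolynomial (Fin d) R) • (γ j • f j)) := by
      intro j
      rw [sub_smul, add_smul, Finset.sum_smul]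
      simp only [smul_smul, mul_comm (X _ ^ _ : MvPolynomial (Fin d) R)]
    simp only [h2, Finset.sum_sub_distrib, Finset.sum_add_distrib]
    rw [Finset.sum_comm]
    simp only [← Finset.smul_sum, hα, hβ, hγ]
    rw [sub_eq_zero]
    calc _ = c • ((X k : MvPolynomial (Fin d) R) • a) ^ p ^ e := by rw [smul_pow, smul_comm]
      _ = _ := by
        rw [hr', smul_add, Finset.smul_sum]
        congr 1
        · exact Finset.sum_congr rfl fun i _ => by rw [smul_pow, smul_comm]
        · rw [smul_comm]; congr 1
          rw [Algebra.smul_def, map_natCast]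
  exact sub_eq_zero.1 (Fintype.linearIndependent_iff.1 hf _ h1 j)

lemma mono_colon {k : Type*} [CommRing k] {d q : ℕ} (a : Fin d) (I : Finset (Fin d)) (ha : a ∉ I) (α : MvPolynomial (Fin d) k)
    (β : Fin d → MvPolynomial (Fin d) k) (h : α * X a ^ q = ∑ i ∈ I, β i * X i ^ q) :
    ∃ g : I → MvPolynomial (Fin d) k, α = ∑ i, X i.1 ^ q * g i := by
  classical
  let s : Set (Fin d →₀ ℕ) := (fun i => Finsupp.single i q) '' (I : Set (Fin d))
  have hs : Ideal.span ((fun s => monomial s (1 : k)) '' s) = Ideal.span (Set.range fun i : I => (X i.1 : MvPolynomial (Fin d) k) ^ q) := by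
    congr 1
    ext x
    simp [s, X_pow_eq_monomial]
  have h1 : α * X a ^ q ∈ Ideal.span ((fun s => monomial s (1 : k)) '' s) := by
    rw [hs, h]
    exact Ideal.sum_mem _ fun i hi => Ideal.mul_mem_left _ _ (Ideal.subset_span ⟨⟨i, hi⟩, rfl⟩)
  have h2 : α ∈ Ideal.span ((fun s => monomial s (1 : k)) '' s) := by
    rw [mem_ideal_span_monomial_image] at h1 ⊢
    intro xi hxi
    obtain ⟨si, ⟨i, hi, rfl⟩, hle⟩ := h1 (xi + Finsupp.single a q) (by
      rw [mem_support_iff, X_pow_eq_monomial, coeff_mul_monomial]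
      simpa using hxi)
    refine ⟨_, ⟨i, hi, rfl⟩, ?_⟩
    have hia : i ≠ a := by rintro rfl; exact ha hi
    rw [Finsupp.single_le_iff] at hle ⊢
    simpa [Finsupp.single_eq_of_ne hia] using hle
  rw [hs, Ideal.mem_span_range_iff_exists_fun] at h2
  obtain ⟨g, hg⟩ := h2
  exact ⟨g, by rw [← hg]; exact Finset.sum_congr rfl fun i _ => mul_comm _ _⟩

end spread
end CMProof


namespace CMProof
section cert
variable {n m : ℕ} {I : Type} [Fintype I]

def Sol (F : Type*) [CommRing F] (y : I → MvPolynomial (MV n m) F) (a : MvPolynomial (MV n m) F) (e : ℕ) : Prop :=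
  ∃ s : I → MvPolynomial (MV n m) F, (∀ i, (s i).IsHomogeneous e) ∧ (∀ i, Lam n m F (s i) = 0) ∧ a = ∑ i, y i * s i

abbrev CE (n m : ℕ) (I : Type) := (MV n m →₀ ℕ) ⊕ (I × (((Fin n × Fin n) ⊕ MV n m) →₀ ℕ))

noncomputable def LTm (F : Type*) [CommRing F] (y : I → MvPolynomial (MV n m) F) (s : I → MvPolynomial (MV n m) F) (x : CE n m I) : F :=
  Sum.elim (fun ρ => coeff ρ (∑ i, y i * s i)) (fun j => coeff j.2 (Lam n m F (s j.1))) x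

noncomputable def VV (I : Type) {F : Type*} [CommRing F] (a : MvPolynomial (MV n m) F) (x : CE n m I) : F :=
  Sum.elim (fun ρ => coeff ρ a) 0 x

open Classical in
noncomputable def sgm (F : Type*) [CommRing F] (i : I) (μ : MV n m →₀ ℕ) : I → MvPolynomial (MV n m) F := fun j => if i = j then monomial μ 1 else 0

def Cert (F : Type*) [CommRing F] (y : I → MvPolynomial (MV n m) F) (a : MvPolynomial (MV n m) F) (e : ℕ)
    (E : Finset (CE n m I)) (l : CE n m I → F) : Prop :=
  (∀ i μ, μ.degree = e → ∑ x ∈ E, l x * LTm F y (sgm F i μ) x = 0) ∧ ∑ x ∈ E, l x * VV I a x = 1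

lemma LTm_sum {F : Type*} [CommRing F] (y : I → MvPolynomial (MV n m) F) {U : Type*} [Fintype U] (c : U → F) (s : U → I → MvPolynomial (MV n m) F) (x : CE n m I) :
    LTm F y (fun i => ∑ u, c u • s u i) x = ∑ u, c u * LTm F y (s u) x := by
  rcases x with ρ | ⟨j, ν⟩
  · simp only [LTm, Sum.elim_inl, Finset.mul_sum, mul_smul_comm]
    rw [Finset.sum_comm]
    simp only [coeff_sum, coeff_smul, smul_eq_mul, Finset.mul_sum]
  · simp [LTm, coeff_sum]

lemma LTm_map {F G : Type*} [CommRing F] [CommRing G] (θ : F →+* G) (y : I → MvPolynomial (MV n m) F) (i : I) (μ : MV n m →₀ ℕ) (x : CE n m I) :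
    LTm G (fun i => map θ (y i)) (sgm G i μ) x = θ (LTm F y (sgm F i μ) x) := by
  have h : ∀ j, sgm G i μ j = map θ (sgm F i μ j) := by
    intro j; unfold sgm; split_ifs <;> simp
  rcases x with ρ | ⟨j, ν⟩
  · simp only [LTm, Sum.elim_inl, h, ← map_mul, ← map_sum, MvPolynomial.coeff_map]
  · simp only [LTm, Sum.elim_inr, h, Lam_map, MvPolynomial.coeff_map]

lemma VV_map {F G : Type*} [CommRing F] [CommRing G] (θ : F →+* G) (a : MvPolynomial (MV n m) F) (x : CE n m I) :
    VV I (map θ a) x = θ (VV I a x) := by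
  rcases x with ρ | ⟨j, ν⟩ <;> simp [VV, MvPolynomial.coeff_map]

lemma Cert.map {F G : Type*} [CommRing F] [CommRing G] (θ : F →+* G) {y : I → MvPolynomial (MV n m) F} {a : MvPolynomial (MV n m) F} {e : ℕ}
    {E : Finset (CE n m I)} {l : CE n m I → F} (h : Cert F y a e E l) :
    Cert G (fun i => MvPolynomial.map θ (y i)) (MvPolynomial.map θ a) e E (fun x => θ (l x)) := by
  refine ⟨fun i μ hμ => ?_, ?_⟩
  · simp only [LTm_map, ← map_mul, ← map_sum, h.1 i μ hμ, map_zero]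
  · simp only [VV_map, ← map_mul, ← map_sum, h.2, map_one]

lemma Cert.of_map {F G : Type*} [CommRing F] [CommRing G] (θ : F →+* G) (hθ : Function.Injective θ) {y : I → MvPolynomial (MV n m) F} {a : MvPolynomial (MV n m) F} {e : ℕ}
    {E : Finset (CE n m I)} {l : CE n m I → F}
    (h : Cert G (fun i => MvPolynomial.map θ (y i)) (MvPolynomial.map θ a) e E (fun x => θ (l x))) : Cert F y a e E l := by
  obtain ⟨h1, h2⟩ := h
  refine ⟨fun i μ hμ => hθ ?_, hθ ?_⟩
  · simpa only [LTm_map, ← map_mul, ← map_sum, map_zero] using h1 i μ hμ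
  · simpa only [VV_map, ← map_mul, ← map_sum, map_one] using h2

/-- homogeneous polynomials of degree `e` as combinations of monomials -/
lemma hom_expand {F : Type*} [CommRing F] {e : ℕ} {s : I → MvPolynomial (MV n m) F} (hs : ∀ i, (s i).IsHomogeneous e) (i : I) :
    s i = ∑ u : I × (Finset.univ : Finset (MV n m)).finsuppAntidiag e, coeff u.2.1 (s u.1) • sgm F u.1 u.2.1 i := by
  classical
  rw [Fintype.sum_prod_type, Finset.sum_eq_single i]
  · simp only [sgm, if_pos]
    ext μ
    simp only [coeff_sum, coeff_smul, coeff_monomial, smul_eq_mul]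
    by_cases hμ : μ ∈ (Finset.univ : Finset (MV n m)).finsuppAntidiag e
    · rw [Finset.sum_eq_single ⟨μ, hμ⟩]
      · simp
      · intro b _ hb
        rw [if_neg (fun h => hb (Subtype.ext h)), mul_zero]
      · simp
    · rw [Finset.sum_eq_zero]
      · by_contra h
        refine hμ ?_
        have := hs i h
        rw [Finset.mem_finsuppAntidiag]
        refine ⟨?_, by simp⟩
        rw [← this]
        simp [Finsupp.weight_apply, Finsupp.sum_fintype]
      · rintro ⟨ν, hν⟩ _
        rw [if_neg (fun h : ν = μ => hμ (h ▸ hν)), mul_zero]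
  · intro j _ hj
    exact Finset.sum_eq_zero fun u _ => by simp [sgm, hj]
  · simp

lemma deg_of_mem {e : ℕ} {μ : MV n m →₀ ℕ} (h : μ ∈ (Finset.univ : Finset (MV n m)).finsuppAntidiag e) : μ.degree = e := by
  rw [Finset.mem_finsuppAntidiag] at h
  rw [← h.1, Finsupp.degree_eq_sum]

lemma Cert.not_sol {F : Type*} [CommRing F] [Nontrivial F] {y : I → MvPolynomial (MV n m) F} {a : MvPolynomial (MV n m) F} {e : ℕ}
    {E : Finset (CE n m I)} {l : CE n m I → F} (h : Cert F y a e E l) : ¬ Sol F y a e := by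
  rintro ⟨s, hs, hL, ha⟩
  have h1 : ∀ x, VV I a x = LTm F y s x := by
    rintro (ρ | ⟨j, ν⟩)
    · simp [VV, LTm, ha]
    · simp [VV, LTm, hL]
  have h2 := h.2
  simp only [h1] at h2
  rw [funext fun i => hom_expand hs i] at h2
  simp only [LTm_sum, Finset.mul_sum] at h2
  rw [Finset.sum_comm, Finset.sum_eq_zero] at h2
  · exact zero_ne_one h2
  · rintro u _
    have := h.1 u.1 u.2.1 (deg_of_mem u.2.2)
    rw [← mul_zero (coeff u.2.1 (s u.1)), ← this, Finset.mul_sum]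
    exact Finset.sum_congr rfl fun x _ => by ring

lemma cert_exists {K : Type*} [Field K] {y : I → MvPolynomial (MV n m) K} {a : MvPolynomial (MV n m) K} {e : ℕ}
    (h : ¬ Sol K y a e) : ∃ E l, Cert K y a e E l := by
  classical
  obtain ⟨l, h1, h2⟩ := cert (U := I × (Finset.univ : Finset (MV n m)).finsuppAntidiag e)
    (fun x u => LTm K y (sgm K u.1 u.2.1) x) (VV I a) (by
    rintro ⟨c, hc⟩
    refine h ⟨fun i => ∑ u, c u • sgm K u.1 u.2.1 i, fun i => ?_, fun i => ?_, ?_⟩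
    · refine IsHomogeneous.sum _ _ _ fun u _ => ?_
      rw [smul_eq_C_mul]
      have h0 : (sgm K u.1 u.2.1 i).IsHomogeneous e := ?_
      · simpa using (isHomogeneous_C _ (c u)).mul h0
      unfold sgm
      split_ifs
      · exact isHomogeneous_monomial _ (deg_of_mem u.2.2)
      · exact isHomogeneous_zero _ _ _
    · ext ν
      have := hc (Sum.inr (i, ν))
      rw [← LTm_sum] at this
      simpa [LTm, VV] using this
    · ext ρ
      have := hc (Sum.inl ρ)
      rw [← LTm_sum] at this
      simpa [LTm, VV] using this.symm)
  refine ⟨l.support, l, fun i μ hμ => ?_, h2⟩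
  refine h1 (i, ⟨μ, ?_⟩)
  rw [Finset.mem_finsuppAntidiag]
  exact ⟨by rw [← hμ, Finsupp.degree_eq_sum], by simp⟩
end cert
end CMProof


namespace CMProof
section spread2

lemma aeval_map_theta {F G σ τ : Type*} [CommRing F] [CommRing G] (θ : F →+* G) (y : σ → MvPolynomial τ F) (x : MvPolynomial σ F) :
    aeval (fun i => map θ (y i)) (map θ x) = map θ (aeval y x) := by
  induction x using MvPolynomial.induction_on with
  | C a => simp [algebraMap_eq]
  | add p q hp hq => simp only [map_add, hp, hq]
  | mul_X p i hp => simp only [map_mul, hp, MvPolynomial.map_X, aeval_X]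

lemma lift_fam {K : Type*} [Field K] {ι σ : Type*} [Finite ι] (x : ι → MvPolynomial σ K) : ∃ T : Set K, T.Finite ∧
    ∀ R : Subalgebra ℤ K, T ⊆ R → ∃ x' : ι → MvPolynomial σ R, ∀ i, map (algebraMap R K) (x' i) = x i := by
  refine ⟨⋃ i, ((x i).coeffs : Set K), Set.finite_iUnion fun i => Finset.finite_toSet _, fun R hR => ?_⟩
  have : ∀ i, x i ∈ Set.range (map (algebraMap R K)) := fun i => by
    rw [MvPolynomial.mem_range_map_iff_coeffs_subset]
    intro c hc
    exact ⟨⟨c, hR (Set.mem_iUnion.2 ⟨i, hc⟩)⟩, rfl⟩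
  choose x' hx' using this
  exact ⟨x', hx'⟩

lemma CC2 {R σ : Type*} [CommRing R] {d : ℕ} (y : Fin d → MvPolynomial σ R) {ι : Type*} [Fintype ι] (g : ι → MvPolynomial σ R)
    (J : Finset ι) (hind : ∀ α : J → MvPolynomial (Fin d) R, ∑ j, aeval y (α j) * g j.1 = 0 → ∀ j, α j = 0)
    (s : ι → ι → ι → MvPolynomial (Fin d) R) (hs : ∀ i j, g i * g j = ∑ l, aeval y (s i j l) * g l)
    (i1 : ι) (h1 : g i1 = 1) (c : MvPolynomial (Fin d) R) (t : ι → J → MvPolynomial (Fin d) R)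
    (ht : ∀ l, aeval y c * g l = ∑ j, aeval y (t l j) * g j.1) (ia : ι) (ib : Fin d → ι) (k : Fin d) (I : Finset (Fin d))
    (hab : y k * g ia = ∑ i ∈ I, y i * g (ib i)) {p : ℕ} (hp : p.Prime) (e : ℕ) :
    ∃ (α : J → MvPolynomial (Fin d) R), aeval y c * g ia ^ p ^ e = ∑ j, aeval y (α j) * g j.1 ∧
      ∀ j, ∃ (β : Fin d → MvPolynomial (Fin d) R) (γ : MvPolynomial (Fin d) R),
        α j * X k ^ p ^ e = ∑ i ∈ I, β i * X i ^ p ^ e + (p : MvPolynomial (Fin d) R) * γ := by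
  letI : Algebra (MvPolynomial (Fin d) R) (MvPolynomial σ R) := (aeval (R := R) y).toRingHom.toAlgebra
  have hsm : ∀ (r : MvPolynomial (Fin d) R) (x : MvPolynomial σ R), r • x = aeval y r * x := fun r x => rfl
  let N : Submodule (MvPolynomial (Fin d) R) (MvPolynomial σ R) := Submodule.span _ (Set.range g)
  have hN : ∀ i, g i ∈ N := fun i => Submodule.subset_span ⟨i, rfl⟩
  have hmul : ∀ x z, x ∈ N → z ∈ N → x * z ∈ N := by
    intro x z hx hz
    have hle : N * N ≤ N := by
      rw [Submodule.span_mul_span, Submodule.span_le]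
      rintro _ ⟨_, ⟨i, rfl⟩, _, ⟨j, rfl⟩, rfl⟩
      simp only [hs]
      exact Submodule.sum_mem _ fun l _ => Submodule.smul_mem N (s i j l) (hN l)
    exact hle (Submodule.mul_mem_mul hx hz)
  let M : Subalgebra (MvPolynomial (Fin d) R) (MvPolynomial σ R) := N.toSubalgebra (h1 ▸ hN i1) hmul
  have hMN : ∀ x, x ∈ M ↔ x ∈ N := fun x => Iff.rfl
  obtain ⟨α, h2, h3⟩ := CC (f := fun j : J => g j.1) (Fintype.linearIndependent_iff.2 fun α hα => hind α hα) c M (by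
    intro x hx
    rw [hMN] at hx
    induction hx using Submodule.span_induction with
    | mem x hx =>
      obtain ⟨l, rfl⟩ := hx
      rw [hsm, ht]
      exact Submodule.sum_mem _ fun j _ => Submodule.smul_mem _ (t l j) (Submodule.subset_span ⟨j, rfl⟩)
    | zero => simp
    | add x z _ _ h h' => rw [smul_add]; exact add_mem h h'
    | smul r x _ h => rw [smul_comm]; exact Submodule.smul_mem _ _ h) (hN ia) (fun i => hN (ib i)) k I
      (by simpa only [hsm, aeval_X] using hab) hp e
  exact ⟨α, h2, h3⟩

theorem spreadS {K : Type} [Field K] [IsAlgClosed K] {n m d D da : ℕ} (hm : 0 < m) (y : Fin d → MvPolynomial (MV n m) K) (hyS : ∀ i, y i ∈ matrixInvariants K n m)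
    (hyD : ∀ i, (y i).IsHomogeneous D) {ι : Type} [Fintype ι] (g : ι → MvPolynomial (MV n m) K) (hgS : ∀ i, g i ∈ matrixInvariants K n m)
    (J : Finset ι) (hind : ∀ α : J → MvPolynomial (Fin d) K, ∑ j, aeval y (α j) * g j.1 = 0 → ∀ j, α j = 0)
    (s : ι → ι → ι → MvPolynomial (Fin d) K) (hs : ∀ i j, g i * g j = ∑ l, aeval y (s i j l) * g l)
    (i1 : ι) (h1 : g i1 = 1) (c : MvPolynomial (Fin d) K) (hc0 : aeval y c ≠ 0) (t : ι → J → MvPolynomial (Fin d) K)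
    (ht : ∀ l, aeval y c * g l = ∑ j, aeval y (t l j) * g j.1) (ia : ι) (ib : Fin d → ι) (k : Fin d) (I : Finset (Fin d)) (hkI : k ∉ I)
    (hab : y k * g ia = ∑ i ∈ I, y i * g (ib i)) (had : (g ia).IsHomogeneous da) :
    Sol K (fun i : I => y i) (g ia) (da - D) := by
  classical
  by_contra hns
  obtain ⟨E, l, hcert⟩ := cert_exists hns
  obtain ⟨ρ0, hρ0⟩ := MvPolynomial.ne_zero_iff.1 hc0
  obtain ⟨T1, hT1, L1⟩ := lift_fam y
  obtain ⟨T2, hT2, L2⟩ := lift_fam g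
  obtain ⟨T3, hT3, L3⟩ := lift_fam (fun u : ι × ι × ι => s u.1 u.2.1 u.2.2)
  obtain ⟨T4, hT4, L4⟩ := lift_fam (fun u : ι × J => t u.1 u.2)
  obtain ⟨T5, hT5, L5⟩ := lift_fam (fun _ : Unit => c)
  let T : Set K := T1 ∪ (T2 ∪ (T3 ∪ (T4 ∪ (T5 ∪ (l '' E ∪ {(coeff ρ0 (aeval y c))⁻¹})))))
  have hT : T.Finite := hT1.union (hT2.union (hT3.union (hT4.union (hT5.union ((E.finite_toSet.image l).union (Set.finite_singleton _))))))
  obtain ⟨p, hp, F, _, _, _, ⟨θ⟩⟩ := exists_theta T hT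
  set R := Algebra.adjoin ℤ T with hR
  have hTR : T ⊆ R := Algebra.subset_adjoin
  obtain ⟨yR, hyR⟩ := L1 R (fun x hx => hTR (by simp [T, hx]))
  obtain ⟨gR, hgR⟩ := L2 R (fun x hx => hTR (by simp [T, hx]))
  obtain ⟨sR, hsR⟩ := L3 R (fun x hx => hTR (by simp [T, hx]))
  obtain ⟨tR, htR⟩ := L4 R (fun x hx => hTR (by simp [T, hx]))
  obtain ⟨cR', hcR'⟩ := L5 R (fun x hx => hTR (by simp [T, hx]))
  obtain ⟨cR, hcR⟩ : ∃ cR, map (algebraMap R K) cR = c := ⟨_, hcR' ()⟩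
  have hw : (coeff ρ0 (aeval y c))⁻¹ ∈ R := hTR (by simp [T])
  have hl : ∀ x ∈ E, l x ∈ R := fun x hx => hTR (by
    simp only [T, Set.mem_union]; right; right; right; right; right; left; exact ⟨x, hx, rfl⟩)
  let lR : CE n m I → R := fun x => if h : x ∈ E then ⟨l x, hl x h⟩ else 0
  let φ : R →+* K := algebraMap R K
  have hφ : Function.Injective φ := Subtype.val_injective
  have hinj : ∀ {σ : Type}, Function.Injective (map (σ := σ) φ) := fun {σ} => map_injective φ hφ
  have hyR' : y = fun i => map φ (yR i) := funext fun i => (hyR i).symm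
  have hae : ∀ x : MvPolynomial (Fin d) R, map φ (aeval yR x) = aeval y (map φ x) := fun x => by
    rw [hyR', aeval_map_theta]
  -- relations over R
  have hindR : ∀ α : J → MvPolynomial (Fin d) R, ∑ j, aeval yR (α j) * gR j.1 = 0 → ∀ j, α j = 0 := by
    intro α hα j
    refine hinj ?_
    rw [map_zero]
    refine hind (fun j => map φ (α j)) ?_ j
    have := congrArg (map φ) hα
    simpa only [map_sum, map_mul, hae, φ, hgR, map_zero] using this
  have hsR2 : ∀ i j, gR i * gR j = ∑ u, aeval yR (sR (i, j, u)) * gR u := fun i j => hinj (by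
    simpa only [map_sum, map_mul, hae, φ, hgR, hsR] using hs i j)
  have h1R : gR i1 = 1 := hinj (by simpa only [map_one, φ, hgR] using h1)
  have htR2 : ∀ u, aeval yR cR * gR u = ∑ j, aeval yR (tR (u, j)) * gR j.1 := fun u => hinj (by
    simpa only [map_sum, map_mul, hae, φ, hgR, htR, hcR] using ht u)
  have habR : yR k * gR ia = ∑ i ∈ I, yR i * gR (ib i) := hinj (by
    simpa only [map_sum, map_mul, φ, hgR, hyR] using hab)
  have hLR : ∀ x : MvPolynomial (MV n m) R, map φ x ∈ matrixInvariants K n m → map θ x ∈ matrixInvariants F n m := by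
    have : Infinite K := IsAlgClosed.instInfinite
    have : Infinite F := IsAlgClosed.instInfinite
    intro x hx
    rw [mem_S_iff_Lam, Lam_map] at hx ⊢
    rw [hinj (hx.trans (map_zero _).symm), map_zero]
  have hhom : ∀ (x : MvPolynomial (MV n m) R) (N : ℕ), (map φ x).IsHomogeneous N → (map θ x).IsHomogeneous N := fun x N hx =>
    (IsHomogeneous.of_map (f := φ) hφ hx).map θ
  have hcR0 : map θ (aeval yR cR) ≠ 0 := by
    intro h0
    have h2 := congrArg (coeff ρ0) h0
    rw [MvPolynomial.coeff_map, coeff_zero] at h2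
    have h3 : coeff ρ0 (aeval yR cR) * ⟨_, hw⟩ = 1 := hφ (by
      rw [map_mul, ← MvPolynomial.coeff_map, hae, map_one]
      simp only [φ, hcR]
      exact mul_inv_cancel₀ hρ0)
    have h4 := congrArg θ h3
    rw [map_mul, h2, zero_mul, map_one] at h4
    exact zero_ne_one h4
  have hcertR : Cert R (fun i : I => yR i) (gR ia) (da - D) E lR := by
    refine Cert.of_map φ hφ ?_
    simp only [φ, hyR, hgR]
    refine ⟨fun i μ hμ => ?_, ?_⟩
    · rw [← hcert.1 i μ hμ]
      exact Finset.sum_congr rfl fun x hx => by simp only [lR, dif_pos hx]; rfl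
    · rw [← hcert.2]
      exact Finset.sum_congr rfl fun x hx => by simp only [lR, dif_pos hx]; rfl
  refine (hcertR.map θ).not_sol ?_
  have haS : map θ (gR ia) ∈ matrixInvariants F n m := hLR _ (by simp only [φ, hgR, hgS])
  have hah : (map θ (gR ia)).IsHomogeneous da := hhom _ _ (by simpa only [φ, hgR] using had)
  have hyh : ∀ i, (map θ (yR i)).IsHomogeneous D := fun i => hhom _ _ (by simpa only [φ, hyR] using hyD i)
  have hyS' : ∀ i, map θ (yR i) ∈ matrixInvariants F n m := fun i => hLR _ (by simp only [φ, hyR, hyS])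
  have hgS' : ∀ i, map θ (gR i) ∈ matrixInvariants F n m := fun i => hLR _ (by simp only [φ, hgR, hgS])
  obtain ⟨S, hS1, hS2⟩ := CP (K := F) (n := n) (m := m) p hm (ιd := Fin d) (ιf := J) (ιz := I) (c := map θ (aeval yR cR)) (a := map θ (gR ia))
    (y := fun i => map θ (yR i)) (f := fun j => map θ (gR j.1)) (z := fun i => map θ (yR i.1)) (da := da) (D := D)
    (by
      rw [← aeval_map_theta]
      exact (Algebra.adjoin_le (by rintro _ ⟨i, rfl⟩; exact hyS' i) : Algebra.adjoin F (Set.range fun i => map θ (yR i)) ≤ _)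
        (by rw [Algebra.adjoin_range_eq_range_aeval]; exact ⟨_, rfl⟩)) hcR0 haS hyS' (fun j => hgS' _) (fun i => hyS' _) hah (fun i => hyh _) (by
      intro e
      obtain ⟨α, h2, h3⟩ := CC2 yR gR J hindR (fun i j u => sR (i, j, u)) hsR2 i1 h1R cR (fun u j => tR (u, j)) htR2 ia ib k I habR hp.out e
      have h4 : ∀ j, ∃ G : I → MvPolynomial (Fin d) F, map θ (α j) = ∑ i, X i.1 ^ p ^ e * G i := by
        intro j
        obtain ⟨β, γ, hβ⟩ := h3 j
        refine mono_colon k I hkI _ (fun i => map θ (β i)) ?_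
        have h5 := congrArg (map θ) hβ
        simpa only [map_add, map_mul, map_pow, map_sum, MvPolynomial.map_X, map_natCast, CharP.cast_eq_zero, zero_mul, add_zero] using h5
      choose G hG using h4
      refine ⟨fun i j => G j i, ?_⟩
      have h5 := congrArg (map θ) h2
      rw [map_mul, map_pow, map_sum] at h5
      rw [h5, Finset.sum_comm]
      refine Finset.sum_congr rfl fun j _ => ?_
      rw [map_mul, ← aeval_map_theta, hG, map_sum, Finset.sum_mul]
      refine Finset.sum_congr rfl fun i _ => ?_
      rw [map_mul, map_pow, aeval_X, mul_assoc])
  have hinf : Infinite F := IsAlgClosed.instInfinite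
  have h6 : map θ (gR ia) = ∑ i : I, if D ≤ da then map θ (yR i.1) * homogeneousComponent (da - D) (S i) else 0 := by
    have h7 := congrArg (homogeneousComponent da) hS2
    rw [homogeneousComponent_of_mem hah, if_pos rfl, map_sum] at h7
    rw [h7]
    exact Finset.sum_congr rfl fun i _ => hc_mul (hyh _) _ _
  refine ⟨fun i => if D ≤ da then homogeneousComponent (da - D) (S i) else 0, fun i => ?_, fun i => ?_, ?_⟩
  · dsimp only
    split_ifs
    · exact homogeneousComponent_isHomogeneous _ _
    · exact isHomogeneous_zero _ _ _
  · dsimp only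
    split_ifs
    · exact mem_S_iff_Lam.1 (hc_mem (hS1 i) _)
    · exact map_zero _
  · rw [h6]
    exact Finset.sum_congr rfl fun i _ => by split_ifs <;> simp
end spread2
end CMProof


namespace CMProof
section wreg
variable {K : Type} [Field K] [IsAlgClosed K] {n m d D : ℕ}

theorem wreg_hom {da : ℕ} (hm : 0 < m) (y : Fin d → MvPolynomial (MV n m) K) (hyS : ∀ i, y i ∈ matrixInvariants K n m)
    (hyD : ∀ i, (y i).IsHomogeneous D) (hyI : AlgebraicIndependent K y)
    (hint : ∀ f ∈ matrixInvariants K n m, IsIntegral (Algebra.adjoin K (Set.range y)) f)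
    (k : Fin d) (I : Finset (Fin d)) (hkI : k ∉ I) (a : MvPolynomial (MV n m) K) (ha : a ∈ matrixInvariants K n m) (had : a.IsHomogeneous da)
    (b : Fin d → MvPolynomial (MV n m) K) (hb : ∀ i, b i ∈ matrixInvariants K n m) (hab : y k * a = ∑ i ∈ I, y i * b i) :
    ∃ s : I → MvPolynomial (MV n m) K, (∀ i, s i ∈ matrixInvariants K n m) ∧ a = ∑ i, y i.1 * s i := by
  classical
  have hinf : Infinite K := IsAlgClosed.instInfinite
  letI : Algebra (MvPolynomial (Fin d) K) (MvPolynomial (MV n m) K) := (aeval (R := K) y).toRingHom.toAlgebra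
  have hsm : ∀ (r : MvPolynomial (Fin d) K) (x : MvPolynomial (MV n m) K), r • x = aeval y r * x := fun r x => rfl
  have hintA : ∀ f ∈ matrixInvariants K n m, IsIntegral (MvPolynomial (Fin d) K) f := by
    intro f hf
    refine IsIntegral.map_of_comp_eq (T := MvPolynomial (Fin d) K) (S := MvPolynomial (MV n m) K) (U := MvPolynomial (MV n m) K) hyI.aevalEquiv.symm.toRingEquiv.toRingHom (RingHom.id _) ?_ (hint f hf)
    refine RingHom.ext fun x => ?_
    obtain ⟨z, rfl⟩ := hyI.aevalEquiv.surjective x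
    simp [RingHom.algebraMap_toAlgebra, hyI.algebraMap_aevalEquiv]
  have haeS : ∀ r, aeval y r ∈ matrixInvariants K n m := fun r =>
    (Algebra.adjoin_le (by rintro _ ⟨i, rfl⟩; exact hyS i) : Algebra.adjoin K (Set.range y) ≤ _)
        (by rw [Algebra.adjoin_range_eq_range_aeval]; exact ⟨_, rfl⟩)
  let SA : Subalgebra (MvPolynomial (Fin d) K) (MvPolynomial (MV n m) K) :=
    { (matrixInvariants K n m).toSubsemiring with algebraMap_mem' := haeS }
  let W : Set (MvPolynomial (MV n m) K) := {a} ∪ Set.range b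
  have hWS : W ⊆ matrixInvariants K n m := by
    rintro x (rfl | ⟨i, rfl⟩)
    exacts [ha, hb i]
  let M := Algebra.adjoin (MvPolynomial (Fin d) K) W
  have hMS : M ≤ SA := Algebra.adjoin_le hWS
  have hMfg : (Subalgebra.toSubmodule M).FG := fg_adjoin_of_finite ((Set.finite_singleton a).union (Set.finite_range b)) fun x hx => hintA x (hWS hx)
  obtain ⟨Fs, hFs⟩ := hMfg
  have hFsM : ∀ x ∈ Fs, x ∈ M := fun x hx => (by
    have : x ∈ Subalgebra.toSubmodule M := hFs ▸ Submodule.subset_span hx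
    exact this)
  let G : Finset (MvPolynomial (MV n m) K) := insert 1 (insert a (Fs ∪ Finset.univ.image b))
  have haM : a ∈ M := Algebra.subset_adjoin (Or.inl rfl)
  have hbM : ∀ i, b i ∈ M := fun i => Algebra.subset_adjoin (Or.inr ⟨i, rfl⟩)
  have hGM : ∀ x ∈ G, x ∈ M := by
    intro x hx
    simp only [G, Finset.mem_insert, Finset.mem_union, Finset.mem_image, Finset.mem_univ, true_and] at hx
    rcases hx with rfl | rfl | hx | ⟨i, rfl⟩
    exacts [one_mem M, haM, hFsM x hx, hbM i]
  let g : G → MvPolynomial (MV n m) K := Subtype.val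
  have hspan : ∀ x ∈ M, ∃ c : G → MvPolynomial (Fin d) K, ∑ l, c l • g l = x := by
    intro x hx
    refine (Submodule.mem_span_range_iff_exists_fun _).1 ?_
    have h1 : x ∈ Submodule.span (MvPolynomial (Fin d) K) (Fs : Set _) := by rw [hFs]; exact hx
    refine Submodule.span_mono (fun z hz => ?_) h1
    exact ⟨⟨z, by simp only [G, Finset.mem_insert, Finset.mem_union]; right; right; left; exact hz⟩, rfl⟩
  choose! co hco using hspan
  obtain ⟨s, hsi, hs⟩ := exists_maximal_linearIndepOn (MvPolynomial (Fin d) K) g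
  obtain ⟨J, rfl⟩ := (Set.toFinite s).exists_finset_coe
  have hs' : ∀ i, ∃ r : MvPolynomial (Fin d) K, r ≠ 0 ∧ r • g i ∈ Submodule.span (MvPolynomial (Fin d) K) (g '' J) := by
    intro i
    by_cases hi : i ∈ (J : Set G)
    · exact ⟨1, one_ne_zero, by rw [one_smul]; exact Submodule.subset_span ⟨i, hi, rfl⟩⟩
    · exact hs i hi
  choose r hr0 hr using hs'
  let c := ∏ i, r i
  have hc : ∀ l, ∃ t : J → MvPolynomial (Fin d) K, ∑ j, t j • g j.1 = c • g l := by
    intro l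
    refine (Submodule.mem_span_range_iff_exists_fun _).1 ?_
    have h1 : c • g l ∈ Submodule.span (MvPolynomial (Fin d) K) (g '' J) := by
      simp only [c]
      rw [← Finset.prod_erase_mul _ _ (Finset.mem_univ l), mul_smul]
      exact Submodule.smul_mem _ _ (hr l)
    have h2 : g '' J = Set.range fun j : J => g j.1 := by
      ext x; simp
    rwa [h2] at h1
  choose t ht using hc
  have hc0 : aeval y c ≠ 0 := by
    intro h0
    have : c = 0 := hyI (by rw [h0, map_zero])
    exact (Finset.prod_ne_zero_iff.2 fun i _ => hr0 i) this
  have hG1 : (1 : MvPolynomial (MV n m) K) ∈ G := by simp [G]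
  have hGa : a ∈ G := by simp [G]
  have hGb : ∀ i, b i ∈ G := fun i => by
    simp only [G, Finset.mem_insert, Finset.mem_union, Finset.mem_image, Finset.mem_univ, true_and]
    exact Or.inr (Or.inr (Or.inr ⟨i, rfl⟩))
  obtain ⟨S, hS1, hS2, hS3⟩ := spreadS hm y hyS hyD (ι := G) g (fun i => hMS (hGM i.1 i.2)) J
    (fun α hα => Fintype.linearIndependent_iff.1 hsi α hα) (fun i j => co (g i * g j))
    (fun i j => (hco _ (mul_mem (hGM i.1 i.2) (hGM j.1 j.2))).symm) ⟨1, hG1⟩ rfl c hc0 t (fun l => (ht l).symm) ⟨a, hGa⟩ (fun i => ⟨b i, hGb i⟩)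
    k I hkI hab had
  exact ⟨S, fun i => mem_S_iff_Lam.2 (hS2 i), hS3⟩

end wreg
end CMProof


namespace CMProof
section inhom
variable {K σ : Type} [Field K] {d D : ℕ}

def Fil (S : Subalgebra K (MvPolynomial σ K)) (e : ℕ) : Submodule K (MvPolynomial σ K) where
  carrier := {f | f ∈ S ∧ ∀ N, e ≤ N → homogeneousComponent N f = 0}
  add_mem' := fun {a b} ha hb => ⟨add_mem ha.1 hb.1, fun N hN => by rw [map_add, ha.2 N hN, hb.2 N hN, add_zero]⟩
  zero_mem' := ⟨zero_mem _, fun N _ => map_zero _⟩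
  smul_mem' := fun c x hx => ⟨Subalgebra.smul_mem _ hx.1 c, fun N hN => by rw [map_smul, hx.2 N hN, smul_zero]⟩

lemma Fil_mono {S : Subalgebra K (MvPolynomial σ K)} {e e' : ℕ} (h : e ≤ e') : Fil S e ≤ Fil S e' := fun _ hf => ⟨hf.1, fun N hN => hf.2 N (h.trans hN)⟩

lemma Fil_zero {S : Subalgebra K (MvPolynomial σ K)} {f : MvPolynomial σ K} (h : f ∈ Fil S 0) : f = 0 := by
  rw [← sum_homogeneousComponent f]
  exact Finset.sum_eq_zero fun i _ => h.2 i (Nat.zero_le i)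

lemma Fil_exists {S : Subalgebra K (MvPolynomial σ K)} {f : MvPolynomial σ K} (h : f ∈ S) : f ∈ Fil S (f.totalDegree + 1) :=
  ⟨h, fun N hN => homogeneousComponent_eq_zero N f (by omega)⟩

/-- regularity data -/
structure RD (S : Subalgebra K (MvPolynomial σ K)) (y : Fin d → MvPolynomial σ K) (D : ℕ) : Prop where
  hc : ∀ f ∈ S, ∀ N, homogeneousComponent N f ∈ S
  hy : ∀ i, y i ∈ S
  hD : 0 < D
  hom : ∀ i, (y i).IsHomogeneous D
  W : ∀ (k : Fin d) (I : Finset (Fin d)), k ∉ I → ∀ (e : ℕ) (a : MvPolynomial σ K), a ∈ S → a.IsHomogeneous e →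
    ∀ b : Fin d → MvPolynomial σ K, (∀ i, b i ∈ S) → y k * a = ∑ i ∈ I, y i * b i → ∃ s : Fin d → MvPolynomial σ K, (∀ i, s i ∈ S) ∧ a = ∑ i ∈ I, y i * s i

variable {S : Subalgebra K (MvPolynomial σ K)} {y : Fin d → MvPolynomial σ K} (α : Fin d → K)

lemma z_hc (h : RD S y D) {f : MvPolynomial σ K} {e : ℕ} (hf : f ∈ Fil S (e + 1)) (i : Fin d) :
    homogeneousComponent (e + D) ((y i - C (α i)) * f) = y i * homogeneousComponent e f := by
  have := h.hD
  rw [_root_.sub_mul, map_sub, hc_mul (h.hom i), if_pos (by omega), C_mul', map_smul, hf.2 (e + D) (by omega), smul_zero, sub_zero, Nat.add_sub_cancel]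

lemma z_S (h : RD S y D) (i : Fin d) : y i - C (α i) ∈ S := sub_mem (h.hy i) (S.algebraMap_mem (α i))

lemma z_Fil (h : RD S y D) {f : MvPolynomial σ K} {e : ℕ} (hf : f ∈ Fil S e) (i : Fin d) :
    (y i - C (α i)) * f ∈ Fil S (e + D) := by
  refine ⟨mul_mem (z_S α h i) hf.1, fun N hN => ?_⟩
  rw [_root_.sub_mul, map_sub, hc_mul (h.hom i), if_pos (by omega), C_mul', map_smul, hf.2 N (by omega), hf.2 (N - D) (by omega), smul_zero, mul_zero, sub_zero]

/-- removing the top part -/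
lemma top_drop (h : RD S y D) {k : Fin d} {I : Finset (Fin d)} (hk : k ∉ I) {e : ℕ} {a : MvPolynomial σ K} (ha : a ∈ Fil S (e + 1))
    {b : Fin d → MvPolynomial σ K} (hb : ∀ i, b i ∈ Fil S (e + 1))
    (hab : (y k - C (α k)) * a - ∑ i ∈ I, (y i - C (α i)) * b i ∈ Fil S (e + D)) :
    ∃ c : Fin d → MvPolynomial σ K, (∀ i, c i ∈ S) ∧ (∀ i, (y k - C (α k)) * c i ∈ Fil S (e + 1)) ∧ a - ∑ i ∈ I, (y i - C (α i)) * c i ∈ Fil S e := by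
  have h1 := hab.2 (e + D) le_rfl
  rw [map_sub, map_sum, z_hc α h ha, sub_eq_zero] at h1
  simp only [fun i => z_hc α h (hb i) i] at h1
  obtain ⟨s, hs, hs2⟩ := h.W k I hk e _ (h.hc a ha.1 e) (homogeneousComponent_isHomogeneous e a) _ (fun i => h.hc _ (hb i).1 e) h1
  have hD := h.hD
  by_cases he : D ≤ e
  · have hcF : ∀ i, homogeneousComponent (e - D) (s i) ∈ Fil S (e - D + 1) := fun i => ⟨h.hc _ (hs i) _, fun N hN => by
      rw [homogeneousComponent_of_mem (homogeneousComponent_isHomogeneous _ _), if_neg (by omega)]⟩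
    have hzF : ∀ j i, (y j - C (α j)) * homogeneousComponent (e - D) (s i) ∈ Fil S (e + 1) := fun j i => by
      have := z_Fil α h (hcF i) j
      rwa [show e - D + 1 + D = e + 1 by omega] at this
    refine ⟨fun i => homogeneousComponent (e - D) (s i), fun i => h.hc _ (hs i) _, fun i => hzF k i, ?_⟩
    have hF : a - ∑ i ∈ I, (y i - C (α i)) * homogeneousComponent (e - D) (s i) ∈ Fil S (e + 1) :=
      sub_mem ha (Submodule.sum_mem _ fun i _ => hzF i i)
    refine ⟨hF.1, fun N hN => ?_⟩
    rcases Nat.lt_or_ge e N with hN2 | hN2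
    · exact hF.2 N hN2
    · obtain rfl : N = e := by omega
      have h3 : ∀ i, homogeneousComponent N ((y i - C (α i)) * homogeneousComponent (N - D) (s i)) = y i * homogeneousComponent (N - D) (s i) := fun i => by
        have := z_hc α h (hcF i) i
        rwa [Nat.sub_add_cancel he, homogeneousComponent_of_mem (homogeneousComponent_isHomogeneous _ _), if_pos rfl] at this
      have h2 := congrArg (homogeneousComponent N) hs2
      rw [homogeneousComponent_of_mem (homogeneousComponent_isHomogeneous _ _), if_pos rfl, map_sum] at h2
      simp only [hc_mul (h.hom _), if_pos he] at h2
      rw [map_sub, map_sum, h2, sub_eq_zero]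
      exact Finset.sum_congr rfl fun i _ => (h3 i).symm
  · refine ⟨fun _ => 0, fun i => zero_mem _, fun i => by rw [mul_zero]; exact zero_mem _, ?_⟩
    simp only [mul_zero, Finset.sum_const_zero, sub_zero]
    refine ⟨ha.1, fun N hN => ?_⟩
    rcases Nat.lt_or_ge e N with hN2 | hN2
    · exact ha.2 N hN2
    · obtain rfl : N = e := by omega
      have h2 := congrArg (homogeneousComponent N) hs2
      rw [homogeneousComponent_of_mem (homogeneousComponent_isHomogeneous _ _), if_pos rfl, map_sum] at h2
      rw [h2]
      exact Finset.sum_eq_zero fun i _ => by rw [hc_mul (h.hom _), if_neg he]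

lemma lower (h : RD S y D) (I : Finset (Fin d)) : ∀ (e : ℕ) (b : Fin d → MvPolynomial σ K), (∀ i, b i ∈ Fil S (e + 1)) →
    ∑ i ∈ I, (y i - C (α i)) * b i ∈ Fil S (e + D) →
    ∃ b' : Fin d → MvPolynomial σ K, (∀ i, b' i ∈ Fil S e) ∧ ∑ i ∈ I, (y i - C (α i)) * b' i = ∑ i ∈ I, (y i - C (α i)) * b i := by
  classical
  induction I using Finset.induction_on with
  | empty => exact fun e b _ _ => ⟨0, fun i => zero_mem _, by simp⟩
  | insert k I hk ih =>
    intro e b hb hsum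
    rw [Finset.sum_insert hk] at hsum
    obtain ⟨c, hc1, hc2, hc3⟩ := top_drop α h hk (hb k) (b := fun i => - b i) (fun i => neg_mem (hb i))
      (by simpa only [mul_neg, Finset.sum_neg_distrib, sub_neg_eq_add] using hsum)
    have hid : ∑ i ∈ I, (y i - C (α i)) * (b i + (y k - C (α k)) * c i) =
        ((y k - C (α k)) * b k + ∑ i ∈ I, (y i - C (α i)) * b i) - (y k - C (α k)) * (b k - ∑ i ∈ I, (y i - C (α i)) * c i) := by
      have : ∀ i, (y i - C (α i)) * (b i + (y k - C (α k)) * c i) = (y i - C (α i)) * b i + (y k - C (α k)) * ((y i - C (α i)) * c i) := fun i => by ring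
      simp only [this, Finset.sum_add_distrib, ← Finset.mul_sum]
      ring
    obtain ⟨b', hb', hb2⟩ := ih e (fun i => b i + (y k - C (α k)) * c i) (fun i => add_mem (hb i) (hc2 i))
      (by rw [hid]; exact sub_mem hsum (z_Fil α h hc3 k))
    refine ⟨fun i => if i = k then b k - ∑ i ∈ I, (y i - C (α i)) * c i else b' i, fun i => ?_, ?_⟩
    · dsimp only; split_ifs
      exacts [hc3, hb' i]
    · rw [Finset.sum_insert hk, Finset.sum_insert hk]
      dsimp only
      rw [if_pos rfl]
      have : ∑ i ∈ I, (y i - C (α i)) * (if i = k then b k - ∑ i ∈ I, (y i - C (α i)) * c i else b' i) = ∑ i ∈ I, (y i - C (α i)) * b' i :=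
        Finset.sum_congr rfl fun i hi => by rw [if_neg (fun hik : i = k => hk (hik ▸ hi))]
      rw [this, hb2, hid]
      ring

lemma lower' (h : RD S y D) (I : Finset (Fin d)) (e j : ℕ) : ∀ (b : Fin d → MvPolynomial σ K), (∀ i, b i ∈ Fil S (e + j)) →
    ∑ i ∈ I, (y i - C (α i)) * b i ∈ Fil S (e + D) →
    ∃ b' : Fin d → MvPolynomial σ K, (∀ i, b' i ∈ Fil S e) ∧ ∑ i ∈ I, (y i - C (α i)) * b' i = ∑ i ∈ I, (y i - C (α i)) * b i := by
  induction j with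
  | zero => exact fun b hb _ => ⟨b, hb, rfl⟩
  | succ j ih =>
    intro b hb hs
    obtain ⟨b', h1, h2⟩ := lower α h I (e + j) b hb (Fil_mono (by omega) hs)
    obtain ⟨b2, h3, h4⟩ := ih b' h1 (h2 ▸ hs)
    exact ⟨b2, h3, h4.trans h2⟩

theorem wreg_inhom (h : RD S y D) {k : Fin d} {I : Finset (Fin d)} (hk : k ∉ I) (e : ℕ) : ∀ a ∈ Fil S e, ∀ b : Fin d → MvPolynomial σ K, (∀ i, b i ∈ S) →
    (y k - C (α k)) * a = ∑ i ∈ I, (y i - C (α i)) * b i → ∃ s : Fin d → MvPolynomial σ K, (∀ i, s i ∈ S) ∧ a = ∑ i ∈ I, (y i - C (α i)) * s i := by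
  induction e with
  | zero => exact fun a ha b _ _ => ⟨0, fun i => zero_mem _, by simp [Fil_zero ha]⟩
  | succ e ih =>
    intro a ha b hb hab
    let j := ∑ i, ((b i).totalDegree + 1)
    obtain ⟨b', hb', hb2⟩ := lower' α h I (e + 1) j b (fun i => Fil_mono
      ((Finset.single_le_sum (f := fun i => (b i).totalDegree + 1) (fun _ _ => Nat.zero_le _) (Finset.mem_univ i)).trans (Nat.le_add_left _ _)) (Fil_exists (hb i)))
      (by rw [← hab]; exact z_Fil α h ha k)
    obtain ⟨c, hc1, hc2, hc3⟩ := top_drop α h hk ha hb' (by rw [hab, hb2, sub_self]; exact zero_mem _)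
    obtain ⟨s, hs1, hs2⟩ := ih _ hc3 (fun i => b i - (y k - C (α k)) * c i) (fun i => sub_mem (hb i) (mul_mem (z_S α h k) (hc1 i))) (by
      rw [_root_.mul_sub, hab, Finset.mul_sum, ← Finset.sum_sub_distrib]
      exact Finset.sum_congr rfl fun i _ => by ring)
    refine ⟨fun i => s i + c i, fun i => add_mem (hs1 i) (hc1 i), ?_⟩
    simp only [_root_.mul_add, Finset.sum_add_distrib, ← hs2]
    ring
end inhom
end CMProof


namespace CMProof
open scoped Pointwise
section concl

lemma len_le : ∀ (l : ℕ) (R : Type) [CommRing R] (rs : List R), rs.length = l → RingTheory.Sequence.IsRegular R rs →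
    (l : WithBot (WithTop ℕ)) ≤ ringKrullDim R := by
  intro l
  induction l with
  | zero =>
    intro R _ rs _ h
    have : Nontrivial R := h.nontrivial
    exact ringKrullDim_nonneg_of_nontrivial
  | succ l ih =>
    intro R _ rs hl h
    obtain ⟨r, rs, rfl⟩ : ∃ r t, rs = r :: t := List.exists_cons_of_length_eq_add_one hl
    rw [RingTheory.Sequence.isRegular_cons_iff'] at h
    obtain ⟨h1, h2⟩ := h
    have he : (r • ⊤ : Submodule R R) = (Ideal.span {r} : Ideal R) := by
      rw [← Submodule.ideal_span_singleton_smul, smul_eq_mul, Ideal.mul_top]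
    let e : QuotSMulTop r R ≃ₗ[R] (R ⧸ Ideal.span {r}) := Submodule.quotEquivOfEq _ _ he
    have h3 : RingTheory.Sequence.IsRegular (R ⧸ Ideal.span {r}) (rs.map (Ideal.Quotient.mk (Ideal.span {r}))) := by
      refine (AddEquiv.isRegular_congr (e := e.toAddEquiv) ?_).1 h2
      refine List.forall₂_same.mpr fun s _ x => ?_
      obtain ⟨s, rfl⟩ := Ideal.Quotient.mk_surjective s
      exact e.map_smul s x
    have h4 := ih (R ⧸ Ideal.span {r}) _ (by simpa using hl) h3
    have h5 : r ∈ nonZeroDivisors R := by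
      rw [mem_nonZeroDivisors_iff_right]
      intro x hx
      exact h1 (by simpa [mul_comm] using hx)
    refine le_trans ?_ (ringKrullDim_quotient_succ_le_of_nonZeroDivisor h5)
    rw [Nat.cast_succ]
    exact add_le_add_left h4 1

lemma dim_le {A B : Type} [CommRing A] [CommRing B] (f : A →+* B) (hf : f.IsIntegral) : ringKrullDim B ≤ ringKrullDim A := by
  letI := f.toAlgebra
  have : Algebra.IsIntegral A B := ⟨hf⟩
  refine Order.krullDim_le_of_strictMono (PrimeSpectrum.comap f) ?_
  intro I J h
  exact Ideal.IsIntegral.comap_lt_comap (R := A) h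

/-- the general conclusion -/
theorem cm_of_RD {K σ : Type} [Field K] [IsAlgClosed K] {d D : ℕ} {S : Subalgebra K (MvPolynomial σ K)} {y : Fin d → MvPolynomial σ K}
    (h : RD S y D) (hyI : AlgebraicIndependent K y)
    (hint : ∀ f ∈ S, IsIntegral (Algebra.adjoin K (Set.range y)) f) : IsCohenMacaulayRing S := by
  classical
  let ψ : MvPolynomial (Fin d) K →ₐ[K] S := aeval fun i => ⟨y i, h.hy i⟩
  have hψv : ∀ r, ((ψ r : S) : MvPolynomial σ K) = aeval y r := by
    intro r
    have : S.val.comp ψ = aeval y := by ext i; simp [ψ]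
    exact DFunLike.congr_fun this r
  have hψ : ψ.toRingHom.IsIntegral := by
    intro f
    letI : Algebra (MvPolynomial (Fin d) K) (MvPolynomial σ K) := (aeval (R := K) y).toRingHom.toAlgebra
    have h1 : IsIntegral (MvPolynomial (Fin d) K) (f : MvPolynomial σ K) := by
      refine IsIntegral.map_of_comp_eq (T := MvPolynomial (Fin d) K) (S := MvPolynomial σ K) (U := MvPolynomial σ K) hyI.aevalEquiv.symm.toRingEquiv.toRingHom (RingHom.id _) ?_ (hint f f.2)
      refine RingHom.ext fun x => ?_
      obtain ⟨z, rfl⟩ := hyI.aevalEquiv.surjective x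
      simp [RingHom.algebraMap_toAlgebra, hyI.algebraMap_aevalEquiv]
    obtain ⟨q, hq, hq2⟩ := h1
    refine ⟨q, hq, Subtype.val_injective ?_⟩
    have h2 := Polynomial.hom_eval₂ q ψ.toRingHom S.val.toRingHom f
    have h3 : S.val.toRingHom.comp ψ.toRingHom = (aeval (R := K) y).toRingHom := RingHom.ext hψv
    rw [h3] at h2
    exact h2.trans hq2
  intro p hp
  haveI := hp.isPrime
  have hdim : ringKrullDim (Localization.AtPrime p) ≤ d := by
    rw [IsLocalization.AtPrime.ringKrullDim_eq_height p (Localization.AtPrime p)]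
    refine (Ideal.height_le_ringKrullDim_of_ne_top hp.ne_top).trans ((dim_le _ hψ).trans ?_)
    rw [MvPolynomial.ringKrullDim_of_isNoetherianRing, ringKrullDim_eq_zero_of_field]
    simp
  have hmax := Ideal.isMaximal_comap_of_isIntegral_of_isMaximal' ψ.toRingHom hψ p
  obtain ⟨α, hα⟩ := MvPolynomial.eq_vanishingIdeal_singleton_of_isMaximal K hmax
  let z : Fin d → S := fun i => ⟨y i - C (α i), z_S α h i⟩
  have hz : ∀ i, z i ∈ p := by
    intro i
    have h1 : (X i - C (α i) : MvPolynomial (Fin d) K) ∈ Ideal.comap ψ.toRingHom p := by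
      rw [hα, MvPolynomial.mem_vanishingIdeal_singleton_iff]; simp
    have h2 : ψ (X i - C (α i)) = z i := Subtype.ext (by rw [hψv]; simp [z])
    rw [← h2]; exact h1
  have hreg : RingTheory.Sequence.IsWeaklyRegular S (List.ofFn z) := by
    rw [RingTheory.Sequence.isWeaklyRegular_iff]
    intro i hi
    have hid : i < d := by simpa using hi
    rw [isSMulRegular_quotient_iff_mem_of_smul_mem]
    intro a ha
    have hI : (Ideal.ofList ((List.ofFn z).take i) • ⊤ : Submodule S S) = Ideal.span (z '' ↑(Finset.univ.filter fun j : Fin d => (j : ℕ) < i)) := by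
      rw [smul_eq_mul, Ideal.mul_top]
      unfold Ideal.ofList
      congr 1
      ext x
      simp only [Set.mem_ofPred_eq, List.mem_take_iff_getElem, List.getElem_ofFn, Set.mem_image, Finset.coe_filter, Finset.mem_univ, true_and]
      constructor
      · rintro ⟨j, hj, rfl⟩
        exact ⟨⟨j, by simp at hj; omega⟩, by simp at hj ⊢; omega, rfl⟩
      · rintro ⟨j, hj, rfl⟩
        exact ⟨j, by simp [hj], rfl⟩
    rw [hI] at ha ⊢
    rw [List.getElem_ofFn] at ha
    rw [Submodule.mem_span_image_finset_iff_exists_fun] at ha ⊢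
    obtain ⟨c0, hc⟩ := ha
    let c : Fin d → S := fun j => if hj : j ∈ Finset.univ.filter (fun j : Fin d => (j : ℕ) < i) then c0 ⟨j, hj⟩ else 0
    have hc2 : (y ⟨i, hid⟩ - C (α ⟨i, hid⟩)) * (a : MvPolynomial σ K) = ∑ j ∈ Finset.univ.filter (fun j : Fin d => (j : ℕ) < i), (y j - C (α j)) * (c j : MvPolynomial σ K) := by
      have := congrArg (fun x : S => (x : MvPolynomial σ K)) hc
      simp only [AddSubmonoidClass.coe_finsetSum, smul_eq_mul, MulMemClass.coe_mul] at this
      refine this.symm.trans ?_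
      rw [← Finset.sum_coe_sort (Finset.univ.filter (fun j : Fin d => (j : ℕ) < i))]
      refine Finset.sum_congr rfl fun j _ => ?_
      rw [show c j = c0 j from dif_pos j.2]
      exact mul_comm _ _
    obtain ⟨s, hs, hs2⟩ := wreg_inhom α h (k := ⟨i, hid⟩) (by simp) _ a (Fil_exists a.2) (fun j => c j) (fun j => (c j).2) hc2
    refine ⟨fun j => ⟨s j, hs j⟩, Subtype.ext ?_⟩
    simp only [AddSubmonoidClass.coe_finsetSum, smul_eq_mul, MulMemClass.coe_mul]
    rw [hs2, ← Finset.sum_coe_sort (Finset.univ.filter (fun j : Fin d => (j : ℕ) < i))]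
    exact Finset.sum_congr rfl fun j _ => mul_comm _ _
  have hmem : ∀ r ∈ List.ofFn z, r ∈ p := by
    intro r hr
    obtain ⟨i, rfl⟩ := (List.mem_ofFn' _ _).1 hr
    exact hz i
  have hreg2 := hreg.isRegular_of_isLocalization_of_mem (Localization.AtPrime p) p hmem
  apply le_antisymm
  · refine sSup_le ?_
    rintro _ ⟨rs, rfl, h1, -⟩
    exact len_le _ _ rs rfl h1
  · refine hdim.trans (le_sSup ⟨_, ?_, hreg2, ?_⟩)
    · rw [List.length_map, List.length_ofFn]; rfl
    · intro r hr
      obtain ⟨s, hs, rfl⟩ := List.mem_map.1 hr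
      exact (IsLocalization.AtPrime.to_map_mem_maximal_iff _ p s).2 (hmem s hs)

theorem main (K : Type) [Field K] [IsAlgClosed K] (n m : ℕ) (hn : 0 < n) (hm : 0 < m) :
    IsCohenMacaulayRing ↥(matrixInvariants K n m) := by
  classical
  have hinf : Infinite K := IsAlgClosed.instInfinite
  obtain ⟨d, D, y, hD, hyS, hyD, hyI, hint⟩ := hsop (K := K) (n := n) (m := m) hn
  refine cm_of_RD (D := D) (y := y) ⟨fun f hf N => hc_mem hf N, hyS, hD, hyD, ?_⟩ hyI hint
  intro k I hk e a ha hae b hb hab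
  obtain ⟨s, hs, hs2⟩ := wreg_hom hm y hyS hyD hyI hint k I hk a ha hae b hb hab
  refine ⟨fun i => if hi : i ∈ I then s ⟨i, hi⟩ else 0, fun i => ?_, ?_⟩
  · dsimp only; split_ifs
    exacts [hs _, zero_mem _]
  · rw [hs2, ← Finset.sum_coe_sort I]
    exact Finset.sum_congr rfl fun i _ => by dsimp only; rw [dif_pos i.2]

end concl
end CMProof

/-- The ring of matrix invariants `S(n,m)` is Cohen-Macaulay in arbitrary
characteristic. -/
theorem stmt_11 (K : Type) [Field K] [IsAlgClosed K] (n m : ℕ) (hn : 0 < n) (hm : 0 < m) :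
    IsCohenMacaulayRing ↥(matrixInvariants K n m) := by
  exact CMProof.main K n m hn hm
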